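/- Let d ≥ 1, let V : ℝ^d → ℝ be smooth with e^{−V} Lebesgue-integrable, let μ be the probability measure with density proportional to e^{−V}, and assume there exists ρ ∈ ℝ such that ∇²V(x) ≥ ρ I_d for all x. Let a : ℝ^d → ℝ be smooth, positive and non-decreasing (∂_i a ≥ 0 everywhere for every i), satisfying: (G) |∇a|/a is bounded; and (BM) with V_a = V + log(a²), for all i ≠ j one has ∂²_{ij}V_a ≤ 0 everywhere, and for each i the function Σ_{j=1}^d ∂²_{ij}V_a is bounded above. Define κ̃_a = inf_{x ∈ ℝ^d} { ρ_−(∇²V(x)) − a(x)·L(a^{−1})(x) } and assume κ̃_a > 0. Then for every smooth positive non-decreasing function f : ℝ^d → ℝ (with ∂_i f ≥ 0 everywhere for every i, and such that f² log(f²), f² and |∇f|² are μ-integrable), one has Ent_μ(f²) ≤ (2/κ̃_a) ∫_{ℝ^d} |∇f|² dμ. -/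

import Mathlib

open Real MeasureTheory Finset Matrix Set

noncomputable section

/-- Partial derivative of `f` in the `i`-th coordinate direction. -/
def pd {d : ℕ} (i : Fin d) (f : EuclideanSpace ℝ (Fin d) → ℝ)
    (x : EuclideanSpace ℝ (Fin d)) : ℝ :=
  fderiv ℝ f x (EuclideanSpace.single i 1)

/-- Laplacian of `f`. -/
def lap {d : ℕ} (f : EuclideanSpace ℝ (Fin d) → ℝ) (x : EuclideanSpace ℝ (Fin d)) : ℝ :=
  ∑ i, pd i (fun y => pd i f y) x

/-- Diffusion operator `L f = Δ f - ∇V ⋅ ∇f` associated with the potential `V`. -/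
def diffOp {d : ℕ} (V f : EuclideanSpace ℝ (Fin d) → ℝ) (x : EuclideanSpace ℝ (Fin d)) : ℝ :=
  lap f x - ∑ i, pd i V x * pd i f x

/-- Hessian matrix of `V` at `x`. -/
def hess {d : ℕ} (V : EuclideanSpace ℝ (Fin d) → ℝ) (x : EuclideanSpace ℝ (Fin d)) :
    Matrix (Fin d) (Fin d) ℝ :=
  Matrix.of fun i j => pd i (fun y => pd j V y) x

/-- Smallest (real) eigenvalue of a matrix: the infimum of its real spectrum. -/
def minEig {d : ℕ} (A : Matrix (Fin d) (Fin d) ℝ) : ℝ :=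
  sInf (spectrum ℝ A)

/-- The probability measure with density proportional to `exp (-V)` w.r.t. Lebesgue measure. -/
def gibbs {d : ℕ} (V : EuclideanSpace ℝ (Fin d) → ℝ) : Measure (EuclideanSpace ℝ (Fin d)) :=
  (∫⁻ x, ENNReal.ofReal (Real.exp (-V x)))⁻¹ •
    volume.withDensity fun x => ENNReal.ofReal (Real.exp (-V x))

/-- Entropy of `g` with respect to the measure `μ`. -/
def entropy {d : ℕ} (μ : Measure (EuclideanSpace ℝ (Fin d)))
    (g : EuclideanSpace ℝ (Fin d) → ℝ) : ℝ :=
  ∫ x, g x * Real.log (g x) ∂μ - (∫ x, g x ∂μ) * Real.log (∫ x, g x ∂μ)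

/-- Squared Euclidean norm of the gradient of `f` at `x`. -/
def gradSq {d : ℕ} (f : EuclideanSpace ℝ (Fin d) → ℝ) (x : EuclideanSpace ℝ (Fin d)) : ℝ :=
  ∑ i, (pd i f x) ^ 2

end


set_option linter.unusedSectionVars false
set_option linter.unusedVariables false

namespace Grid

section general
variable {d : ℕ} {G : Type} [Fintype G] [AddCommGroup G]

/-- discrete generator with weights `m` and conductances `c` -/
noncomputable def gn (e : Fin d → G) (m : G → ℝ) (c : Fin d → G → ℝ) (g : G → ℝ) (x : G) : ℝ :=
  (m x)⁻¹ * ∑ i, (c i x * (g (x + e i) - g x) + c i (x - e i) * (g (x - e i) - g x))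

/-- Dirichlet form -/
def En (e : Fin d → G) (c : Fin d → G → ℝ) (f g : G → ℝ) : ℝ :=
  ∑ i, ∑ x, c i x * (f (x + e i) - f x) * (g (x + e i) - g x)

/-- explicit Euler step -/
noncomputable def stp (e : Fin d → G) (m : G → ℝ) (c : Fin d → G → ℝ) (τ : ℝ) (g : G → ℝ) (x : G) : ℝ :=
  g x + τ * gn e m c g x

variable {e : Fin d → G} {m : G → ℝ} {c : Fin d → G → ℝ} {τ rr : ℝ}

lemma sum_shift (a : G) (f : G → ℝ) : ∑ x, f (x - a) = ∑ x, f x :=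
  Equiv.sum_comp (Equiv.subRight a) f

lemma sum_shift' (a : G) (f : G → ℝ) : ∑ x, f (x + a) = ∑ x, f x :=
  Equiv.sum_comp (Equiv.addRight a) f

lemma ibp (hm : ∀ x, 0 < m x) (f g : G → ℝ) :
    ∑ x, m x * f x * gn e m c g x = - En e c f g := by
  have h1 : ∀ x, m x * f x * gn e m c g x =
      ∑ i, (f x * (c i x * (g (x + e i) - g x)) + f x * (c i (x - e i) * (g (x - e i) - g x))) := by
    intro x
    have := (hm x).ne'
    simp only [gn]
    rw [← mul_assoc, mul_comm (m x * f x), ← mul_assoc, inv_mul_cancel₀ this, one_mul, Finset.mul_sum]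
    exact Finset.sum_congr rfl fun i _ => by ring
  simp_rw [h1]
  rw [Finset.sum_comm, En, ← Finset.sum_neg_distrib]
  refine Finset.sum_congr rfl fun i _ => ?_
  rw [Finset.sum_add_distrib]
  have := sum_shift' (e i) (fun x => f x * (c i (x - e i) * (g (x - e i) - g x)))
  rw [← this, ← Finset.sum_add_distrib, ← Finset.sum_neg_distrib]
  refine Finset.sum_congr rfl fun x _ => ?_
  simp only [add_sub_cancel_right]
  ring

lemma gn_add (f g : G → ℝ) (x : G) :
    gn e m c (fun y => f y + g y) x = gn e m c f x + gn e m c g x := by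
  simp only [gn]; rw [← mul_add, ← Finset.sum_add_distrib]
  congr 1; exact Finset.sum_congr rfl fun i _ => by ring

lemma gn_sub (f g : G → ℝ) (x : G) :
    gn e m c (fun y => f y - g y) x = gn e m c f x - gn e m c g x := by
  simp only [gn]; rw [← mul_sub, ← Finset.sum_sub_distrib]
  congr 1; exact Finset.sum_congr rfl fun i _ => by ring

lemma gn_smul (s : ℝ) (f : G → ℝ) (x : G) :
    gn e m c (fun y => s * f y) x = s * gn e m c f x := by
  simp only [gn]
  rw [mul_left_comm]
  congr 1; rw [Finset.mul_sum]; exact Finset.sum_congr rfl fun i _ => by ring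

lemma gn_const (s : ℝ) (x : G) : gn e m c (fun _ => s) x = 0 := by
  simp [gn]

lemma stp_const (s : ℝ) (x : G) : stp e m c τ (fun _ => s) x = s := by
  simp [stp, gn_const]

lemma stp_sub (f g : G → ℝ) (x : G) :
    stp e m c τ (fun y => f y - g y) x = stp e m c τ f x - stp e m c τ g x := by
  simp only [stp, gn_sub]; ring

lemma stp_add (f g : G → ℝ) (x : G) :
    stp e m c τ (fun y => f y + g y) x = stp e m c τ f x + stp e m c τ g x := by
  simp only [stp, gn_add]; ring

lemma stp_smul (s : ℝ) (f : G → ℝ) (x : G) :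
    stp e m c τ (fun y => s * f y) x = s * stp e m c τ f x := by
  simp only [stp, gn_smul]; ring

lemma sum_stp (hm : ∀ x, 0 < m x) (g : G → ℝ) :
    ∑ x, m x * stp e m c τ g x = ∑ x, m x * g x := by
  have := ibp (e := e) (c := c) hm (fun _ => 1) g
  simp only [En, sub_self, mul_zero, zero_mul, Finset.sum_const_zero, neg_zero, mul_one] at this
  simp only [stp, mul_add, Finset.sum_add_distrib]
  have h2 : ∑ x, m x * (τ * gn e m c g x) = τ * ∑ x, m x * gn e m c g x := by
    rw [Finset.mul_sum]; exact Finset.sum_congr rfl fun i _ => by ring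
  rw [h2, this]; ring

/-- rate bound -/
def Rate (e : Fin d → G) (m : G → ℝ) (c : Fin d → G → ℝ) (rr : ℝ) : Prop :=
  ∀ x, ∑ i, (c i x + c i (x - e i)) ≤ rr * m x

lemma stp_nonneg (hm : ∀ x, 0 < m x) (hc : ∀ i x, 0 ≤ c i x) (hr : Rate e m c rr)
    (hτ : 0 ≤ τ) (hτr : τ * rr ≤ 1) {g : G → ℝ} (hg : ∀ x, 0 ≤ g x) (x : G) :
    0 ≤ stp e m c τ g x := by
  have h1 : - (rr * g x) ≤ gn e m c g x := by
    have : - (∑ i, (c i x + c i (x - e i)) * g x) ≤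
      ∑ i, (c i x * (g (x + e i) - g x) + c i (x - e i) * (g (x - e i) - g x)) := by
      rw [← Finset.sum_neg_distrib]
      refine Finset.sum_le_sum fun i _ => ?_
      have := mul_nonneg (hc i x) (hg (x + e i))
      have := mul_nonneg (hc i (x - e i)) (hg (x - e i))
      nlinarith
    rw [← Finset.sum_mul] at this
    have h2 := mul_le_mul_of_nonneg_right (hr x) (hg x)
    rw [gn, inv_mul_eq_div, le_div_iff₀ (hm x)]
    nlinarith
  have := mul_le_mul_of_nonneg_left h1 hτ
  have h3 := mul_le_mul_of_nonneg_right hτr (hg x)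
  simp only [stp]; nlinarith

lemma stp_mono (hm : ∀ x, 0 < m x) (hc : ∀ i x, 0 ≤ c i x) (hr : Rate e m c rr)
    (hτ : 0 ≤ τ) (hτr : τ * rr ≤ 1) {f g : G → ℝ} (hg : ∀ x, f x ≤ g x) (x : G) :
    stp e m c τ f x ≤ stp e m c τ g x := by
  have := stp_nonneg hm hc hr hτ hτr (g := fun y => g y - f y) (fun y => sub_nonneg.2 (hg y)) x
  rw [stp_sub] at this; linarith

lemma stp_ge (hm : ∀ x, 0 < m x) (hc : ∀ i x, 0 ≤ c i x) (hr : Rate e m c rr)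
    (hτ : 0 ≤ τ) (hτr : τ * rr ≤ 1) {b : ℝ} {g : G → ℝ} (hg : ∀ x, b ≤ g x) (x : G) :
    b ≤ stp e m c τ g x := by
  have := stp_mono hm hc hr hτ hτr (f := fun _ => b) hg x
  rwa [stp_const] at this

lemma stp_le (hm : ∀ x, 0 < m x) (hc : ∀ i x, 0 ≤ c i x) (hr : Rate e m c rr)
    (hτ : 0 ≤ τ) (hτr : τ * rr ≤ 1) {b : ℝ} {g : G → ℝ} (hg : ∀ x, g x ≤ b) (x : G) :
    stp e m c τ g x ≤ b := by
  have := stp_mono hm hc hr hτ hτr (g := fun _ => b) hg x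
  rwa [stp_const] at this

lemma stp_sum {ι : Type} (s : Finset ι) (f : ι → G → ℝ) (x : G) :
    stp e m c τ (fun y => ∑ i ∈ s, f i y) x = ∑ i ∈ s, stp e m c τ (f i) x := by
  classical
  induction s using Finset.induction_on with
  | empty => simpa using stp_const (e := e) (m := m) (c := c) (τ := τ) 0 x
  | insert a s ha ih =>
    simp only [Finset.sum_insert ha, ← ih]
    exact stp_add _ _ x

lemma cone (hm : ∀ x, 0 < m x) (hc : ∀ i x, 0 ≤ c i x) (hr : Rate e m c rr)
    (hτ : 0 ≤ τ) (hτr : τ * rr ≤ 1) {w : Fin d → G → ℝ} {h q : G → ℝ} {b : ℝ} (hb : 0 < b)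
    (hh : ∀ x, b ≤ h x) (hq : ∀ x, 0 ≤ q x)
    (hw : ∀ x, ∑ i, (w i x) ^ 2 ≤ h x * q x) (x : G) :
    ∑ i, (stp e m c τ (w i) x) ^ 2 ≤ stp e m c τ h x * stp e m c τ q x := by
  set H := stp e m c τ h x with hH
  have hHp : 0 < H := lt_of_lt_of_le hb (stp_ge hm hc hr hτ hτr hh x)
  set B : Fin d → ℝ := fun i => stp e m c τ (w i) x with hB
  set N := ∑ i, (B i) ^ 2 with hN
  have hN0 : 0 ≤ N := Finset.sum_nonneg fun i _ => sq_nonneg _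
  -- pointwise
  have key : ∀ y, ∑ i, (2 * B i) * w i y ≤ (N / H) * h y + H * q y := by
    intro y
    have hhy : 0 < h y := lt_of_lt_of_le hb (hh y)
    have hcs : (∑ i, B i * w i y) ^ 2 ≤ N * ∑ i, (w i y) ^ 2 :=
      Finset.sum_mul_sq_le_sq_mul_sq _ _ _
    have h2 : (∑ i, B i * w i y) ^ 2 ≤ N * (h y * q y) :=
      hcs.trans (mul_le_mul_of_nonneg_left (hw y) hN0)
    have e1 : ∑ i, (2 * B i) * w i y = 2 * ∑ i, B i * w i y := by
      rw [Finset.mul_sum]; exact Finset.sum_congr rfl fun i _ => by ring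
    rw [e1]
    refine (abs_le_of_sq_le_sq' (a := 2 * ∑ i, B i * w i y) (b := (N / H) * h y + H * q y) ?_ ?_).2
    · have e2 : ((N / H) * h y + H * q y) ^ 2 = ((N / H) * h y - H * q y) ^ 2 + 4 * (N * (h y * q y)) := by
        field_simp; ring
      rw [e2]; nlinarith [sq_nonneg ((N / H) * h y - H * q y)]
    · have := hq y
      positivity
  have h3 := stp_mono hm hc hr hτ hτr key x
  rw [stp_sum, stp_add, stp_smul, stp_smul] at h3
  simp only [stp_smul] at h3
  rw [← hH, div_mul_cancel₀ _ hHp.ne'] at h3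
  have e3 : ∑ i, 2 * B i * stp e m c τ (w i) x = 2 * N := by
    rw [hN, Finset.mul_sum]; exact Finset.sum_congr rfl fun i _ => by simp only [hB]; ring
  rw [e3] at h3
  linarith

lemma En_nonneg (hc : ∀ i x, 0 ≤ c i x) (f : G → ℝ) : 0 ≤ En e c f f := by
  refine Finset.sum_nonneg fun i _ => Finset.sum_nonneg fun x _ => ?_
  rw [mul_assoc]; exact mul_nonneg (hc i x) (mul_self_nonneg _)

lemma En_le (hc : ∀ i x, 0 ≤ c i x) (hr : Rate e m c rr) (f : G → ℝ) :
    En e c f f ≤ 2 * rr * ∑ x, m x * f x ^ 2 := by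
  have h1 : En e c f f ≤ ∑ i, ∑ x, (2 * (c i x * f x ^ 2) + 2 * (c i x * f (x + e i) ^ 2)) := by
    refine Finset.sum_le_sum fun i _ => Finset.sum_le_sum fun x _ => ?_
    nlinarith [mul_nonneg (hc i x) (sq_nonneg (f (x + e i) + f x))]
  refine h1.trans ?_
  have h2 : ∀ i, ∑ x, (2 * (c i x * f x ^ 2) + 2 * (c i x * f (x + e i) ^ 2)) =
      ∑ x, 2 * ((c i x + c i (x - e i)) * f x ^ 2) := by
    intro i
    rw [Finset.sum_add_distrib]
    rw [← sum_shift (e i) (fun x => 2 * (c i x * f (x + e i) ^ 2)), ← Finset.sum_add_distrib]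
    refine Finset.sum_congr rfl fun x _ => ?_
    simp only [sub_add_cancel]; ring
  simp_rw [h2]
  rw [Finset.sum_comm, Finset.mul_sum]
  refine Finset.sum_le_sum fun x _ => ?_
  rw [← Finset.mul_sum, ← Finset.sum_mul]
  have := mul_le_mul_of_nonneg_right (hr x) (sq_nonneg (f x))
  nlinarith

lemma En_expand (f g : G → ℝ) (s : ℝ) :
    En e c (fun y => f y + s * g y) (fun y => f y + s * g y) =
      En e c f f + 2 * s * En e c g f + s ^ 2 * En e c g g := by
  simp only [En, Finset.mul_sum, ← Finset.sum_add_distrib]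
  refine Finset.sum_congr rfl fun i _ => Finset.sum_congr rfl fun x _ => ?_
  ring

lemma ibp_gn (hm : ∀ x, 0 < m x) (w : G → ℝ) :
    En e c (gn e m c w) w = - ∑ x, m x * gn e m c w x ^ 2 := by
  rw [← neg_eq_iff_eq_neg, ← ibp hm]
  exact Finset.sum_congr rfl fun x _ => by ring

lemma gn_sq_le (hm : ∀ x, 0 < m x) (hc : ∀ i x, 0 ≤ c i x) (hr : Rate e m c rr) (hrr : 0 < rr)
    (w : G → ℝ) : ∑ x, m x * gn e m c w x ^ 2 ≤ 2 * rr * En e c w w := by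
  have h0 := En_nonneg (e := e) hc (fun y => w y + (1 / (2 * rr)) * gn e m c w y)
  rw [En_expand, ibp_gn hm] at h0
  have h1 := En_le (e := e) hc hr (gn e m c w)
  set X := ∑ x, m x * gn e m c w x ^ 2
  have h2 : (1 / (2 * rr)) ^ 2 * En e c (gn e m c w) (gn e m c w) ≤ (1 / (2 * rr)) ^ 2 * (2 * rr * X) :=
    mul_le_mul_of_nonneg_left h1 (sq_nonneg _)
  have h3 : (1 / (2 * rr)) ^ 2 * (2 * rr * X) = X / (2 * rr) := by field_simp
  have h4 : 2 * (1 / (2 * rr)) * -X = - 2 * (X / (2 * rr)) := by field_simp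
  rw [h4] at h0
  have h5 : X / (2 * rr) ≤ En e c w w := by linarith
  rw [div_le_iff₀ (by positivity)] at h5
  linarith

lemma stp_sq_le (hm : ∀ x, 0 < m x) (hc : ∀ i x, 0 ≤ c i x) (hr : Rate e m c rr) (hrr : 0 < rr)
    (hτ : 0 ≤ τ) (hτr : 2 * τ * rr ≤ 1) (w : G → ℝ) :
    ∑ x, m x * stp e m c τ w x ^ 2 ≤ ∑ x, m x * w x ^ 2 - τ * En e c w w := by
  have h1 := gn_sq_le hm hc hr hrr w
  have h2 := ibp (e := e) (c := c) hm w w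
  have h3 : ∑ x, m x * stp e m c τ w x ^ 2 = ∑ x, m x * w x ^ 2 +
      2 * τ * ∑ x, m x * w x * gn e m c w x + τ ^ 2 * ∑ x, m x * gn e m c w x ^ 2 := by
    simp only [Finset.mul_sum, ← Finset.sum_add_distrib]
    exact Finset.sum_congr rfl fun x _ => by simp only [stp]; ring
  rw [h3, h2]
  have h4 := mul_le_mul_of_nonneg_left h1 (sq_nonneg τ)
  have h5 := mul_nonneg hτ (En_nonneg (e := e) hc w)
  nlinarith

lemma En_stp_le (hm : ∀ x, 0 < m x) (hc : ∀ i x, 0 ≤ c i x) (hr : Rate e m c rr)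
    (hτ : 0 ≤ τ) (hτr : 2 * τ * rr ≤ 1) (w : G → ℝ) :
    En e c (stp e m c τ w) (stp e m c τ w) ≤ En e c w w := by
  have h0 := En_expand (e := e) (c := c) w (gn e m c w) τ
  have h1 := En_le (e := e) hc hr (gn e m c w)
  have h2 := ibp_gn (e := e) (c := c) hm w
  have h3 : stp e m c τ w = fun y => w y + τ * gn e m c w y := rfl
  rw [h3, h0, h2]
  have h4 := mul_le_mul_of_nonneg_left h1 (sq_nonneg τ)
  have h5 : 0 ≤ τ * ∑ x, m x * gn e m c w x ^ 2 :=
    mul_nonneg hτ (Finset.sum_nonneg fun x _ => mul_nonneg (hm x).le (sq_nonneg _))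
  nlinarith

end general

end Grid

set_option linter.unusedSectionVars false
set_option linter.unusedVariables false

namespace Grid

/-- grid data -/
structure GD (d : ℕ) (G : Type) [AddCommGroup G] where
  e : Fin d → G
  η : ℝ
  k : Fin d → G → ℝ
  V : G → ℝ
  al : G → ℝ

section conc
variable {d : ℕ} {G : Type} [Fintype G] [AddCommGroup G]

namespace GD

/-- perturbed potential -/
def Va (D : GD d G) (x : G) : ℝ := D.V x + 2 * D.al x
/-- weight of a potential -/
noncomputable def w (D : GD d G) (U : G → ℝ) (x : G) : ℝ := Real.exp (-U x)
/-- conductance of a potential -/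
noncomputable def c (D : GD d G) (U : G → ℝ) (i : Fin d) (x : G) : ℝ :=
  D.η⁻¹ ^ 2 * D.k i x * Real.exp (-(U x + U (x + D.e i)) / 2)
/-- forward rate -/
noncomputable def p (D : GD d G) (U : G → ℝ) (i : Fin d) (x : G) : ℝ :=
  D.η⁻¹ ^ 2 * D.k i x * Real.exp ((U x - U (x + D.e i)) / 2)
/-- backward rate -/
noncomputable def q (D : GD d G) (U : G → ℝ) (i : Fin d) (x : G) : ℝ :=
  D.η⁻¹ ^ 2 * D.k i (x - D.e i) * Real.exp ((U x - U (x - D.e i)) / 2)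

/-- generator -/
noncomputable def L (D : GD d G) (U : G → ℝ) (g : G → ℝ) (x : G) : ℝ := gn D.e (D.w U) (D.c U) g x
/-- step -/
noncomputable def S (D : GD d G) (U : G → ℝ) (τ : ℝ) (g : G → ℝ) (x : G) : ℝ :=
  stp D.e (D.w U) (D.c U) τ g x
/-- energy -/
noncomputable def E (D : GD d G) (U : G → ℝ) (f g : G → ℝ) : ℝ := En D.e (D.c U) f g
/-- discrete gradient times a -/
noncomputable def v (D : GD d G) (g : G → ℝ) (i : Fin d) (x : G) : ℝ :=
  D.k i x * Real.exp (D.al x) * ((g (x + D.e i) - g x) / D.η)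

/-- basic hypotheses -/
structure Ok (D : GD d G) (ε rr : ℝ) : Prop where
  hη : 0 < D.η
  hk : ∀ i x, D.k i x = 0 ∨ D.k i x = 1
  hkk : ∀ i j, i ≠ j → ∀ x, D.k i (x + D.e j) = D.k i x
  hal : ∀ i x, D.k i x = 1 → D.al x ≤ D.al (x + D.e i)
  hsub : ∀ i j, i ≠ j → ∀ x, D.k i x = 1 → D.k j x = 1 →
    D.Va (x + D.e i + D.e j) + D.Va x ≤ D.Va (x + D.e i) + D.Va (x + D.e j)
  hε0 : 0 ≤ ε
  hε1 : ε ≤ 1 / 10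
  hVe : ∀ i x, D.k i x = 1 → |D.V (x + D.e i) - D.V x| ≤ ε
  hae : ∀ i x, D.k i x = 1 → |D.al (x + D.e i) - D.al x| ≤ ε
  hrr : 0 < rr
  hrV : Rate D.e (D.w D.V) (D.c D.V) rr
  hra : Rate D.e (D.w D.Va) (D.c D.Va) rr

variable {D : GD d G} {ε rr τ : ℝ}

lemma w_pos (D : GD d G) (U : G → ℝ) (x : G) : 0 < D.w U x := Real.exp_pos _

lemma Ok.k0 (h : D.Ok ε rr) (i : Fin d) (x : G) : 0 ≤ D.k i x := by
  rcases h.hk i x with h | h <;> rw [h] <;> norm_num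

lemma Ok.k1 (h : D.Ok ε rr) (i : Fin d) (x : G) : D.k i x ≤ 1 := by
  rcases h.hk i x with h | h <;> rw [h] <;> norm_num

lemma Ok.ksq (h : D.Ok ε rr) (i : Fin d) (x : G) : D.k i x ^ 2 = D.k i x := by
  rcases h.hk i x with h | h <;> rw [h] <;> norm_num

lemma Ok.hkk' (h : D.Ok ε rr) (i j : Fin d) (hij : i ≠ j) (x : G) :
    D.k i (x - D.e j) = D.k i x := by
  have := h.hkk i j hij (x - D.e j)
  rw [sub_add_cancel] at this; exact this.symm

lemma Ok.c0 (h : D.Ok ε rr) (U : G → ℝ) (i : Fin d) (x : G) : 0 ≤ D.c U i x := by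
  have := h.k0 i x
  unfold c; positivity

lemma Ok.p0 (h : D.Ok ε rr) (U : G → ℝ) (i : Fin d) (x : G) : 0 ≤ D.p U i x := by
  have := h.k0 i x
  unfold p; positivity

lemma Ok.q0 (h : D.Ok ε rr) (U : G → ℝ) (i : Fin d) (x : G) : 0 ≤ D.q U i x := by
  have := h.k0 i (x - D.e i)
  unfold q; positivity

lemma c_p (D : GD d G) (U : G → ℝ) (i : Fin d) (x : G) : (D.w U x)⁻¹ * D.c U i x = D.p U i x := by
  simp only [w, c, p, ← Real.exp_neg]
  rw [mul_left_comm, ← Real.exp_add]; congr 2; ring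

lemma c_q (D : GD d G) (U : G → ℝ) (i : Fin d) (x : G) :
    (D.w U x)⁻¹ * D.c U i (x - D.e i) = D.q U i x := by
  simp only [w, c, q, ← Real.exp_neg, sub_add_cancel]
  rw [mul_left_comm, ← Real.exp_add]; congr 2; ring

lemma L_eq (D : GD d G) (U g : G → ℝ) (x : G) : D.L U g x =
    ∑ j, (D.p U j x * (g (x + D.e j) - g x) + D.q U j x * (g (x - D.e j) - g x)) := by
  simp only [L, gn, ← c_p, ← c_q, Finset.mul_sum]
  exact Finset.sum_congr rfl fun i _ => by ring

lemma rate_pq (D : GD d G) (U : G → ℝ) (h : Rate D.e (D.w U) (D.c U) rr) (x : G) :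
    ∑ j, (D.p U j x + D.q U j x) ≤ rr := by
  have h1 := h x
  have h2 : ∑ j, (D.p U j x + D.q U j x) = (D.w U x)⁻¹ * ∑ i, (D.c U i x + D.c U i (x - D.e i)) := by
    simp only [← c_p, ← c_q, Finset.mul_sum, mul_add]
  rw [h2, inv_mul_eq_div, div_le_iff₀ (D.w_pos U x)]; exact h1

/-- monotone along edges -/
def Mon (D : GD d G) (g : G → ℝ) : Prop := ∀ i x, D.k i x = 1 → g x ≤ g (x + D.e i)

lemma Ok.mon_step (h : D.Ok ε rr) (hτ : 0 ≤ τ) (hτr : 2 * τ * rr ≤ 1) {g : G → ℝ} (hg : D.Mon g) :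
    D.Mon (D.S D.Va τ g) := by
  intro i x hi
  set y := x + D.e i with hy
  set u := g y - g x with hu
  have hu0 : 0 ≤ u := sub_nonneg.2 (hg i x hi)
  -- termwise bound
  have key : ∀ j, -((D.p D.Va j x + D.q D.Va j x + (D.p D.Va j y + D.q D.Va j y)) * u) ≤
      (D.p D.Va j y * (g (y + D.e j) - g y) + D.q D.Va j y * (g (y - D.e j) - g y)) -
      (D.p D.Va j x * (g (x + D.e j) - g x) + D.q D.Va j x * (g (x - D.e j) - g x)) := by
    intro j
    have hpx := h.p0 D.Va j x
    have hpy := h.p0 D.Va j y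
    have hqx := h.q0 D.Va j x
    have hqy := h.q0 D.Va j y
    by_cases hij : j = i
    · subst hij
      -- forward at y nonneg, backward at x nonneg
      have a1 : 0 ≤ D.p D.Va j y * (g (y + D.e j) - g y) := by
        rcases h.hk j y with h0 | h0
        · simp [p, h0]
        · exact mul_nonneg hpy (sub_nonneg.2 (hg j y h0))
      have a2 : D.q D.Va j x * (g (x - D.e j) - g x) ≤ 0 := by
        rcases h.hk j (x - D.e j) with h0 | h0
        · simp [q, h0]
        · have := hg j _ h0
          rw [sub_add_cancel] at this
          exact mul_nonpos_of_nonneg_of_nonpos hqx (by linarith)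
      have a3 : g (y - D.e j) = g x := by rw [hy, add_sub_cancel_right]
      rw [a3]
      have a4 : g (x + D.e j) - g x = u := rfl
      rw [a4]
      nlinarith [mul_nonneg hqx hu0, mul_nonneg hpy hu0, mul_nonneg hpx hu0, mul_nonneg hqy hu0]
    · -- j ≠ i
      have hkjy : D.k j y = D.k j x := h.hkk j i hij x
      have b1 : -(D.p D.Va j x * u) ≤ D.p D.Va j y * (g (y + D.e j) - g y) - D.p D.Va j x * (g (x + D.e j) - g x) := by
        rcases h.hk j x with h0 | h0
        · have : D.p D.Va j x = 0 := by simp [p, h0]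
          have h' : D.p D.Va j y = 0 := by simp [p, hkjy, h0]
          rw [this, h']; simp
        · have hm1 : g y ≤ g (y + D.e j) := hg j y (hkjy.trans h0)
          have hm2 : g (x + D.e j) ≤ g (y + D.e j) := by
            have := hg i (x + D.e j) ((h.hkk i j (Ne.symm hij) x).trans hi)
            rwa [add_right_comm] at this
          have hp : D.p D.Va j x ≤ D.p D.Va j y := by
            simp only [p, hkjy, h0]
            have hs := h.hsub i j (Ne.symm hij) x hi h0
            have : (D.Va x - D.Va (x + D.e j)) / 2 ≤ (D.Va y - D.Va (y + D.e j)) / 2 := by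
              rw [hy]; linarith
            gcongr
          have := mul_le_mul_of_nonneg_right hp (sub_nonneg.2 hm1)
          have h3 : D.p D.Va j x * (g (x + D.e j)) ≤ D.p D.Va j x * g (y + D.e j) :=
            mul_le_mul_of_nonneg_left hm2 hpx
          rw [hu]; nlinarith
      have b2 : -(D.q D.Va j x * u) ≤ D.q D.Va j y * (g (y - D.e j) - g y) - D.q D.Va j x * (g (x - D.e j) - g x) := by
        have hk1 : D.k j (y - D.e j) = D.k j (x - D.e j) := by
          rw [hy, add_sub_right_comm]; exact h.hkk j i hij _
        rcases h.hk j (x - D.e j) with h0 | h0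
        · have : D.q D.Va j x = 0 := by simp [q, h0]
          have h' : D.q D.Va j y = 0 := by simp [q, hk1, h0]
          rw [this, h']; simp
        · have hki : D.k i (x - D.e j) = 1 := (h.hkk' i j (Ne.symm hij) x).trans hi
          have hm1 : g (y - D.e j) ≤ g y := by
            have := hg j _ (hk1.trans h0)
            rwa [sub_add_cancel] at this
          have hm2 : g (x - D.e j) ≤ g (y - D.e j) := by
            have := hg i (x - D.e j) hki
            rwa [← add_sub_right_comm] at this
          have hq : D.q D.Va j y ≤ D.q D.Va j x := by
            simp only [q, hk1, h0]
            have hs := h.hsub i j (Ne.symm hij) (x - D.e j) hki h0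
            have e1 : x - D.e j + D.e i + D.e j = y := by rw [hy]; abel
            have e2 : x - D.e j + D.e i = y - D.e j := by rw [hy]; abel
            rw [e1, e2, sub_add_cancel] at hs
            have : (D.Va y - D.Va (y - D.e j)) / 2 ≤ (D.Va x - D.Va (x - D.e j)) / 2 := by
              linarith
            gcongr
          have := mul_le_mul_of_nonneg_right hq (sub_nonneg.2 hm1)
          have h3 : D.q D.Va j x * (g (x - D.e j)) ≤ D.q D.Va j x * g (y - D.e j) :=
            mul_le_mul_of_nonneg_left hm2 hqx
          rw [hu]; nlinarith
      nlinarith [mul_nonneg hpy hu0, mul_nonneg hqy hu0]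
  have hL : -(2 * rr * u) ≤ D.L D.Va g y - D.L D.Va g x := by
    rw [L_eq, L_eq, ← Finset.sum_sub_distrib]
    refine le_trans ?_ (Finset.sum_le_sum fun j _ => key j)
    rw [Finset.sum_neg_distrib, ← Finset.sum_mul, Finset.sum_add_distrib]
    have h1 := D.rate_pq D.Va h.hra x
    have h2 := D.rate_pq D.Va h.hra y
    have := mul_le_mul_of_nonneg_right (add_le_add h1 h2) hu0
    linarith
  change g x + τ * D.L D.Va g x ≤ g y + τ * D.L D.Va g y
  have h1 := mul_le_mul_of_nonneg_left hL hτ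
  have h2 := mul_le_mul_of_nonneg_right hτr hu0
  have h3 : u = g y - g x := hu
  nlinarith

lemma Ok.L_ge (h : D.Ok ε rr) {g : G → ℝ} (hg : D.Mon g) (x : G) : D.L D.Va g x ≤ D.L D.V g x := by
  rw [L_eq, L_eq]
  refine Finset.sum_le_sum fun j _ => ?_
  have h1 : D.p D.Va j x * (g (x + D.e j) - g x) ≤ D.p D.V j x * (g (x + D.e j) - g x) := by
    rcases h.hk j x with h0 | h0
    · simp [p, h0]
    · refine mul_le_mul_of_nonneg_right ?_ (sub_nonneg.2 (hg j x h0))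
      have := h.hal j x h0
      simp only [p, h0, Va]
      gcongr ?_ * Real.exp ?_
      linarith
  have h2 : D.q D.Va j x * (g (x - D.e j) - g x) ≤ D.q D.V j x * (g (x - D.e j) - g x) := by
    rcases h.hk j (x - D.e j) with h0 | h0
    · simp [q, h0]
    · have h3 := hg j _ h0
      rw [sub_add_cancel] at h3
      refine mul_le_mul_of_nonpos_right ?_ (sub_nonpos.2 h3)
      have := h.hal j _ h0
      rw [sub_add_cancel] at this
      simp only [q, h0, Va]
      gcongr ?_ * Real.exp ?_
      linarith
  linarith

/-- iterates -/
noncomputable def it (D : GD d G) (U : G → ℝ) (τ : ℝ) (F : G → ℝ) : ℕ → G → ℝ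
  | 0 => F
  | n + 1 => D.S U τ (it D U τ F n)

lemma Ok.it_bd (h : D.Ok ε rr) (U : G → ℝ) (hr : Rate D.e (D.w U) (D.c U) rr) (hτ : 0 ≤ τ)
    (hτr : 2 * τ * rr ≤ 1) {F : G → ℝ} {b C : ℝ} (hF : ∀ x, b ≤ F x ∧ F x ≤ C) (n : ℕ) :
    ∀ x, b ≤ D.it U τ F n x ∧ D.it U τ F n x ≤ C := by
  have hτ' : τ * rr ≤ 1 := by nlinarith [mul_nonneg hτ h.hrr.le]
  induction n with
  | zero => exact hF
  | succ n ih =>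
    exact fun x => ⟨stp_ge (D.w_pos U) (h.c0 U) hr hτ hτ' (fun y => (ih y).1) x,
      stp_le (D.w_pos U) (h.c0 U) hr hτ hτ' (fun y => (ih y).2) x⟩

lemma Ok.it_mon (h : D.Ok ε rr) (hτ : 0 ≤ τ) (hτr : 2 * τ * rr ≤ 1) {F : G → ℝ} (hF : D.Mon F)
    (n : ℕ) : D.Mon (D.it D.Va τ F n) := by
  induction n with
  | zero => exact hF
  | succ n ih => exact h.mon_step hτ hτr ih

lemma Ok.it_comp (h : D.Ok ε rr) (hτ : 0 ≤ τ) (hτr : 2 * τ * rr ≤ 1) {F : G → ℝ} (hF : D.Mon F)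
    (n : ℕ) : ∀ x, D.it D.Va τ F n x ≤ D.it D.V τ F n x := by
  have hτ' : τ * rr ≤ 1 := by nlinarith [mul_nonneg hτ h.hrr.le]
  induction n with
  | zero => exact fun x => le_rfl
  | succ n ih =>
    intro x
    have h1 : D.S D.V τ (D.it D.Va τ F n) x ≤ D.S D.V τ (D.it D.V τ F n) x :=
      stp_mono (D.w_pos _) (h.c0 _) h.hrV hτ hτ' ih x
    refine le_trans ?_ h1
    have h2 := mul_le_mul_of_nonneg_left (h.L_ge (h.it_mon hτ hτr hF n) x) hτ
    exact add_le_add_right h2 _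

end GD
end conc
end Grid

set_option linter.unusedSectionVars false
set_option linter.unusedVariables false

namespace Grid
section conc
variable {d : ℕ} {G : Type} [Fintype G] [AddCommGroup G]
namespace GD
variable {D : GD d G} {ε rr τ : ℝ}

/-- consistency error matrix -/
noncomputable def Z (D : GD d G) (M : G → Fin d → Fin d → ℝ) (i j : Fin d) (x : G) : ℝ :=
  (D.p D.V j (x + D.e i) - D.p D.V j x) +
  (D.q D.V j x - D.q D.V j (x + D.e i)) * Real.exp (D.al x - D.al (x - D.e j)) + M x i j +
  if i = j then ∑ l, (D.p D.V l (x + D.e i) * (Real.exp (D.al x - D.al (x + D.e l)) - 1) +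
    D.q D.V l (x + D.e i) * (Real.exp (D.al x - D.al (x - D.e l)) - 1)) else 0

/-- cutoff / consistency hypotheses -/
structure Ok2 (D : GD d G) (M : G → Fin d → Fin d → ℝ) (χ : G → ℝ) (ε K R : ℝ) : Prop where
  h0 : ∀ x, 0 ≤ χ x
  h1 : ∀ x, χ x ≤ 1
  hL : ∀ i x, D.k i x = 1 → |χ (x + D.e i) - χ x| ≤ D.η / R
  hk : ∀ x, χ x ≠ 0 → ∀ i, D.k i x = 1 ∧ D.k i (x - D.e i) = 1 ∧ D.k i (x + D.e i) = 1
  hR : 1 ≤ R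
  hMp : ∀ x (y : Fin d → ℝ), 0 ≤ ∑ i, y i * ∑ j, M x i j * y j
  hP : ∀ x, χ x ≠ 0 → ∀ i j, |(D.p D.V j (x + D.e i) - D.p D.V j x) *
    Real.exp (D.al x - D.al (x + D.e j))| ≤ K
  hQ : ∀ x, χ x ≠ 0 → ∀ i j, |(D.q D.V j (x + D.e i) - D.q D.V j x) *
    Real.exp (D.al x - D.al (x - D.e j))| ≤ K
  hZ : ∀ x, χ x ≠ 0 → ∀ i j, |D.Z M i j x| ≤ ε
  hK : 0 ≤ K
  hθ : K * D.η * (8 * (1 + d)) ≤ ε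

variable {M : G → Fin d → Fin d → ℝ} {χ : G → ℝ} {K R : ℝ}

/-- `a ∇ L g` -/
noncomputable def vL (D : GD d G) (g : G → ℝ) (i : Fin d) (x : G) : ℝ :=
  Real.exp (D.al x) * ((D.L D.V g (x + D.e i) - D.L D.V g x) / D.η)

lemma Va_p (D : GD d G) (j : Fin d) (x : G) :
    D.p D.Va j x = D.p D.V j x * Real.exp (D.al x - D.al (x + D.e j)) := by
  simp only [p, Va]; rw [mul_assoc (_ * _), ← Real.exp_add]; congr 2; ring

lemma Va_q (D : GD d G) (j : Fin d) (x : G) :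
    D.q D.Va j x = D.q D.V j x * Real.exp (D.al x - D.al (x - D.e j)) := by
  simp only [q, Va]; rw [mul_assoc (_ * _), ← Real.exp_add]; congr 2; ring

lemma interior (h : D.Ok ε rr) (h2 : D.Ok2 M χ ε K R) (g : G → ℝ) (i : Fin d) (x : G)
    (hx : χ x ≠ 0) :
    |D.vL g i x - D.L D.Va (D.v g i) x + ∑ j, M x i j * D.v g j x| ≤
      (∑ j, (K * |D.v g i (x + D.e j) - D.v g i x| + K * |D.v g i (x - D.e j) - D.v g i x| +
        K * |D.v g j (x - D.e j) - D.v g j x|)) + ∑ j, ε * |D.v g j x| := by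
  have hkx : ∀ j, D.k j x = 1 := fun j => (h2.hk x hx j).1
  have hkp : ∀ i j, D.k i (x + D.e j) = 1 := by
    intro i j
    by_cases hij : i = j
    · subst hij; exact (h2.hk x hx i).2.2
    · rw [h.hkk i j hij]; exact hkx i
  have hkm : ∀ i j, D.k i (x - D.e j) = 1 := by
    intro i j
    by_cases hij : i = j
    · subst hij; exact (h2.hk x hx i).2.1
    · rw [h.hkk' i j hij]; exact hkx i
  have v1 : ∀ i, D.v g i x = Real.exp (D.al x) * ((g (x + D.e i) - g x) / D.η) := by
    intro i; simp [v, hkx]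
  have v2 : ∀ i j, Real.exp (D.al x - D.al (x + D.e j)) * D.v g i (x + D.e j) =
      Real.exp (D.al x) * ((g (x + D.e j + D.e i) - g (x + D.e j)) / D.η) := by
    intro i j; simp only [v, hkp, one_mul, ← mul_assoc, ← Real.exp_add]; congr 3; ring
  have v3 : ∀ i j, Real.exp (D.al x - D.al (x - D.e j)) * D.v g i (x - D.e j) =
      Real.exp (D.al x) * ((g (x - D.e j + D.e i) - g (x - D.e j)) / D.η) := by
    intro i j; simp only [v, hkm, one_mul, ← mul_assoc, ← Real.exp_add]; congr 3; ring
  have key : D.vL g i x - D.L D.Va (D.v g i) x + ∑ j, M x i j * D.v g j x =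
      (∑ j, ((D.p D.V j (x + D.e i) - D.p D.V j x) * Real.exp (D.al x - D.al (x + D.e j)) *
          (D.v g i (x + D.e j) - D.v g i x) +
        (D.q D.V j (x + D.e i) - D.q D.V j x) * Real.exp (D.al x - D.al (x - D.e j)) *
          (D.v g i (x - D.e j) - D.v g i x) -
        (D.q D.V j (x + D.e i) - D.q D.V j x) * Real.exp (D.al x - D.al (x - D.e j)) *
          (D.v g j (x - D.e j) - D.v g j x))) + ∑ j, D.Z M i j x * D.v g j x := by
    have e1 : D.vL g i x = ∑ j, Real.exp (D.al x) / D.η *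
      (D.p D.V j (x + D.e i) * (g (x + D.e i + D.e j) - g (x + D.e i)) +
       D.q D.V j (x + D.e i) * (g (x + D.e i - D.e j) - g (x + D.e i)) -
       (D.p D.V j x * (g (x + D.e j) - g x) + D.q D.V j x * (g (x - D.e j) - g x))) := by
      rw [← Finset.mul_sum, Finset.sum_sub_distrib, ← L_eq, ← L_eq, vL]; ring
    have e2 : ∑ j, D.Z M i j x * D.v g j x = ∑ j, (((D.p D.V j (x + D.e i) - D.p D.V j x) +
      (D.q D.V j x - D.q D.V j (x + D.e i)) * Real.exp (D.al x - D.al (x - D.e j)) + M x i j)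
        * D.v g j x + (D.p D.V j (x + D.e i) * (Real.exp (D.al x - D.al (x + D.e j)) - 1) +
    D.q D.V j (x + D.e i) * (Real.exp (D.al x - D.al (x - D.e j)) - 1)) * D.v g i x) := by
      simp only [Z, add_mul (_ + _ + M x i _), ite_mul, zero_mul]
      rw [Finset.sum_add_distrib, Finset.sum_ite_eq, if_pos (Finset.mem_univ i),
        Finset.sum_mul, ← Finset.sum_add_distrib]
    rw [e1, e2, L_eq, ← Finset.sum_sub_distrib, ← Finset.sum_add_distrib, ← Finset.sum_add_distrib]
    refine Finset.sum_congr rfl fun j _ => ?_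
    rw [Va_p, Va_q]
    have w1 := v1 i
    have w1j := v1 j
    have w2 := v2 i j
    have w3 := v3 i j
    have w3j := v3 j j
    rw [sub_add_cancel] at w3j
    rw [add_right_comm x (D.e j)] at w2
    rw [← add_sub_right_comm] at w3
    set A := Real.exp (D.al x)
    set Ap := Real.exp (D.al x - D.al (x + D.e j))
    set Am := Real.exp (D.al x - D.al (x - D.e j))
    set P := D.p D.V j x
    set P' := D.p D.V j (x + D.e i)
    set Q := D.q D.V j x
    set Q' := D.q D.V j (x + D.e i)
    linear_combination (-P') * w2 + (-Q') * w3 + (P' + Q') * w1 + (-(P' - P)) * w1j + (-(Q - Q')) * w3j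
  rw [key]
  refine (abs_add_le _ _).trans (add_le_add ?_ ?_)
  · refine (Finset.abs_sum_le_sum_abs _ _).trans (Finset.sum_le_sum fun j _ => ?_)
    refine (abs_sub _ _).trans (add_le_add ((abs_add_le _ _).trans (add_le_add ?_ ?_)) ?_)
    · rw [abs_mul]; exact mul_le_mul_of_nonneg_right (h2.hP x hx i j) (abs_nonneg _)
    · rw [abs_mul]; exact mul_le_mul_of_nonneg_right (h2.hQ x hx i j) (abs_nonneg _)
    · rw [abs_mul]; exact mul_le_mul_of_nonneg_right (h2.hQ x hx i j) (abs_nonneg _)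
  · refine (Finset.abs_sum_le_sum_abs _ _).trans (Finset.sum_le_sum fun j _ => ?_)
    rw [abs_mul]; exact mul_le_mul_of_nonneg_right (h2.hZ x hx i j) (abs_nonneg _)

end GD
end conc
end Grid

set_option linter.unusedSectionVars false
set_option linter.unusedVariables false

namespace Grid

lemma scalar_edge {K η χ χ' z b b' Δt : ℝ} (hK : 0 ≤ K) (hη : 0 < η) (h0 : 0 ≤ χ) (h1 : χ ≤ 1)
    (hχ : |χ' - χ| ≤ η) :
    χ ^ 2 * (|z| * (K * |b' - b + Δt|)) ≤
      K * η / 2 * (3 * z ^ 2 + η⁻¹ ^ 2 * (χ' * b' - χ * b) ^ 2 + b' ^ 2 + η⁻¹ ^ 2 * Δt ^ 2) := by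
  have e1 : χ * |b' - b + Δt| ≤ |χ' * b' - χ * b| + η * |b'| + |Δt| := by
    have : χ * |b' - b + Δt| = |(χ' * b' - χ * b) - (χ' - χ) * b' + χ * Δt| := by
      rw [← abs_of_nonneg h0, ← abs_mul, abs_of_nonneg h0]; congr 1; ring
    rw [this]
    refine (abs_add_le _ _).trans (add_le_add ((abs_sub _ _).trans (add_le_add le_rfl ?_)) ?_)
    · rw [abs_mul]; exact mul_le_mul_of_nonneg_right hχ (abs_nonneg _)
    · rw [abs_mul, abs_of_nonneg h0]; exact mul_le_of_le_one_left (abs_nonneg _) h1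
  have e2 : χ ^ 2 * (|z| * (K * |b' - b + Δt|)) ≤ K * (|z| * (χ * |b' - b + Δt|)) := by
    have : χ ^ 2 * (|z| * (K * |b' - b + Δt|)) = χ * (K * (|z| * (χ * |b' - b + Δt|))) := by ring
    rw [this]; exact mul_le_of_le_one_left (by positivity) h1
  refine e2.trans ?_
  have am : ∀ X : ℝ, |z| * |X| ≤ η / 2 * (z ^ 2 + η⁻¹ ^ 2 * X ^ 2) := by
    intro X
    have h3 : |z| * |X| = η * (|z| * (η⁻¹ * |X|)) := by field_simp
    rw [h3, ← sq_abs z, ← sq_abs X]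
    nlinarith [mul_nonneg hη.le (sq_nonneg (|z| - η⁻¹ * |X|))]
  have a1 := am (χ' * b' - χ * b)
  have a2 := am Δt
  have a3 : |z| * (η * |b'|) ≤ η / 2 * (z ^ 2 + b' ^ 2) := by
    rw [← sq_abs z, ← sq_abs b']; nlinarith [mul_nonneg hη.le (sq_nonneg (|z| - |b'|))]
  have a4 := mul_le_mul_of_nonneg_left e1 (abs_nonneg z)
  have a5 : |z| * (χ * |b' - b + Δt|) ≤
    η / 2 * (3 * z ^ 2 + η⁻¹ ^ 2 * (χ' * b' - χ * b) ^ 2 + b' ^ 2 + η⁻¹ ^ 2 * Δt ^ 2) := by linarith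
  have := mul_le_mul_of_nonneg_left a5 hK
  linarith

section conc
variable {d : ℕ} {G : Type} [Fintype G] [AddCommGroup G]
namespace GD
variable {D : GD d G} {ε rr τ : ℝ} {M : G → Fin d → Fin d → ℝ} {χ : G → ℝ} {K R : ℝ}

lemma exp_le_two {t : ℝ} (ht : t ≤ 1 / 2) : Real.exp t ≤ 2 := by
  have : t ≤ Real.log 2 := by have := Real.log_two_gt_d9; linarith
  calc Real.exp t ≤ Real.exp (Real.log 2) := Real.exp_le_exp.2 this
    _ = 2 := Real.exp_log (by norm_num)

lemma Ok.dVa (h : D.Ok ε rr) (i : Fin d) (x : G) (hk : D.k i x = 1) :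
    |D.Va (x + D.e i) - D.Va x| ≤ 3 / 10 := by
  have h1 := h.hVe i x hk
  have h2 := h.hae i x hk
  have h3 := h.hε1
  simp only [Va]
  rw [abs_le] at *
  constructor <;> linarith [h1.1, h1.2, h2.1, h2.2]

lemma exp_two_le {s t : ℝ} (h : s - t ≤ 1 / 2) : Real.exp s ≤ 2 * Real.exp t := by
  have : Real.exp s = Real.exp (s - t) * Real.exp t := by rw [← Real.exp_add]; congr 1; ring
  rw [this]; exact mul_le_mul_of_nonneg_right (exp_le_two h) (Real.exp_pos _).le

lemma Ok.w_le_c (h : D.Ok ε rr) (i : Fin d) (x : G) (hk : D.k i x = 1) :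
    D.w D.Va x * D.η⁻¹ ^ 2 ≤ 2 * D.c D.Va i x := by
  have := h.dVa i x hk
  rw [abs_le] at this
  have h1 : Real.exp (-D.Va x) ≤ 2 * Real.exp (-(D.Va x + D.Va (x + D.e i)) / 2) :=
    exp_two_le (by linarith [this.1, this.2])
  simp only [w, c, hk]
  have := mul_le_mul_of_nonneg_left h1 (sq_nonneg D.η⁻¹)
  linarith

lemma Ok.w_le_c' (h : D.Ok ε rr) (i : Fin d) (x : G) (hk : D.k i x = 1) :
    D.w D.Va (x + D.e i) * D.η⁻¹ ^ 2 ≤ 2 * D.c D.Va i x := by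
  have := h.dVa i x hk
  rw [abs_le] at this
  have h1 : Real.exp (-D.Va (x + D.e i)) ≤ 2 * Real.exp (-(D.Va x + D.Va (x + D.e i)) / 2) :=
    exp_two_le (by linarith [this.1, this.2])
  simp only [w, c, hk]
  have := mul_le_mul_of_nonneg_left h1 (sq_nonneg D.η⁻¹)
  linarith

lemma Ok.w_le_w (h : D.Ok ε rr) (i : Fin d) (x : G) (hk : D.k i x = 1) :
    D.w D.Va x ≤ 2 * D.w D.Va (x + D.e i) := by
  have := h.dVa i x hk
  rw [abs_le] at this
  exact exp_two_le (by linarith [this.1, this.2])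

lemma Ok.w_le_w' (h : D.Ok ε rr) (i : Fin d) (x : G) (hk : D.k i x = 1) :
    D.w D.Va (x + D.e i) ≤ 2 * D.w D.Va x := by
  have := h.dVa i x hk
  rw [abs_le] at this
  exact exp_two_le (by linarith [this.1, this.2])

/-- weighted square norm, scalar -/
noncomputable def N (D : GD d G) (f : G → ℝ) : ℝ := ∑ x, D.w D.Va x * f x ^ 2
/-- weighted square norm, vector -/
noncomputable def nn (D : GD d G) (f : Fin d → G → ℝ) : ℝ := ∑ i, D.N (f i)
/-- energy in one direction -/
noncomputable def E1 (D : GD d G) (j : Fin d) (f : G → ℝ) : ℝ :=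
  ∑ x, D.c D.Va j x * (f (x + D.e j) - f x) ^ 2
/-- total energy, vector -/
noncomputable def EE (D : GD d G) (f : Fin d → G → ℝ) : ℝ := ∑ i, ∑ j, D.E1 j (f i)

lemma EE_eq (D : GD d G) (f : Fin d → G → ℝ) : D.EE f = ∑ i, D.E D.Va (f i) (f i) := by
  simp only [EE, E, En, E1]
  exact Finset.sum_congr rfl fun i _ => Finset.sum_congr rfl fun j _ =>
    Finset.sum_congr rfl fun x _ => by ring

lemma N_nonneg (D : GD d G) (f : G → ℝ) : 0 ≤ D.N f :=
  Finset.sum_nonneg fun x _ => mul_nonneg (D.w_pos _ x).le (sq_nonneg _)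
lemma nn_nonneg (D : GD d G) (f : Fin d → G → ℝ) : 0 ≤ D.nn f :=
  Finset.sum_nonneg fun x _ => D.N_nonneg _
lemma Ok.E1_nonneg (h : D.Ok ε rr) (j : Fin d) (f : G → ℝ) : 0 ≤ D.E1 j f :=
  Finset.sum_nonneg fun x _ => mul_nonneg (h.c0 _ j x) (sq_nonneg _)
lemma Ok.EE_nonneg (h : D.Ok ε rr) (f : Fin d → G → ℝ) : 0 ≤ D.EE f :=
  Finset.sum_nonneg fun x _ => Finset.sum_nonneg fun j _ => h.E1_nonneg j _

lemma Ok2.hL1 (h : D.Ok ε rr) (h2 : D.Ok2 M χ ε K R) (i : Fin d) (x : G) (hk : D.k i x = 1) :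
    |χ (x + D.e i) - χ x| ≤ D.η := by
  refine (h2.hL i x hk).trans ?_
  exact div_le_self h.hη.le h2.hR

lemma edge_fwd (h : D.Ok ε rr) (h2 : D.Ok2 M χ ε K R) (j : Fin d) (z b t : G → ℝ) :
    ∑ x, D.w D.Va x * (χ x ^ 2 * (|z x| * (K * |(b (x + D.e j) + t (x + D.e j)) - (b x + t x)|))) ≤
    K * D.η / 2 * (3 * D.N z + 2 * D.E1 j (fun x => χ x * b x) + 2 * D.N b + 2 * D.E1 j t) := by
  have hKη : 0 ≤ K * D.η / 2 := by have := h2.hK; have := h.hη.le; positivity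
  have key : ∀ x, D.w D.Va x * (χ x ^ 2 * (|z x| * (K * |(b (x + D.e j) + t (x + D.e j)) - (b x + t x)|))) ≤
    K * D.η / 2 * (3 * (D.w D.Va x * z x ^ 2) +
      2 * (D.c D.Va j x * (χ (x + D.e j) * b (x + D.e j) - χ x * b x) ^ 2) +
      2 * (D.w D.Va (x + D.e j) * b (x + D.e j) ^ 2) +
      2 * (D.c D.Va j x * (t (x + D.e j) - t x) ^ 2)) := by
    intro x
    have hw := D.w_pos D.Va x
    have hw' := D.w_pos D.Va (x + D.e j)
    have hc := h.c0 D.Va j x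
    by_cases hx : χ x = 0
    · rw [hx]
      simp only [ne_eq, OfNat.ofNat_ne_zero, not_false_eq_true, zero_pow, zero_mul, mul_zero]
      positivity
    · have hk := (h2.hk x hx j).1
      have s := scalar_edge (z := z x) (b := b x) (b' := b (x + D.e j)) (Δt := t (x + D.e j) - t x)
        h2.hK h.hη (h2.h0 x) (h2.h1 x) (h2.hL1 h j x hk)
      have e1 : (b (x + D.e j) + t (x + D.e j)) - (b x + t x) = b (x + D.e j) - b x + (t (x + D.e j) - t x) := by ring
      rw [e1]
      refine (mul_le_mul_of_nonneg_left s hw.le).trans ?_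
      rw [mul_left_comm]
      refine mul_le_mul_of_nonneg_left ?_ hKη
      have c1 := mul_le_mul_of_nonneg_right (h.w_le_c j x hk) (sq_nonneg (χ (x + D.e j) * b (x + D.e j) - χ x * b x))
      have c2 := mul_le_mul_of_nonneg_right (h.w_le_c j x hk) (sq_nonneg (t (x + D.e j) - t x))
      have c3 := mul_le_mul_of_nonneg_right (h.w_le_w j x hk) (sq_nonneg (b (x + D.e j)))
      linarith
  refine (Finset.sum_le_sum fun x _ => key x).trans (le_of_eq ?_)
  rw [← Finset.mul_sum]
  simp only [Finset.sum_add_distrib, ← Finset.mul_sum]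
  rw [sum_shift' (D.e j) (fun x => D.w D.Va x * b x ^ 2)]
  rfl

lemma edge_bwd (h : D.Ok ε rr) (h2 : D.Ok2 M χ ε K R) (j : Fin d) (z b t : G → ℝ) :
    ∑ x, D.w D.Va x * (χ x ^ 2 * (|z x| * (K * |(b (x - D.e j) + t (x - D.e j)) - (b x + t x)|))) ≤
    K * D.η / 2 * (3 * D.N z + 2 * D.E1 j (fun x => χ x * b x) + 2 * D.N b + 2 * D.E1 j t) := by
  have hKη : 0 ≤ K * D.η / 2 := by have := h2.hK; have := h.hη.le; positivity
  have key : ∀ x, D.w D.Va x * (χ x ^ 2 * (|z x| * (K * |(b (x - D.e j) + t (x - D.e j)) - (b x + t x)|))) ≤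
    K * D.η / 2 * (3 * (D.w D.Va x * z x ^ 2) +
      2 * (D.c D.Va j (x - D.e j) * (χ (x - D.e j + D.e j) * b (x - D.e j + D.e j) - χ (x - D.e j) * b (x - D.e j)) ^ 2) +
      2 * (D.w D.Va (x - D.e j) * b (x - D.e j) ^ 2) +
      2 * (D.c D.Va j (x - D.e j) * (t (x - D.e j + D.e j) - t (x - D.e j)) ^ 2)) := by
    intro x
    have hw := D.w_pos D.Va x
    have hw' := D.w_pos D.Va (x - D.e j)
    have hc := h.c0 D.Va j (x - D.e j)
    by_cases hx : χ x = 0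
    · rw [hx]
      simp only [ne_eq, OfNat.ofNat_ne_zero, not_false_eq_true, zero_pow, zero_mul, mul_zero]
      positivity
    · have hk := (h2.hk x hx j).2.1
      have hl := h2.hL1 h j (x - D.e j) hk
      have c0 := h.w_le_c' j _ hk
      have c3 := h.w_le_w' j _ hk
      simp only [sub_add_cancel] at hl c0 c3 ⊢
      rw [abs_sub_comm] at hl
      have s := scalar_edge (z := z x) (b := b x) (b' := b (x - D.e j)) (Δt := t (x - D.e j) - t x)
        h2.hK h.hη (h2.h0 x) (h2.h1 x) hl
      have e1 : (b (x - D.e j) + t (x - D.e j)) - (b x + t x) = b (x - D.e j) - b x + (t (x - D.e j) - t x) := by ring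
      rw [e1]
      refine (mul_le_mul_of_nonneg_left s hw.le).trans ?_
      rw [mul_left_comm]
      refine mul_le_mul_of_nonneg_left ?_ hKη
      have c1 := mul_le_mul_of_nonneg_right c0 (sq_nonneg (χ (x - D.e j) * b (x - D.e j) - χ x * b x))
      have c2 := mul_le_mul_of_nonneg_right c0 (sq_nonneg (t (x - D.e j) - t x))
      have c3 := mul_le_mul_of_nonneg_right c3 (sq_nonneg (b (x - D.e j)))
      rw [sub_sq_comm (χ x * b x), sub_sq_comm (t x)]
      linarith
  refine (Finset.sum_le_sum fun x _ => key x).trans (le_of_eq ?_)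
  rw [← Finset.mul_sum]
  simp only [Finset.sum_add_distrib, ← Finset.mul_sum]
  rw [sum_shift (D.e j) (fun x => D.w D.Va x * b x ^ 2),
    sum_shift (D.e j) (fun x => D.c D.Va j x * (χ (x + D.e j) * b (x + D.e j) - χ x * b x) ^ 2),
    sum_shift (D.e j) (fun x => D.c D.Va j x * (t (x + D.e j) - t x) ^ 2)]
  rfl

/-- Caccioppoli -/
lemma cacc (h : D.Ok ε rr) (h2 : D.Ok2 M χ ε K R) (z : G → ℝ) :
    ∑ x, D.w D.Va x * (χ x ^ 2 * (z x * D.L D.Va z x)) ≤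
      - ∑ j, D.E1 j (fun x => χ x * z x) + d * R⁻¹ ^ 2 * D.N z := by
  have e1 : ∑ x, D.w D.Va x * (χ x ^ 2 * (z x * D.L D.Va z x)) =
      - En D.e (D.c D.Va) (fun x => χ x ^ 2 * z x) z := by
    rw [← ibp (D.w_pos D.Va)]
    exact Finset.sum_congr rfl fun x _ => by simp only [L]; ring
  rw [e1, En]
  have key : ∀ j, ∑ x, -(D.c D.Va j x * ((χ (x + D.e j) ^ 2 * z (x + D.e j)) - χ x ^ 2 * z x) * (z (x + D.e j) - z x))
      ≤ - D.E1 j (fun x => χ x * z x) + R⁻¹ ^ 2 * D.N z := by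
    intro j
    have pt : ∀ x, -(D.c D.Va j x * ((χ (x + D.e j) ^ 2 * z (x + D.e j)) - χ x ^ 2 * z x) * (z (x + D.e j) - z x))
      ≤ -(D.c D.Va j x * (χ (x + D.e j) * z (x + D.e j) - χ x * z x) ^ 2) +
        R⁻¹ ^ 2 * (1 / 2) * (D.w D.Va x * z x ^ 2) +
        R⁻¹ ^ 2 * (1 / 2) * (D.w D.Va (x + D.e j) * z (x + D.e j) ^ 2) := by
      intro x
      have hw := D.w_pos D.Va x
      have hw' := D.w_pos D.Va (x + D.e j)
      rcases h.hk j x with hk | hk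
      · simp only [c, hk, mul_zero, zero_mul, neg_zero, zero_add]; positivity
      · have e2 : -(D.c D.Va j x * ((χ (x + D.e j) ^ 2 * z (x + D.e j)) - χ x ^ 2 * z x) * (z (x + D.e j) - z x))
          = -(D.c D.Va j x * (χ (x + D.e j) * z (x + D.e j) - χ x * z x) ^ 2) +
            D.c D.Va j x * (χ (x + D.e j) - χ x) ^ 2 * (z x * z (x + D.e j)) := by ring
        rw [e2, add_assoc]
        refine add_le_add_right ?_ _
        have hl := h2.hL j x hk
        have hs : (χ (x + D.e j) - χ x) ^ 2 ≤ (D.η / R) ^ 2 := by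
          rw [← sq_abs]; exact pow_le_pow_left₀ (abs_nonneg _) hl 2
        have hη := h.hη.ne'
        have hcw : D.c D.Va j x * D.η ^ 2 = Real.exp (-D.Va x / 2) * Real.exp (-D.Va (x + D.e j) / 2) := by
          simp only [c, hk, mul_one]
          rw [mul_right_comm, ← mul_pow, inv_mul_cancel₀ hη, one_pow, one_mul, ← Real.exp_add]
          congr 1; ring
        have w1 : D.w D.Va x = Real.exp (-D.Va x / 2) ^ 2 := by
          rw [w, ← Real.exp_nat_mul]; congr 1; push_cast; ring
        have w2 : D.w D.Va (x + D.e j) = Real.exp (-D.Va (x + D.e j) / 2) ^ 2 := by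
          rw [w, ← Real.exp_nat_mul]; congr 1; push_cast; ring
        rw [w1, w2]
        set p := Real.exp (-D.Va x / 2)
        set q := Real.exp (-D.Va (x + D.e j) / 2)
        have hc := h.c0 D.Va j x
        calc D.c D.Va j x * (χ (x + D.e j) - χ x) ^ 2 * (z x * z (x + D.e j))
            ≤ D.c D.Va j x * (χ (x + D.e j) - χ x) ^ 2 * |z x * z (x + D.e j)| :=
              mul_le_mul_of_nonneg_left (le_abs_self _) (by positivity)
          _ ≤ D.c D.Va j x * (D.η / R) ^ 2 * |z x * z (x + D.e j)| := by gcongr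
          _ = R⁻¹ ^ 2 * ((D.c D.Va j x * D.η ^ 2) * |z x * z (x + D.e j)|) := by
              rw [div_eq_mul_inv]; ring
          _ = R⁻¹ ^ 2 * ((p * |z x|) * (q * |z (x + D.e j)|)) := by rw [hcw, abs_mul]; ring
          _ ≤ R⁻¹ ^ 2 * ((1 / 2) * ((p * |z x|) ^ 2 + (q * |z (x + D.e j)|) ^ 2)) := by
              refine mul_le_mul_of_nonneg_left ?_ (sq_nonneg _)
              nlinarith [sq_nonneg (p * |z x| - q * |z (x + D.e j)|)]
          _ = _ := by rw [mul_pow, mul_pow, sq_abs, sq_abs]; ring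
    refine (Finset.sum_le_sum fun x _ => pt x).trans (le_of_eq ?_)
    simp only [Finset.sum_add_distrib, ← Finset.mul_sum, Finset.sum_neg_distrib]
    rw [sum_shift' (D.e j) (fun x => D.w D.Va x * z x ^ 2)]
    simp only [N, E1]; ring
  calc -∑ j, ∑ x, (D.c D.Va j x * ((χ (x + D.e j) ^ 2 * z (x + D.e j)) - χ x ^ 2 * z x) * (z (x + D.e j) - z x))
      = ∑ j, ∑ x, -(D.c D.Va j x * ((χ (x + D.e j) ^ 2 * z (x + D.e j)) - χ x ^ 2 * z x) * (z (x + D.e j) - z x)) := by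
        simp only [Finset.sum_neg_distrib]
    _ ≤ ∑ j, (- D.E1 j (fun x => χ x * z x) + R⁻¹ ^ 2 * D.N z) := Finset.sum_le_sum fun j _ => key j
    _ = _ := by
      rw [Finset.sum_add_distrib, Finset.sum_neg_distrib]
      simp; ring

end GD
end conc
end Grid

set_option linter.unusedSectionVars false
set_option linter.unusedVariables false

namespace Grid
section conc
variable {d : ℕ} {G : Type} [Fintype G] [AddCommGroup G]
namespace GD
variable {D : GD d G} {ε rr τ : ℝ} {M : G → Fin d → Fin d → ℝ} {χ : G → ℝ} {K R : ℝ}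

/-- remainder bound predicate -/
def Rem (D : GD d G) (M : G → Fin d → Fin d → ℝ) (χ : G → ℝ) (ε K : ℝ) (z t A : Fin d → G → ℝ) : Prop :=
  ∀ x, χ x ≠ 0 → ∀ i, |A i x - D.L D.Va (z i) x + ∑ j, M x i j * z j x| ≤
    (∑ j, (K * |(z i (x + D.e j) + t i (x + D.e j)) - (z i x + t i x)| +
      K * |(z i (x - D.e j) + t i (x - D.e j)) - (z i x + t i x)| +
      K * |(z j (x - D.e j) + t j (x - D.e j)) - (z j x + t j x)|)) + ∑ j, ε * |z j x + t j x|

lemma zest (h : D.Ok ε rr) (h2 : D.Ok2 M χ ε K R) {z t A : Fin d → G → ℝ}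
    (hA : D.Rem M χ ε K z t A) :
    ∑ i, ∑ x, D.w D.Va x * (χ x ^ 2 * (z i x * A i x)) ≤
      d * R⁻¹ ^ 2 * D.nn z + ε * (D.nn z + D.EE t) +
      ε * d / 2 * (D.nn z + D.nn (fun i x => z i x + t i x)) := by
  set v : Fin d → G → ℝ := fun i x => z i x + t i x with hv
  -- pointwise bound
  have pt : ∀ x, ∑ i, D.w D.Va x * (χ x ^ 2 * (z i x * A i x)) ≤
      ∑ i, (D.w D.Va x * (χ x ^ 2 * (z i x * D.L D.Va (z i) x)) +
        ((∑ j, (D.w D.Va x * (χ x ^ 2 * (|z i x| * (K * |v i (x + D.e j) - v i x|))) +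
          D.w D.Va x * (χ x ^ 2 * (|z i x| * (K * |v i (x - D.e j) - v i x|))) +
          D.w D.Va x * (χ x ^ 2 * (|z i x| * (K * |v j (x - D.e j) - v j x|))))) +
        ∑ j, ε / 2 * (D.w D.Va x * z i x ^ 2 + D.w D.Va x * v j x ^ 2))) := by
    intro x
    have hw := D.w_pos D.Va x
    have hε := h.hε0
    have hK := h2.hK
    by_cases hx : χ x = 0
    · have : ∑ i, D.w D.Va x * (χ x ^ 2 * (z i x * A i x)) = 0 :=
        Finset.sum_eq_zero fun i _ => by rw [hx]; ring
      rw [this]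
      refine Finset.sum_nonneg fun i _ => ?_
      have : D.w D.Va x * (χ x ^ 2 * (z i x * D.L D.Va (z i) x)) = 0 := by rw [hx]; ring
      rw [this, zero_add]
      positivity
    · have hM := h2.hMp x (fun i => z i x)
      have hχ0 : 0 ≤ D.w D.Va x * χ x ^ 2 := by positivity
      have step : ∀ i, D.w D.Va x * (χ x ^ 2 * (z i x * A i x)) ≤
        (D.w D.Va x * (χ x ^ 2 * (z i x * D.L D.Va (z i) x)) +
        ((∑ j, (D.w D.Va x * (χ x ^ 2 * (|z i x| * (K * |v i (x + D.e j) - v i x|))) +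
          D.w D.Va x * (χ x ^ 2 * (|z i x| * (K * |v i (x - D.e j) - v i x|))) +
          D.w D.Va x * (χ x ^ 2 * (|z i x| * (K * |v j (x - D.e j) - v j x|))))) +
        ∑ j, ε / 2 * (D.w D.Va x * z i x ^ 2 + D.w D.Va x * v j x ^ 2)))
        - D.w D.Va x * χ x ^ 2 * (z i x * ∑ j, M x i j * z j x) := by
        intro i
        have hr := hA x hx i
        set r := A i x - D.L D.Va (z i) x + ∑ j, M x i j * z j x with hrdef
        have e1 : A i x = D.L D.Va (z i) x - ∑ j, M x i j * z j x + r := by rw [hrdef]; ring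
        have e2 : z i x * r ≤ |z i x| * ((∑ j, (K * |v i (x + D.e j) - v i x| +
      K * |v i (x - D.e j) - v i x| + K * |v j (x - D.e j) - v j x|)) + ∑ j, ε * |v j x|) := by
          calc z i x * r ≤ |z i x * r| := le_abs_self _
            _ = |z i x| * |r| := abs_mul _ _
            _ ≤ _ := mul_le_mul_of_nonneg_left hr (abs_nonneg _)
        have e3 := mul_le_mul_of_nonneg_left e2 hχ0
        have e4 : D.w D.Va x * χ x ^ 2 * (|z i x| * ((∑ j, (K * |v i (x + D.e j) - v i x| +
      K * |v i (x - D.e j) - v i x| + K * |v j (x - D.e j) - v j x|)) + ∑ j, ε * |v j x|)) =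
          (∑ j, (D.w D.Va x * (χ x ^ 2 * (|z i x| * (K * |v i (x + D.e j) - v i x|))) +
          D.w D.Va x * (χ x ^ 2 * (|z i x| * (K * |v i (x - D.e j) - v i x|))) +
          D.w D.Va x * (χ x ^ 2 * (|z i x| * (K * |v j (x - D.e j) - v j x|))))) +
          ∑ j, D.w D.Va x * χ x ^ 2 * (|z i x| * (ε * |v j x|)) := by
          rw [mul_add, mul_add, Finset.mul_sum, Finset.mul_sum, Finset.mul_sum, Finset.mul_sum]
          congr 1
          exact Finset.sum_congr rfl fun j _ => by ring
        have e5 : ∑ j, D.w D.Va x * χ x ^ 2 * (|z i x| * (ε * |v j x|)) ≤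
            ∑ j, ε / 2 * (D.w D.Va x * z i x ^ 2 + D.w D.Va x * v j x ^ 2) := by
          refine Finset.sum_le_sum fun j _ => ?_
          have c1 : χ x ^ 2 ≤ 1 := pow_le_one₀ (h2.h0 x) (h2.h1 x)
          have c2 : D.w D.Va x * χ x ^ 2 ≤ D.w D.Va x := mul_le_of_le_one_right hw.le c1
          have c3 : |z i x| * (ε * |v j x|) ≤ ε / 2 * (z i x ^ 2 + v j x ^ 2) := by
            rw [← sq_abs (z i x), ← sq_abs (v j x)]
            nlinarith [mul_nonneg hε (sq_nonneg (|z i x| - |v j x|))]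
          calc D.w D.Va x * χ x ^ 2 * (|z i x| * (ε * |v j x|)) ≤ D.w D.Va x * (ε / 2 * (z i x ^ 2 + v j x ^ 2)) :=
                mul_le_mul c2 c3 (by positivity) hw.le
            _ = _ := by ring
        rw [e4] at e3
        have e6 : D.w D.Va x * (χ x ^ 2 * (z i x * A i x)) =
          D.w D.Va x * (χ x ^ 2 * (z i x * D.L D.Va (z i) x)) + D.w D.Va x * χ x ^ 2 * (z i x * r)
          - D.w D.Va x * χ x ^ 2 * (z i x * ∑ j, M x i j * z j x) := by rw [e1]; ring
        rw [e6]; linarith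
      refine (Finset.sum_le_sum fun i _ => step i).trans ?_
      rw [Finset.sum_sub_distrib, ← Finset.mul_sum]
      have := mul_nonneg hχ0 hM
      linarith
  rw [Finset.sum_comm]
  refine (Finset.sum_le_sum fun x _ => pt x).trans ?_
  rw [Finset.sum_comm]
  -- now sum over i of sum over x
  set θ := K * D.η / 2 with hθdef
  have hθ0 : 0 ≤ θ := by have := h2.hK; have := h.hη.le; positivity
  have perI : ∀ i, ∑ x, (D.w D.Va x * (χ x ^ 2 * (z i x * D.L D.Va (z i) x)) +
        ((∑ j, (D.w D.Va x * (χ x ^ 2 * (|z i x| * (K * |v i (x + D.e j) - v i x|))) +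
          D.w D.Va x * (χ x ^ 2 * (|z i x| * (K * |v i (x - D.e j) - v i x|))) +
          D.w D.Va x * (χ x ^ 2 * (|z i x| * (K * |v j (x - D.e j) - v j x|))))) +
        ∑ j, ε / 2 * (D.w D.Va x * z i x ^ 2 + D.w D.Va x * v j x ^ 2))) ≤
      - ∑ j, D.E1 j (fun x => χ x * z i x) + d * R⁻¹ ^ 2 * D.N (z i) +
      ∑ j, (θ * (3 * D.N (z i) + 2 * D.E1 j (fun x => χ x * z i x) + 2 * D.N (z i) + 2 * D.E1 j (t i)) +
        θ * (3 * D.N (z i) + 2 * D.E1 j (fun x => χ x * z i x) + 2 * D.N (z i) + 2 * D.E1 j (t i)) +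
        θ * (3 * D.N (z i) + 2 * D.E1 j (fun x => χ x * z j x) + 2 * D.N (z j) + 2 * D.E1 j (t j))) +
      ∑ j, ε / 2 * (D.N (z i) + D.N (v j)) := by
    intro i
    rw [Finset.sum_add_distrib, Finset.sum_add_distrib, add_assoc]
    refine add_le_add (cacc h h2 (z i)) (add_le_add ?_ ?_)
    · rw [Finset.sum_comm]
      refine Finset.sum_le_sum fun j _ => ?_
      rw [Finset.sum_add_distrib, Finset.sum_add_distrib]
      exact add_le_add (add_le_add (edge_fwd h h2 j (z i) (z i) (t i)) (edge_bwd h h2 j (z i) (z i) (t i)))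
        (edge_bwd h h2 j (z i) (z j) (t j))
    · rw [Finset.sum_comm]
      refine Finset.sum_le_sum fun j _ => le_of_eq ?_
      rw [← Finset.mul_sum, Finset.sum_add_distrib]; rfl
  refine (Finset.sum_le_sum fun i _ => perI i).trans ?_
  -- evaluate double sums
  set Dt := ∑ i, ∑ j, D.E1 j (fun x => χ x * z i x) with hDt
  have hDt0 : 0 ≤ Dt := h.EE_nonneg (fun i x => χ x * z i x)
  have hEE0 := h.EE_nonneg t
  have hnz := D.nn_nonneg z
  have hnv := D.nn_nonneg v
  have d1 : ∑ j, D.E1 j (fun x => χ x * z j x) ≤ Dt := by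
    refine Finset.sum_le_sum fun i _ => ?_
    exact Finset.single_le_sum (f := fun j => D.E1 j (fun x => χ x * z i x))
      (fun j _ => h.E1_nonneg j _) (Finset.mem_univ i)
  have d2 : ∑ j, D.E1 j (t j) ≤ D.EE t := by
    refine Finset.sum_le_sum fun i _ => ?_
    exact Finset.single_le_sum (f := fun j => D.E1 j (t i))
      (fun j _ => h.E1_nonneg j _) (Finset.mem_univ i)
  have ev : ∑ i, (- ∑ j, D.E1 j (fun x => χ x * z i x) + d * R⁻¹ ^ 2 * D.N (z i) +
      ∑ j, (θ * (3 * D.N (z i) + 2 * D.E1 j (fun x => χ x * z i x) + 2 * D.N (z i) + 2 * D.E1 j (t i)) +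
        θ * (3 * D.N (z i) + 2 * D.E1 j (fun x => χ x * z i x) + 2 * D.N (z i) + 2 * D.E1 j (t i)) +
        θ * (3 * D.N (z i) + 2 * D.E1 j (fun x => χ x * z j x) + 2 * D.N (z j) + 2 * D.E1 j (t j))) +
      ∑ j, ε / 2 * (D.N (z i) + D.N (v j))) =
      - Dt + d * R⁻¹ ^ 2 * D.nn z + θ * (15 * d * D.nn z + 4 * Dt + 4 * D.EE t +
        2 * d * ∑ j, D.E1 j (fun x => χ x * z j x) + 2 * d * ∑ j, D.E1 j (t j)) +
      ε * d / 2 * (D.nn z + D.nn v) := by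
    simp only [Finset.sum_add_distrib, Finset.sum_neg_distrib, ← Finset.mul_sum, Finset.sum_const,
      Finset.card_univ, Fintype.card_fin, nsmul_eq_mul]
    simp only [← hDt, nn, EE]
    ring
  rw [ev]
  have hε1 := h.hε1
  have hθ' : θ * (16 * (1 + d)) ≤ ε := by have := h2.hθ; rw [hθdef]; linarith
  have hd0 : (0 : ℝ) ≤ d := Nat.cast_nonneg d
  have s1 : θ * (2 * d * ∑ j, D.E1 j (fun x => χ x * z j x)) ≤ θ * (2 * d * Dt) := by gcongr
  have s2 : θ * (2 * d * ∑ j, D.E1 j (t j)) ≤ θ * (2 * d * D.EE t) := by gcongr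
  have s3 := mul_le_mul_of_nonneg_right hθ' hnz
  have s4 := mul_le_mul_of_nonneg_right hθ' hEE0
  have s5 := mul_le_mul_of_nonneg_right hθ' hDt0
  have s6 := mul_le_mul_of_nonneg_right hε1 hDt0
  have p1 := mul_nonneg hθ0 hnz
  have p2 := mul_nonneg hθ0 hEE0
  have p3 := mul_nonneg hθ0 hDt0
  have p1' := mul_nonneg p1 hd0
  have p2' := mul_nonneg p2 hd0
  have p3' := mul_nonneg p3 hd0
  nlinarith

/-- the auxiliary vector field -/
noncomputable def tv (D : GD d G) (M : G → Fin d → Fin d → ℝ) (τ : ℝ) (F : G → ℝ) :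
    ℕ → Fin d → G → ℝ
  | 0 => D.v F
  | n + 1 => fun i x => D.S D.Va τ (tv D M τ F n i) x -
      τ * ∑ j, M x i j * D.S D.Va τ (tv D M τ F n j) x

variable {lam : ℝ} {F : G → ℝ}

/-- contraction -/
def Con (M : G → Fin d → Fin d → ℝ) (τ lam : ℝ) : Prop :=
  ∀ x (y : Fin d → ℝ), ∑ i, (y i - τ * ∑ j, M x i j * y j) ^ 2 ≤ lam * ∑ i, y i ^ 2

lemma nn_comm (D : GD d G) (f : Fin d → G → ℝ) : D.nn f = ∑ x, D.w D.Va x * ∑ i, f i x ^ 2 := by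
  simp only [nn, N, Finset.mul_sum]; rw [Finset.sum_comm]

lemma tv_step (h : D.Ok ε rr) (hτ : 0 ≤ τ) (hτr : 2 * τ * rr ≤ 1) (hl0 : 0 ≤ lam)
    (hC : Con M τ lam) (n : ℕ) :
    D.nn (D.tv M τ F (n + 1)) ≤ lam * (D.nn (D.tv M τ F n) - τ * D.EE (D.tv M τ F n)) := by
  have h1 : D.nn (D.tv M τ F (n + 1)) ≤ lam * D.nn (fun i x => D.S D.Va τ (D.tv M τ F n i) x) := by
    rw [nn_comm, nn_comm, Finset.mul_sum]
    refine Finset.sum_le_sum fun x _ => ?_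
    have := mul_le_mul_of_nonneg_left (hC x (fun i => D.S D.Va τ (D.tv M τ F n i) x)) (D.w_pos D.Va x).le
    rw [mul_left_comm] at this; exact this
  refine h1.trans (mul_le_mul_of_nonneg_left ?_ hl0)
  rw [EE_eq, nn, nn, Finset.mul_sum, ← Finset.sum_sub_distrib]
  exact Finset.sum_le_sum fun i _ => stp_sq_le (D.w_pos D.Va) (h.c0 _) h.hra h.hrr hτ hτr _

lemma tv_step1 (h : D.Ok ε rr) (hτ : 0 ≤ τ) (hτr : 2 * τ * rr ≤ 1) (hl0 : 0 ≤ lam) (hl1 : lam ≤ 1)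
    (hC : Con M τ lam) (n : ℕ) :
    D.nn (D.tv M τ F (n + 1)) ≤ D.nn (D.tv M τ F n) - τ * D.EE (D.tv M τ F n) := by
  have h1 := tv_step (F := F) h hτ hτr hl0 hC n
  have h2 := D.nn_nonneg (D.tv M τ F (n + 1))
  have : 0 ≤ D.nn (D.tv M τ F n) - τ * D.EE (D.tv M τ F n) := by
    rw [EE_eq, nn, Finset.mul_sum, ← Finset.sum_sub_distrib]
    refine Finset.sum_nonneg fun i _ => ?_
    have := stp_sq_le (D.w_pos D.Va) (h.c0 _) h.hra h.hrr hτ hτr (D.tv M τ F n i)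
    exact le_trans (D.N_nonneg _) this
  nlinarith

lemma tv_sum (h : D.Ok ε rr) (hτ : 0 ≤ τ) (hτr : 2 * τ * rr ≤ 1) (hl0 : 0 ≤ lam) (hl1 : lam ≤ 1)
    (hC : Con M τ lam) (n : ℕ) :
    D.nn (D.tv M τ F n) + ∑ k ∈ Finset.range n, τ * D.EE (D.tv M τ F k) ≤ D.nn (D.v F) := by
  induction n with
  | zero => simp [tv]
  | succ n ih =>
    rw [Finset.sum_range_succ]
    have := tv_step1 (F := F) h hτ hτr hl0 hl1 hC n
    linarith

lemma tv_le (h : D.Ok ε rr) (hτ : 0 ≤ τ) (hτr : 2 * τ * rr ≤ 1) (hl0 : 0 ≤ lam) (hl1 : lam ≤ 1)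
    (hC : Con M τ lam) (n : ℕ) : D.nn (D.tv M τ F n) ≤ D.nn (D.v F) := by
  have := tv_sum (F := F) h hτ hτr hl0 hl1 hC n
  have h2 : 0 ≤ ∑ k ∈ Finset.range n, τ * D.EE (D.tv M τ F k) :=
    Finset.sum_nonneg fun k _ => mul_nonneg hτ (h.EE_nonneg _)
  linarith

lemma tv_pow (h : D.Ok ε rr) (hτ : 0 ≤ τ) (hτr : 2 * τ * rr ≤ 1) (hl0 : 0 ≤ lam)
    (hC : Con M τ lam) (n : ℕ) : D.nn (D.tv M τ F n) ≤ lam ^ n * D.nn (D.v F) := by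
  induction n with
  | zero => simp [tv]
  | succ n ih =>
    refine (tv_step (F := F) h hτ hτr hl0 hC n).trans ?_
    rw [pow_succ', mul_assoc]
    refine mul_le_mul_of_nonneg_left ?_ hl0
    have := mul_nonneg hτ (h.EE_nonneg (D.tv M τ F n))
    linarith

lemma tv_cone (h : D.Ok ε rr) (hτ : 0 ≤ τ) (hτr : 2 * τ * rr ≤ 1) (hl0 : 0 ≤ lam)
    (hC : Con M τ lam) {b C : ℝ} (hb : 0 < b) (hF : ∀ x, b ≤ F x ∧ F x ≤ C) (n : ℕ) :
    (∀ x, 0 ≤ D.it D.Va τ (fun x => (∑ i, D.v F i x ^ 2) / F x) n x) ∧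
    ∀ x, ∑ i, D.tv M τ F n i x ^ 2 ≤
      D.it D.Va τ F n x * (lam ^ n * D.it D.Va τ (fun x => (∑ i, D.v F i x ^ 2) / F x) n x) := by
  have hτ' : τ * rr ≤ 1 := by nlinarith [mul_nonneg hτ h.hrr.le]
  induction n with
  | zero =>
    refine ⟨fun x => ?_, fun x => ?_⟩
    · have := hb.trans_le (hF x).1
      simp only [it]; positivity
    · have := (hb.trans_le (hF x).1).ne'
      simp only [tv, it, pow_zero, one_mul]; rw [mul_div_cancel₀ _ this]
  | succ n ih =>
    have hq : ∀ x, 0 ≤ lam ^ n * D.it D.Va τ (fun x => (∑ i, D.v F i x ^ 2) / F x) n x :=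
      fun x => mul_nonneg (pow_nonneg hl0 n) (ih.1 x)
    refine ⟨fun x => stp_nonneg (D.w_pos _) (h.c0 _) h.hra hτ hτ' ih.1 x, fun x => ?_⟩
    have h1 := cone (D.w_pos _) (h.c0 _) h.hra hτ hτ' hb
      (fun x => (h.it_bd D.Va h.hra hτ hτr hF n x).1) hq ih.2 x
    rw [stp_smul] at h1
    refine (hC x _).trans ?_
    refine (mul_le_mul_of_nonneg_left h1 hl0).trans (le_of_eq ?_)
    rw [pow_succ']
    simp only [it, S]; ring

end GD
end conc
end Grid

set_option linter.unusedSectionVars false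
set_option linter.unusedVariables false

namespace Grid
section conc
variable {d : ℕ} {G : Type} [Fintype G] [AddCommGroup G]
namespace GD
variable {D : GD d G} {ε rr τ : ℝ} {M : G → Fin d → Fin d → ℝ} {χ : G → ℝ} {K R : ℝ}
variable {lam : ℝ} {F : G → ℝ}

/-- first order term -/
noncomputable def Af (D : GD d G) (M : G → Fin d → Fin d → ℝ) (g : G → ℝ) (t : Fin d → G → ℝ)
    (i : Fin d) (x : G) : ℝ := D.vL g i x - D.L D.Va (t i) x + ∑ j, M x i j * t j x
/-- second order term -/
noncomputable def Bf (D : GD d G) (M : G → Fin d → Fin d → ℝ) (t : Fin d → G → ℝ)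
    (i : Fin d) (x : G) : ℝ := ∑ j, M x i j * D.L D.Va (t j) x
/-- quadratic remainder -/
noncomputable def Psi (D : GD d G) (M : G → Fin d → Fin d → ℝ) (χ : G → ℝ) (g : G → ℝ)
    (t : Fin d → G → ℝ) : ℝ :=
  ∑ i, ∑ x, D.w D.Va x * (χ x ^ 2 * ((D.v g i x - t i x) ^ 2 + 2 * D.Af M g t i x ^ 2 +
    3 * D.Bf M t i x ^ 2))

lemma Psi_bdd (D : GD d G) (M : G → Fin d → Fin d → ℝ) (χ : G → ℝ) (C X : ℝ) :
    ∃ S : ℝ, 0 ≤ S ∧ ∀ g t, (∀ x, |g x| ≤ C) → D.nn t ≤ X → D.Psi M χ g t ≤ S := by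
  have hcont : Continuous (fun p : (G → ℝ) × (Fin d → G → ℝ) => D.Psi M χ p.1 p.2) := by
    unfold Psi Af Bf vL v L gn
    fun_prop
  set C' : ℝ := |C| + ∑ x, (1 + |X| * (D.w D.Va x)⁻¹) with hC'
  have hC'0 : 0 ≤ C' := by
    have : ∀ x, 0 ≤ (D.w D.Va x)⁻¹ := fun x => (inv_pos.2 (D.w_pos D.Va x)).le
    have : 0 ≤ ∑ x, (1 + |X| * (D.w D.Va x)⁻¹) := Finset.sum_nonneg fun x _ => by
      have := this x; positivity
    positivity
  obtain ⟨S, hS⟩ := ((isCompact_closedBall (0 : (G → ℝ) × (Fin d → G → ℝ)) C').image hcont).bddAbove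
  refine ⟨max S 0, le_max_right _ _, fun g t hg ht => ?_⟩
  refine le_trans (hS ?_) (le_max_left _ _)
  refine ⟨(g, t), ?_, rfl⟩
  rw [mem_closedBall_zero_iff, Prod.norm_def, max_le_iff]
  have hw : ∀ x, 0 ≤ (D.w D.Va x)⁻¹ := fun x => (inv_pos.2 (D.w_pos D.Va x)).le
  constructor
  · rw [pi_norm_le_iff_of_nonneg hC'0]
    intro x
    have : 0 ≤ ∑ x, (1 + |X| * (D.w D.Va x)⁻¹) := Finset.sum_nonneg fun x _ => by
      have := hw x; positivity
    rw [Real.norm_eq_abs]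
    linarith [hg x, le_abs_self C]
  · rw [pi_norm_le_iff_of_nonneg hC'0]
    intro i
    rw [pi_norm_le_iff_of_nonneg hC'0]
    intro x
    rw [Real.norm_eq_abs]
    have h1 : D.w D.Va x * t i x ^ 2 ≤ D.nn t := by
      have a1 : D.w D.Va x * t i x ^ 2 ≤ D.N (t i) :=
        Finset.single_le_sum (f := fun x => D.w D.Va x * t i x ^ 2)
          (fun y _ => mul_nonneg (D.w_pos _ y).le (sq_nonneg _)) (Finset.mem_univ x)
      exact a1.trans (Finset.single_le_sum (f := fun i => D.N (t i)) (fun i _ => D.N_nonneg _)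
        (Finset.mem_univ i))
    have h2 : t i x ^ 2 ≤ |X| * (D.w D.Va x)⁻¹ := by
      rw [← div_eq_mul_inv, le_div_iff₀ (D.w_pos _ x)]; linarith [le_abs_self X]
    have h3 : |t i x| ≤ 1 + t i x ^ 2 := by rw [← sq_abs]; nlinarith [sq_nonneg (|t i x| - 1)]
    have h4 : (1 + |X| * (D.w D.Va x)⁻¹) ≤ ∑ x, (1 + |X| * (D.w D.Va x)⁻¹) :=
      Finset.single_le_sum (f := fun x => (1 + |X| * (D.w D.Va x)⁻¹))
        (fun y _ => by have := hw y; positivity) (Finset.mem_univ x)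
    linarith [abs_nonneg C]

lemma rem_Af (h : D.Ok ε rr) (h2 : D.Ok2 M χ ε K R) (g : G → ℝ) (t : Fin d → G → ℝ) :
    D.Rem M χ ε K (fun i x => D.v g i x - t i x) t (D.Af M g t) := by
  intro x hx i
  have := interior h h2 g i x hx
  simp only [sub_add_cancel]
  convert this using 2
  simp only [L, gn_sub, Af, mul_sub, Finset.sum_sub_distrib]
  ring

lemma Ok.nn_v (h : D.Ok ε rr) (g : G → ℝ) : D.nn (D.v g) ≤ 2 * D.E D.V g g := by
  simp only [nn, N, E, En, Finset.mul_sum]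
  refine Finset.sum_le_sum fun i _ => Finset.sum_le_sum fun x _ => ?_
  rcases h.hk i x with hk | hk
  · simp [v, c, hk]
  · have e1 : D.w D.Va x * D.v g i x ^ 2 = D.η⁻¹ ^ 2 * (g (x + D.e i) - g x) ^ 2 * Real.exp (-D.V x) := by
      have : Real.exp (-D.V x) = D.w D.Va x * Real.exp (D.al x) ^ 2 := by
        rw [w, ← Real.exp_nat_mul, ← Real.exp_add, Va]; congr 1; push_cast; ring
      rw [this, v, hk]; ring
    rw [e1]
    have h3 := h.hVe i x hk
    have h4 := h.hε1
    rw [abs_le] at h3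
    have h5 : Real.exp (-D.V x) ≤ 2 * Real.exp (-(D.V x + D.V (x + D.e i)) / 2) :=
      exp_two_le (by linarith [h3.1, h3.2])
    have := mul_le_mul_of_nonneg_left h5 (by positivity : 0 ≤ D.η⁻¹ ^ 2 * (g (x + D.e i) - g x) ^ 2)
    simp only [c, hk]
    linarith

lemma Ok.E_it (h : D.Ok ε rr) (hτ : 0 ≤ τ) (hτr : 2 * τ * rr ≤ 1) (n : ℕ) :
    D.E D.V (D.it D.V τ F n) (D.it D.V τ F n) ≤ D.E D.V F F := by
  induction n with
  | zero => exact le_rfl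
  | succ n ih => exact (En_stp_le (D.w_pos _) (h.c0 _) h.hrV hτ hτr _).trans ih

/-- the localized error -/
noncomputable def Y (D : GD d G) (M : G → Fin d → Fin d → ℝ) (χ : G → ℝ) (τ : ℝ) (F : G → ℝ) (n : ℕ) : ℝ :=
  ∑ i, ∑ x, D.w D.Va x * (χ x ^ 2 * (D.v (D.it D.V τ F n) i x - D.tv M τ F n i x) ^ 2)

lemma Y_step (h : D.Ok ε rr) (h2 : D.Ok2 M χ ε K R) (hτ : 0 ≤ τ) (hτ1 : τ ≤ 1) (n : ℕ) :
    D.Y M χ τ F (n + 1) ≤ D.Y M χ τ F n +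
      2 * τ * (∑ i, ∑ x, D.w D.Va x * (χ x ^ 2 * ((D.v (D.it D.V τ F n) i x - D.tv M τ F n i x) *
        D.Af M (D.it D.V τ F n) (D.tv M τ F n) i x))) +
      τ ^ 2 * D.Psi M χ (D.it D.V τ F n) (D.tv M τ F n) := by
  simp only [Y, Psi, Finset.mul_sum, ← Finset.sum_add_distrib]
  refine Finset.sum_le_sum fun i _ => Finset.sum_le_sum fun x _ => ?_
  by_cases hx : χ x = 0
  · rw [hx]; simp
  · have hk := (h2.hk x hx i).1
    have e1 : D.v (D.it D.V τ F (n + 1)) i x - D.tv M τ F (n + 1) i x =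
        (D.v (D.it D.V τ F n) i x - D.tv M τ F n i x) + τ * D.Af M (D.it D.V τ F n) (D.tv M τ F n) i x
        + τ ^ 2 * D.Bf M (D.tv M τ F n) i x := by
      have e2 : ∑ j, M x i j * D.S D.Va τ (D.tv M τ F n j) x =
          ∑ j, M x i j * D.tv M τ F n j x + τ * D.Bf M (D.tv M τ F n) i x := by
        rw [Bf, Finset.mul_sum, ← Finset.sum_add_distrib]
        exact Finset.sum_congr rfl fun j _ => by simp only [S, stp, L]; ring
      simp only [tv, e2]
      simp only [it, v, S, stp, hk, Af, vL, L]; ring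
    rw [e1]
    set z := D.v (D.it D.V τ F n) i x - D.tv M τ F n i x
    set A := D.Af M (D.it D.V τ F n) (D.tv M τ F n) i x
    set B := D.Bf M (D.tv M τ F n) i x
    have hw := (D.w_pos D.Va x).le
    have key : (z + τ * A + τ ^ 2 * B) ^ 2 ≤ z ^ 2 + 2 * τ * (z * A) + τ ^ 2 * (z ^ 2 + 2 * A ^ 2 + 3 * B ^ 2) := by
      have h4 : τ ^ 2 ≤ 1 := pow_le_one₀ hτ hτ1
      nlinarith [mul_nonneg (sq_nonneg τ) (sq_nonneg (z - B)), mul_nonneg (sq_nonneg τ) (sq_nonneg (A - τ * B)),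
        mul_nonneg (mul_nonneg (sq_nonneg τ) (sub_nonneg.2 h4)) (sq_nonneg B)]
    have := mul_le_mul_of_nonneg_left key (mul_nonneg hw (sq_nonneg (χ x)))
    linarith

/-- error bound coefficient -/
noncomputable def Yb (d : ℕ) (T R ε E0 : ℝ) : ℝ :=
  T * (16 * d * R⁻¹ ^ 2 + (16 + 10 * d) * ε) * E0 + 4 * ε * E0

lemma Y_le (h : D.Ok ε rr) (h2 : D.Ok2 M χ ε K R) (hτ : 0 ≤ τ) (hτ1 : τ ≤ 1)
    (hτr : 2 * τ * rr ≤ 1) (hl0 : 0 ≤ lam) (hl1 : lam ≤ 1) (hC : Con M τ lam)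
    {b C E0 S T : ℝ} (hb : 0 < b) (hF : ∀ x, b ≤ F x ∧ F x ≤ C) (hE : D.E D.V F F ≤ E0)
    (hS0 : 0 ≤ S)
    (hS : ∀ g t, (∀ x, |g x| ≤ C) → D.nn t ≤ 2 * E0 → D.Psi M χ g t ≤ S) (n : ℕ)
    (hT : n * τ ≤ T) :
    D.Y M χ τ F n ≤ Yb d T R ε E0 + T * τ * S := by
  have hE0 : 0 ≤ E0 := (En_nonneg (h.c0 _) F).trans hE
  have hv0 : D.nn (D.v F) ≤ 2 * E0 := (h.nn_v F).trans (by linarith)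
  have hε := h.hε0
  have hd0 : (0 : ℝ) ≤ d := Nat.cast_nonneg d
  set c1 : ℝ := (16 * d * R⁻¹ ^ 2 + (16 + 10 * d) * ε) * E0 with hc1
  have main : ∀ n : ℕ, D.Y M χ τ F n ≤ n * τ * (c1 + τ * S) +
      2 * ε * ∑ k ∈ Finset.range n, τ * D.EE (D.tv M τ F k) := by
    intro n
    induction n with
    | zero => simp [Y, it, tv]
    | succ n ih =>
      set g := D.it D.V τ F n with hg
      set t := D.tv M τ F n with ht
      have s1 := Y_step (F := F) h h2 hτ hτ1 n
      have s2 := zest h h2 (rem_Af h h2 g t)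
      have hvg : D.nn (D.v g) ≤ 2 * E0 :=
        (h.nn_v g).trans (by linarith [h.E_it (F := F) hτ hτr n])
      have htv : D.nn t ≤ 2 * E0 := (tv_le h hτ hτr hl0 hl1 hC n).trans hv0
      have hz : D.nn (fun i x => D.v g i x - t i x) ≤ 8 * E0 := by
        have : D.nn (fun i x => D.v g i x - t i x) ≤ 2 * D.nn (D.v g) + 2 * D.nn t := by
          simp only [nn, N, Finset.mul_sum, ← Finset.sum_add_distrib]
          refine Finset.sum_le_sum fun i _ => Finset.sum_le_sum fun x _ => ?_
          have := D.w_pos D.Va x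
          nlinarith [mul_nonneg this.le (sq_nonneg (D.v g i x + t i x))]
        linarith
      have hv' : D.nn (fun i x => (D.v g i x - t i x) + t i x) ≤ 2 * E0 := by
        simpa only [sub_add_cancel] using hvg
      have hPsi : D.Psi M χ g t ≤ S := by
        refine hS g t (fun x => ?_) htv
        have := h.it_bd D.V h.hrV hτ hτr hF n x
        rw [abs_of_nonneg (hb.le.trans this.1)]; exact this.2
      have s3 : ∑ i, ∑ x, D.w D.Va x * (χ x ^ 2 * ((D.v g i x - t i x) * D.Af M g t i x)) ≤
          c1 / 2 + ε * D.EE t := by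
        refine s2.trans ?_
        have b1 : d * R⁻¹ ^ 2 * D.nn (fun i x => D.v g i x - t i x) ≤ d * R⁻¹ ^ 2 * (8 * E0) := by gcongr
        have b2 : ε * (D.nn (fun i x => D.v g i x - t i x) + D.EE t) ≤ ε * (8 * E0 + D.EE t) := by gcongr
        have b3 : ε * d / 2 * (D.nn (fun i x => D.v g i x - t i x) + D.nn (fun i x => (D.v g i x - t i x) + t i x))
          ≤ ε * d / 2 * (8 * E0 + 2 * E0) := by gcongr
        rw [hc1]; linarith
      have s4 := mul_le_mul_of_nonneg_left s3 (by positivity : 0 ≤ 2 * τ)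
      have s5 := mul_le_mul_of_nonneg_left hPsi (sq_nonneg τ)
      rw [Finset.sum_range_succ]
      push_cast
      linarith
  refine (main n).trans ?_
  have hsum := tv_sum (F := F) h hτ hτr hl0 hl1 hC n
  have hnn := D.nn_nonneg (D.tv M τ F n)
  have hc10 : 0 ≤ c1 + τ * S := by positivity
  have a1 := mul_le_mul_of_nonneg_right hT hc10
  have a2 : ∑ k ∈ Finset.range n, τ * D.EE (D.tv M τ F k) ≤ 2 * E0 := by linarith
  have a3 := mul_le_mul_of_nonneg_left a2 (by positivity : 0 ≤ 2 * ε)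
  rw [Yb]
  linarith

end GD
end conc
end Grid

set_option linter.unusedSectionVars false
set_option linter.unusedVariables false

namespace Grid

/-- s log s -/
noncomputable def Ph (s : ℝ) : ℝ := s * Real.log s

lemma Ph_conv {g g' : ℝ} (hg : 0 < g) (hg' : 0 < g') : Ph g - Ph g' ≤ (1 + Real.log g) * (g - g') := by
  have h1 := Real.log_le_sub_one_of_pos (div_pos hg hg')
  rw [Real.log_div hg.ne' hg'.ne'] at h1
  have h2 := mul_le_mul_of_nonneg_left h1 hg'.le
  rw [mul_sub g', mul_sub g', mul_div_cancel₀ _ hg'.ne'] at h2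
  simp only [Ph]; nlinarith

lemma Ph_upper {g b : ℝ} (hg : 0 < g) (hb : 0 < b) :
    Ph g ≤ Ph b + (1 + Real.log b) * (g - b) + b⁻¹ * (g - b) ^ 2 := by
  have h1 := Real.log_le_sub_one_of_pos (div_pos hg hb)
  rw [Real.log_div hg.ne' hb.ne'] at h1
  have h2 := mul_le_mul_of_nonneg_left h1 hg.le
  have e : b⁻¹ * (g - b) ^ 2 = g * (g / b - 1) - (g - b) := by field_simp
  rw [e]
  simp only [Ph]; nlinarith

lemma log_diff {g g' h : ℝ} (hh : 0 < h) (hg : h ≤ g) (hg' : h ≤ g') :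
    (Real.log g' - Real.log g) * (g' - g) ≤ (g' - g) ^ 2 / h := by
  have aux : ∀ {a b : ℝ}, h ≤ a → a ≤ b → (Real.log b - Real.log a) * (b - a) ≤ (b - a) ^ 2 / h := by
    intro a b ha hab
    have ha0 := hh.trans_le ha
    have hb0 := ha0.trans_le hab
    have h1 := Real.log_le_sub_one_of_pos (div_pos hb0 ha0)
    rw [Real.log_div hb0.ne' ha0.ne'] at h1
    have h2 : b / a - 1 = (b - a) / a := by field_simp
    rw [h2] at h1
    have h3 : (b - a) / a ≤ (b - a) / h := div_le_div_of_nonneg_left (sub_nonneg.2 hab) hh ha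
    calc (Real.log b - Real.log a) * (b - a) ≤ (b - a) / h * (b - a) :=
          mul_le_mul_of_nonneg_right (h1.trans h3) (sub_nonneg.2 hab)
      _ = _ := by ring
  rcases le_total g g' with hl | hl
  · exact aux hg hl
  · have := aux hg' hl
    rw [sub_sq_comm] at this
    linarith

section conc
variable {d : ℕ} {G : Type} [Fintype G] [AddCommGroup G]
namespace GD
variable {D : GD d G} {ε rr τ : ℝ} {M : G → Fin d → Fin d → ℝ} {χ : G → ℝ} {K R : ℝ}
variable {lam : ℝ} {F : G → ℝ}

lemma wVa (D : GD d G) (x : G) : D.w D.V x = D.w D.Va x * Real.exp (D.al x) ^ 2 := by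
  rw [w, w, ← Real.exp_nat_mul, ← Real.exp_add, Va]; congr 1; push_cast; ring

lemma ent_step (h : D.Ok ε rr) (h2 : D.Ok2 M χ ε K R) (hτ : 0 ≤ τ)
    (hτr : 2 * τ * rr ≤ 1) {b C B0 : ℝ} (hb : 0 < b)
    (hB : ∀ s, b ≤ s → s ≤ C → |1 + Real.log s| ≤ B0) {g hh : G → ℝ}
    (hg : ∀ x, b ≤ g x ∧ g x ≤ C) (hh0 : ∀ x, b ≤ hh x) (hhg : ∀ x, hh x ≤ g x) (hmon : D.Mon hh) :
    ∑ x, D.w D.V x * (χ x ^ 2 * (Ph (g x) - Ph (D.S D.V τ g x))) ≤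
      τ * (Real.exp ε * ∑ x, D.w D.Va x * (χ x ^ 2 * ((∑ i, D.v g i x ^ 2) / hh x)) +
        B0 / R * (d * ∑ x, D.w D.V x + D.E D.V g g)) := by
  have hτ' : τ * rr ≤ 1 := by nlinarith [mul_nonneg hτ h.hrr.le]
  have hgp : ∀ x, 0 < g x := fun x => hb.trans_le (hg x).1
  have hSp : ∀ x, 0 < D.S D.V τ g x := fun x =>
    hb.trans_le (stp_ge (D.w_pos _) (h.c0 _) h.hrV hτ hτ' (fun y => (hg y).1) x)
  have hB0 : ∀ x : G, 0 ≤ B0 := fun x => (abs_nonneg _).trans (hB _ (hg x).1 (hg x).2)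
  have hR : 0 < R := lt_of_lt_of_le one_pos h2.hR
  have s1 : ∑ x, D.w D.V x * (χ x ^ 2 * (Ph (g x) - Ph (D.S D.V τ g x))) ≤
      τ * En D.e (D.c D.V) (fun x => χ x ^ 2 * (1 + Real.log (g x))) g := by
    rw [← neg_neg (En _ _ _ _), ← ibp (D.w_pos D.V), mul_neg, Finset.mul_sum, ← Finset.sum_neg_distrib]
    refine Finset.sum_le_sum fun x _ => ?_
    have a1 := Ph_conv (hgp x) (hSp x)
    have a2 : g x - D.S D.V τ g x = - (τ * gn D.e (D.w D.V) (D.c D.V) g x) := by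
      simp only [S, stp]; ring
    rw [a2] at a1
    have := mul_le_mul_of_nonneg_left a1 (mul_nonneg (D.w_pos D.V x).le (sq_nonneg (χ x)))
    linarith
  refine s1.trans (mul_le_mul_of_nonneg_left ?_ hτ)
  rw [En]
  have pt : ∀ i x, D.c D.V i x * (χ (x + D.e i) ^ 2 * (1 + Real.log (g (x + D.e i))) -
      χ x ^ 2 * (1 + Real.log (g x))) * (g (x + D.e i) - g x) ≤
      Real.exp ε * (D.w D.Va x * (χ x ^ 2 * (D.v g i x ^ 2 / hh x))) +
      B0 / R * (1 / 2 * D.w D.V x + 1 / 2 * D.w D.V (x + D.e i) +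
        D.c D.V i x * (g (x + D.e i) - g x) * (g (x + D.e i) - g x)) := by
    intro i x
    have hw := D.w_pos D.V x
    have hwa := D.w_pos D.Va x
    have hw' := D.w_pos D.V (x + D.e i)
    have hhx := hb.trans_le (hh0 x)
    have hB0 := hB0 x
    rcases h.hk i x with hk | hk
    · simp only [c, v, hk, mul_zero, zero_mul]
      simp only [ne_eq, OfNat.ofNat_ne_zero, not_false_eq_true, zero_pow, zero_div, mul_zero, zero_add, add_zero]
      positivity
    · have hc := h.c0 D.V i x
      set Δ := g (x + D.e i) - g x with hΔ
      set l' := 1 + Real.log (g (x + D.e i)) with hl'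
      set l := 1 + Real.log (g x) with hl
      have split : D.c D.V i x * (χ (x + D.e i) ^ 2 * l' - χ x ^ 2 * l) * Δ =
        χ x ^ 2 * (D.c D.V i x * ((l' - l) * Δ)) + D.c D.V i x * ((χ (x + D.e i) ^ 2 - χ x ^ 2) * l' * Δ) := by ring
      rw [split]
      refine add_le_add ?_ ?_
      · have b1 : (l' - l) * Δ ≤ Δ ^ 2 / hh x := by
          have := log_diff hhx (hhg x) ((hmon i x hk).trans (hhg _))
          rw [hl', hl, hΔ]; simpa using this
        have b2 : D.c D.V i x ≤ Real.exp ε * (D.η⁻¹ ^ 2 * D.w D.V x) := by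
          have h3 := h.hVe i x hk
          rw [abs_le] at h3
          have : Real.exp (-(D.V x + D.V (x + D.e i)) / 2) ≤ Real.exp ε * Real.exp (-D.V x) := by
            rw [← Real.exp_add]; exact Real.exp_le_exp.2 (by linarith [h3.1, h3.2, h.hε0])
          simp only [c, w, hk, mul_one]
          calc _ ≤ D.η⁻¹ ^ 2 * (Real.exp ε * Real.exp (-D.V x)) :=
                mul_le_mul_of_nonneg_left this (sq_nonneg _)
            _ = _ := by ring
        have b3 : D.v g i x ^ 2 = Real.exp (D.al x) ^ 2 * (D.η⁻¹ ^ 2 * Δ ^ 2) := by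
          rw [v, hk, hΔ]; ring
        calc χ x ^ 2 * (D.c D.V i x * ((l' - l) * Δ)) ≤
              χ x ^ 2 * ((Real.exp ε * (D.η⁻¹ ^ 2 * D.w D.V x)) * (Δ ^ 2 / hh x)) := by
                refine mul_le_mul_of_nonneg_left ?_ (sq_nonneg _)
                exact (mul_le_mul_of_nonneg_left b1 hc).trans
                  (mul_le_mul_of_nonneg_right b2 (by positivity))
          _ = _ := by rw [b3, wVa]; ring
      · have hη := h.hη
        have d1 : |χ (x + D.e i) ^ 2 - χ x ^ 2| ≤ 2 * (D.η / R) := by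
          have : χ (x + D.e i) ^ 2 - χ x ^ 2 = (χ (x + D.e i) + χ x) * (χ (x + D.e i) - χ x) := by ring
          rw [this, abs_mul, abs_of_nonneg (add_nonneg (h2.h0 _) (h2.h0 _))]
          exact mul_le_mul (by linarith [h2.h1 x, h2.h1 (x + D.e i)]) (h2.hL i x hk) (abs_nonneg _) (by norm_num)
        have d2 : (χ (x + D.e i) ^ 2 - χ x ^ 2) * l' * Δ ≤ 2 * (D.η / R) * B0 * |Δ| := by
          calc _ ≤ |(χ (x + D.e i) ^ 2 - χ x ^ 2) * l' * Δ| := le_abs_self _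
            _ = |χ (x + D.e i) ^ 2 - χ x ^ 2| * |l'| * |Δ| := by rw [abs_mul, abs_mul]
            _ ≤ _ := by
              refine mul_le_mul_of_nonneg_right ?_ (abs_nonneg _)
              exact mul_le_mul d1 (hB _ (hg _).1 (hg _).2) (abs_nonneg _) (by positivity)
        have d3 : 2 * (D.η / R) * B0 * |Δ| ≤ B0 / R * (D.η ^ 2 + Δ * Δ) := by
          have : 2 * (D.η / R) * B0 * |Δ| = B0 / R * (2 * D.η * |Δ|) := by ring
          rw [this]
          refine mul_le_mul_of_nonneg_left ?_ (by positivity)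
          rw [← abs_mul_abs_self Δ]; nlinarith [sq_nonneg (D.η - |Δ|)]
        have d4 : D.c D.V i x * D.η ^ 2 ≤ 1 / 2 * D.w D.V x + 1 / 2 * D.w D.V (x + D.e i) := by
          have hη := h.hη.ne'
          have hcw : D.c D.V i x * D.η ^ 2 = Real.exp (-D.V x / 2) * Real.exp (-D.V (x + D.e i) / 2) := by
            simp only [c, hk, mul_one]
            rw [mul_right_comm, ← mul_pow, inv_mul_cancel₀ hη, one_pow, one_mul, ← Real.exp_add]
            congr 1; ring
          have w1 : D.w D.V x = Real.exp (-D.V x / 2) ^ 2 := by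
            rw [w, ← Real.exp_nat_mul]; congr 1; push_cast; ring
          have w2 : D.w D.V (x + D.e i) = Real.exp (-D.V (x + D.e i) / 2) ^ 2 := by
            rw [w, ← Real.exp_nat_mul]; congr 1; push_cast; ring
          rw [hcw, w1, w2]
          nlinarith [sq_nonneg (Real.exp (-D.V x / 2) - Real.exp (-D.V (x + D.e i) / 2))]
        have d5 := mul_le_mul_of_nonneg_left (d2.trans d3) hc
        refine d5.trans ?_
        have d6 := mul_le_mul_of_nonneg_left d4 (by positivity : 0 ≤ B0 / R)
        linarith
  refine (Finset.sum_le_sum fun i _ => Finset.sum_le_sum fun x _ => pt i x).trans (le_of_eq ?_)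
  simp only [Finset.sum_add_distrib, ← Finset.mul_sum]
  have sh : ∀ i, ∑ x, D.w D.V (x + D.e i) = ∑ x, D.w D.V x := fun i => sum_shift' (D.e i) (D.w D.V)
  simp only [sh, Finset.sum_const, Finset.card_univ, Fintype.card_fin, nsmul_eq_mul, E, En]
  have e1 : ∑ i, ∑ x, D.w D.Va x * (χ x ^ 2 * (D.v g i x ^ 2 / hh x)) =
      ∑ x, D.w D.Va x * (χ x ^ 2 * ((∑ i, D.v g i x ^ 2) / hh x)) := by
    rw [Finset.sum_comm]
    simp only [Finset.sum_div, Finset.mul_sum]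
  rw [e1]
  congr 1
  ring

lemma it_mass (D : GD d G) (U : G → ℝ) (τ : ℝ) (F : G → ℝ) (n : ℕ) :
    ∑ x, D.w U x * D.it U τ F n x = ∑ x, D.w U x * F x := by
  induction n with
  | zero => rfl
  | succ n ih => exact (sum_stp (D.w_pos U) _).trans ih

/-- Fisher information -/
noncomputable def I0 (D : GD d G) (F : G → ℝ) : ℝ := ∑ x, D.w D.Va x * ((∑ i, D.v F i x ^ 2) / F x)

lemma fisher_le (h : D.Ok ε rr) (h2 : D.Ok2 M χ ε K R) (hτ : 0 ≤ τ) 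
    (hτr : 2 * τ * rr ≤ 1) (hl0 : 0 ≤ lam) (hC : Con M τ lam)
    {b C δ : ℝ} (hb : 0 < b) (hF : ∀ x, b ≤ F x ∧ F x ≤ C) (hδ : 0 < δ) (n : ℕ) :
    ∑ x, D.w D.Va x * (χ x ^ 2 * ((∑ i, D.v (D.it D.V τ F n) i x ^ 2) / D.it D.Va τ F n x)) ≤
      (1 + δ) * (lam ^ n * D.I0 F) + (1 + 1 / δ) * b⁻¹ * D.Y M χ τ F n := by
  have hcone := tv_cone h hτ hτr hl0 hC hb hF n
  set q := D.it D.Va τ (fun x => (∑ i, D.v F i x ^ 2) / F x) n with hq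
  have hmass : ∑ x, D.w D.Va x * q x = D.I0 F := it_mass D D.Va τ _ n
  have hhb : ∀ x, b ≤ D.it D.Va τ F n x := fun x => (h.it_bd D.Va h.hra hτ hτr hF n x).1
  have hYc : D.Y M χ τ F n = ∑ x, D.w D.Va x * (χ x ^ 2 *
      ∑ i, (D.v (D.it D.V τ F n) i x - D.tv M τ F n i x) ^ 2) := by
    rw [Y, Finset.sum_comm]; simp only [Finset.mul_sum]
  rw [← hmass, hYc, Finset.mul_sum, Finset.mul_sum, Finset.mul_sum, ← Finset.sum_add_distrib]
  refine Finset.sum_le_sum fun x _ => ?_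
  have hhx := hb.trans_le (hhb x)
  have hw := D.w_pos D.Va x
  have hχ1 : χ x ^ 2 ≤ 1 := pow_le_one₀ (h2.h0 x) (h2.h1 x)
  have h3 : ∑ i, D.v (D.it D.V τ F n) i x ^ 2 ≤ (1 + δ) * ∑ i, D.tv M τ F n i x ^ 2 +
      (1 + 1 / δ) * ∑ i, (D.v (D.it D.V τ F n) i x - D.tv M τ F n i x) ^ 2 := by
    rw [Finset.mul_sum, Finset.mul_sum, ← Finset.sum_add_distrib]
    refine Finset.sum_le_sum fun i _ => ?_
    set a := D.v (D.it D.V τ F n) i x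
    set t := D.tv M τ F n i x
    have : (1 + δ) * t ^ 2 + (1 + 1 / δ) * (a - t) ^ 2 - a ^ 2 = δ⁻¹ * (δ * t - (a - t)) ^ 2 := by
      field_simp; ring
    have h4 : 0 ≤ δ⁻¹ * (δ * t - (a - t)) ^ 2 := by positivity
    linarith
  set Zs := ∑ i, (D.v (D.it D.V τ F n) i x - D.tv M τ F n i x) ^ 2
  have hZs : 0 ≤ Zs := Finset.sum_nonneg fun i _ => sq_nonneg _
  have hqn : 0 ≤ lam ^ n * q x := mul_nonneg (pow_nonneg hl0 n) (hcone.1 x)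
  have h5 : (∑ i, D.v (D.it D.V τ F n) i x ^ 2) / D.it D.Va τ F n x ≤
      (1 + δ) * (lam ^ n * q x) + (1 + 1 / δ) * (b⁻¹ * Zs) := by
    rw [div_le_iff₀ hhx]
    refine h3.trans ?_
    have c1 := mul_le_mul_of_nonneg_left (hcone.2 x) (by positivity : 0 ≤ 1 + δ)
    have c2 : Zs ≤ b⁻¹ * Zs * D.it D.Va τ F n x := by
      have : 1 ≤ b⁻¹ * D.it D.Va τ F n x := by
        rw [inv_mul_eq_div, le_div_iff₀ hb]; linarith [hhb x]
      nlinarith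
    have c3 := mul_le_mul_of_nonneg_left c2 (by positivity : 0 ≤ 1 + 1 / δ)
    linarith
  have h6 := mul_le_mul_of_nonneg_left h5 (by positivity : 0 ≤ D.w D.Va x * χ x ^ 2)
  have h7 : D.w D.Va x * χ x ^ 2 * ((1 + δ) * (lam ^ n * q x)) ≤ D.w D.Va x * ((1 + δ) * (lam ^ n * q x)) := by
    refine mul_le_mul_of_nonneg_right (mul_le_of_le_one_right hw.le hχ1) (by positivity)
  linarith

end GD
end conc
end Grid

set_option linter.unusedSectionVars false
set_option linter.unusedVariables false

namespace Grid
section conc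
variable {d : ℕ} {G : Type} [Fintype G] [AddCommGroup G]
namespace GD
variable {D : GD d G} {ε rr τ : ℝ} {M : G → Fin d → Fin d → ℝ} {χ : G → ℝ} {K R : ℝ}
variable {lam : ℝ} {F : G → ℝ}

lemma I0_nonneg {b : ℝ} (D : GD d G) (hb : 0 < b) (hF : ∀ x, b ≤ F x) : 0 ≤ D.I0 F := by
  refine Finset.sum_nonneg fun x _ => mul_nonneg (D.w_pos _ _).le ?_
  exact div_nonneg (Finset.sum_nonneg fun i _ => sq_nonneg _) (hb.le.trans (hF x))

lemma ent_sum (h : D.Ok ε rr) (h2 : D.Ok2 M χ ε K R) (hτ : 0 ≤ τ) (hτ1 : τ ≤ 1)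
    (hτr : 2 * τ * rr ≤ 1) (hl0 : 0 ≤ lam) (hl1 : lam ≤ 1) (hC : Con M τ lam)
    {b C E0 S T B0 δ Q : ℝ} (hb : 0 < b) (hF : ∀ x, b ≤ F x ∧ F x ≤ C) (hFm : D.Mon F)
    (hE : D.E D.V F F ≤ E0) (hS0 : 0 ≤ S)
    (hS : ∀ g t, (∀ x, |g x| ≤ C) → D.nn t ≤ 2 * E0 → D.Psi M χ g t ≤ S)
    (hB0 : 0 ≤ B0) (hB : ∀ s, b ≤ s → s ≤ C → |1 + Real.log s| ≤ B0) (hδ : 0 < δ) (n : ℕ)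
    (hT : n * τ ≤ T) (hQ : τ * ∑ k ∈ Finset.range n, lam ^ k ≤ Q) :
    ∑ x, D.w D.V x * (χ x ^ 2 * (Ph (F x) - Ph (D.it D.V τ F n x))) ≤
      Real.exp ε * ((1 + δ) * Q * D.I0 F + T * ((1 + 1 / δ) * b⁻¹ * (Yb d T R ε E0 + T * τ * S))) +
      T * (B0 / R * (d * ∑ x, D.w D.V x + E0)) := by
  have hR : 0 < R := lt_of_lt_of_le one_pos h2.hR
  have hE0 : 0 ≤ E0 := (En_nonneg (h.c0 _) F).trans hE
  have hε := h.hε0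
  have hW : 0 ≤ ∑ x, D.w D.V x := Finset.sum_nonneg fun x _ => (D.w_pos _ x).le
  have hI := D.I0_nonneg hb (fun x => (hF x).1)
  have hT0 : 0 ≤ T := le_trans (by positivity) hT
  set Y1 := Yb d T R ε E0 + T * τ * S with hY1
  have hYb0 : 0 ≤ Y1 := by rw [hY1, Yb]; positivity
  set B1 := B0 / R * (d * ∑ x, D.w D.V x + E0) with hB1
  have hB10 : 0 ≤ B1 := by rw [hB1]; positivity
  have step : ∀ k, k < n → ∑ x, D.w D.V x * (χ x ^ 2 * (Ph (D.it D.V τ F k x) - Ph (D.it D.V τ F (k+1) x))) ≤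
      Real.exp ε * ((1 + δ) * D.I0 F) * (τ * lam ^ k) + τ * (Real.exp ε * ((1 + 1 / δ) * b⁻¹ * Y1) + B1) := by
    intro k hk
    have hkT : k * τ ≤ T := le_trans (mul_le_mul_of_nonneg_right (by exact_mod_cast hk.le) hτ) hT
    have a1 := ent_step h h2 hτ hτr hb hB (h.it_bd D.V h.hrV hτ hτr hF k)
      (fun x => (h.it_bd D.Va h.hra hτ hτr hF k x).1) (h.it_comp hτ hτr hFm k) (h.it_mon hτ hτr hFm k)
    have a2 := fisher_le h h2 hτ hτr hl0 hC hb hF hδ k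
    have a3 := Y_le h h2 hτ hτ1 hτr hl0 hl1 hC hb hF hE hS0 hS k hkT
    have a4 := (h.E_it (F := F) hτ hτr k).trans hE
    refine a1.trans ?_
    have a5 := mul_le_mul_of_nonneg_left a3 (by positivity : 0 ≤ (1 + 1 / δ) * b⁻¹)
    have a6 := mul_le_mul_of_nonneg_left (a2.trans (add_le_add_right a5 _)) (Real.exp_pos ε).le
    have a7 : B0 / R * (d * ∑ x, D.w D.V x + D.E D.V (D.it D.V τ F k) (D.it D.V τ F k)) ≤ B1 :=
      mul_le_mul_of_nonneg_left (by linarith) (by positivity)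
    have a8 := mul_le_mul_of_nonneg_left (add_le_add a6 a7) hτ
    refine a8.trans (le_of_eq ?_)
    ring
  have tel : ∀ m, m ≤ n → ∑ x, D.w D.V x * (χ x ^ 2 * (Ph (F x) - Ph (D.it D.V τ F m x))) ≤
      Real.exp ε * ((1 + δ) * D.I0 F) * (τ * ∑ k ∈ Finset.range m, lam ^ k) +
      m * τ * (Real.exp ε * ((1 + 1 / δ) * b⁻¹ * Y1) + B1) := by
    intro m
    induction m with
    | zero => intro _; simp [it]
    | succ m ih =>
      intro hm
      have i1 := ih (by omega)
      have i2 := step m (by omega)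
      have : ∑ x, D.w D.V x * (χ x ^ 2 * (Ph (F x) - Ph (D.it D.V τ F (m+1) x))) =
        ∑ x, D.w D.V x * (χ x ^ 2 * (Ph (F x) - Ph (D.it D.V τ F m x))) +
        ∑ x, D.w D.V x * (χ x ^ 2 * (Ph (D.it D.V τ F m x) - Ph (D.it D.V τ F (m+1) x))) := by
        rw [← Finset.sum_add_distrib]; exact Finset.sum_congr rfl fun x _ => by ring
      rw [this, Finset.sum_range_succ]
      push_cast
      linarith
  refine (tel n le_rfl).trans ?_
  have b1 := mul_le_mul_of_nonneg_left hQ (by positivity : 0 ≤ Real.exp ε * ((1 + δ) * D.I0 F))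
  have b2 := mul_le_mul_of_nonneg_right hT (by positivity : 0 ≤ Real.exp ε * ((1 + 1 / δ) * b⁻¹ * Y1) + B1)
  linarith

lemma ent_end [Nonempty G] (h : D.Ok ε rr) (h2 : D.Ok2 M χ ε K R) (hτ : 0 ≤ τ)
    (hτr : 2 * τ * rr ≤ 1) (hl0 : 0 ≤ lam) (hC : Con M τ lam)
    {b C E0 B0 CP W gb : ℝ} (hb : 0 < b) (hF : ∀ x, b ≤ F x ∧ F x ≤ C)
    (hE : D.E D.V F F ≤ E0) 
    (hB : ∀ s, b ≤ s → s ≤ C → |1 + Real.log s| ≤ B0) (hCP : 0 ≤ CP)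
    (hPo : ∀ g : G → ℝ, (∀ x, b ≤ g x ∧ g x ≤ C) → ∃ c : ℝ, ∑ x, D.w D.V x * (g x - c) ^ 2 ≤
      CP * ∑ i, ∑ x, D.w D.Va x * (χ x ^ 2 * D.v g i x ^ 2) + W)
    (hgb : gb * ∑ x, D.w D.V x = ∑ x, D.w D.V x * F x) (n : ℕ) :
    ∑ x, D.w D.V x * (χ x ^ 2 * Ph (D.it D.V τ F n x)) ≤
      Ph gb * ∑ x, D.w D.V x * χ x ^ 2 + B0 * C * ∑ x, D.w D.V x * (1 - χ x ^ 2) +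
      b⁻¹ * (CP * (4 * (lam ^ n * E0) + 2 * D.Y M χ τ F n) + W) := by
  have hW : 0 < ∑ x, D.w D.V x := Finset.sum_pos (fun x _ => D.w_pos _ x) Finset.univ_nonempty
  have hgb1 : b ≤ gb := by
    by_contra hlt
    have : ∑ x, D.w D.V x * F x ≥ b * ∑ x, D.w D.V x := by
      rw [Finset.mul_sum]
      exact Finset.sum_le_sum fun x _ => by rw [mul_comm]; exact mul_le_mul_of_nonneg_left (hF x).1 (D.w_pos _ x).le
    nlinarith
  have hgb2 : gb ≤ C := by
    by_contra hlt
    have : ∑ x, D.w D.V x * F x ≤ C * ∑ x, D.w D.V x := by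
      rw [Finset.mul_sum]
      exact Finset.sum_le_sum fun x _ => by rw [mul_comm C]; exact mul_le_mul_of_nonneg_left (hF x).2 (D.w_pos _ x).le
    nlinarith
  have hgbp := hb.trans_le hgb1
  set g := D.it D.V τ F n with hg
  have hgF := h.it_bd D.V h.hrV hτ hτr hF n
  have hmass : ∑ x, D.w D.V x * g x = gb * ∑ x, D.w D.V x := by rw [hgb]; exact it_mass D D.V τ F n
  have hmass0 : ∑ x, D.w D.V x * (g x - gb) = 0 := by
    simp only [mul_sub, Finset.sum_sub_distrib, hmass, ← Finset.sum_mul]; ring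
  obtain ⟨c, hc⟩ := hPo g hgF
  have hvar : ∑ x, D.w D.V x * (g x - gb) ^ 2 ≤ ∑ x, D.w D.V x * (g x - c) ^ 2 := by
    have : ∑ x, D.w D.V x * (g x - c) ^ 2 = ∑ x, D.w D.V x * (g x - gb) ^ 2 +
      2 * (gb - c) * ∑ x, D.w D.V x * (g x - gb) + (gb - c) ^ 2 * ∑ x, D.w D.V x := by
      rw [Finset.mul_sum, Finset.mul_sum, ← Finset.sum_add_distrib, ← Finset.sum_add_distrib]
      exact Finset.sum_congr rfl fun x _ => by ring
    rw [this, hmass0]; nlinarith [sq_nonneg (gb - c)]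
  have hgr : ∑ i, ∑ x, D.w D.Va x * (χ x ^ 2 * D.v g i x ^ 2) ≤ 4 * (lam ^ n * E0) + 2 * D.Y M χ τ F n := by
    have h3 : ∑ i, ∑ x, D.w D.Va x * (χ x ^ 2 * D.v g i x ^ 2) ≤
        2 * D.nn (D.tv M τ F n) + 2 * D.Y M χ τ F n := by
      simp only [nn, N, Y, Finset.mul_sum, ← Finset.sum_add_distrib]
      refine Finset.sum_le_sum fun i _ => Finset.sum_le_sum fun x _ => ?_
      have hw := D.w_pos D.Va x
      have hχ1 : χ x ^ 2 ≤ 1 := pow_le_one₀ (h2.h0 x) (h2.h1 x)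
      rw [← hg]
      set a := D.v g i x
      set t := D.tv M τ F n i x
      have e1 : a ^ 2 ≤ 2 * t ^ 2 + 2 * (a - t) ^ 2 := by nlinarith [sq_nonneg (a - 2 * t)]
      have e2 := mul_le_mul_of_nonneg_left e1 (by positivity : 0 ≤ D.w D.Va x * χ x ^ 2)
      have e3 : D.w D.Va x * χ x ^ 2 * (2 * t ^ 2) ≤ D.w D.Va x * (2 * t ^ 2) := 
        mul_le_mul_of_nonneg_right (mul_le_of_le_one_right hw.le hχ1) (by positivity)
      linarith
    have h4 := tv_pow (F := F) h hτ hτr hl0 hC n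
    have h5 : D.nn (D.v F) ≤ 2 * E0 := (h.nn_v F).trans (by linarith)
    have h6 := mul_le_mul_of_nonneg_left h5 (pow_nonneg hl0 n)
    linarith
  have hB0 := hB gb hgb1 hgb2
  have pt : ∀ x, D.w D.V x * (χ x ^ 2 * Ph (g x)) ≤ Ph gb * (D.w D.V x * χ x ^ 2) +
      (1 + Real.log gb) * (D.w D.V x * (g x - gb)) + B0 * C * (D.w D.V x * (1 - χ x ^ 2)) +
      b⁻¹ * (D.w D.V x * (g x - gb) ^ 2) := by
    intro x
    have hw := D.w_pos D.V x
    have hχ1 : χ x ^ 2 ≤ 1 := pow_le_one₀ (h2.h0 x) (h2.h1 x)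
    have e1 := Ph_upper (hb.trans_le (hgF x).1) hgbp
    have e2 := mul_le_mul_of_nonneg_left e1 (by positivity : 0 ≤ D.w D.V x * χ x ^ 2)
    have e3 : D.w D.V x * χ x ^ 2 * (gb⁻¹ * (g x - gb) ^ 2) ≤ b⁻¹ * (D.w D.V x * (g x - gb) ^ 2) := by
      calc _ = gb⁻¹ * (D.w D.V x * (g x - gb) ^ 2) * χ x ^ 2 := by ring
        _ ≤ gb⁻¹ * (D.w D.V x * (g x - gb) ^ 2) := mul_le_of_le_one_right (by positivity) hχ1
        _ ≤ _ := mul_le_mul_of_nonneg_right (inv_anti₀ hb hgb1) (by positivity)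
    have e4 : -((1 + Real.log gb) * (g x - gb)) ≤ B0 * C := by
      refine (neg_le_abs _).trans ?_
      rw [abs_mul]
      refine mul_le_mul hB0 ?_ (abs_nonneg _) ((abs_nonneg _).trans hB0)
      rw [abs_le]; constructor <;> linarith [(hgF x).1, (hgF x).2]
    have e5 := mul_le_mul_of_nonneg_left e4 (mul_nonneg hw.le (sub_nonneg.2 hχ1))
    linarith
  refine (Finset.sum_le_sum fun x _ => pt x).trans ?_
  simp only [Finset.sum_add_distrib, ← Finset.mul_sum]
  rw [hmass0]
  have f1 := hvar.trans (hc.trans (add_le_add_left (mul_le_mul_of_nonneg_left hgr hCP) W))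
  have f2 := mul_le_mul_of_nonneg_left f1 (inv_pos.2 hb).le
  linarith

lemma con_of (M : G → Fin d → Fin d → ℝ) {κ κ' : ℝ} (hκ : κ' < κ) 
    (hM : ∀ x (y : Fin d → ℝ), κ * ∑ i, y i ^ 2 ≤ ∑ i, y i * ∑ j, M x i j * y j) :
    ∃ τ0 > 0, ∀ τ, 0 ≤ τ → τ ≤ τ0 → Con M τ (1 - 2 * τ * κ') := by
  set B := ∑ x, ∑ i, ∑ j, M x i j ^ 2 with hB
  have hB0 : 0 ≤ B := by positivity
  refine ⟨2 * (κ - κ') / (1 + B), by have := sub_pos.2 hκ; positivity, fun τ h0 h1 x y => ?_⟩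
  have hτB : τ * B ≤ 2 * (κ - κ') := by
    rw [le_div_iff₀ (by positivity)] at h1; nlinarith
  have hMy : ∑ i, (∑ j, M x i j * y j) ^ 2 ≤ B * ∑ i, y i ^ 2 := by
    have : ∑ i, ∑ j, M x i j ^ 2 ≤ B := Finset.single_le_sum (f := fun x => ∑ i, ∑ j, M x i j ^ 2)
      (fun x _ => by positivity) (Finset.mem_univ x)
    refine le_trans ?_ (mul_le_mul_of_nonneg_right this (by positivity))
    rw [Finset.sum_mul]
    exact Finset.sum_le_sum fun i _ => Finset.sum_mul_sq_le_sq_mul_sq _ _ _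
  have e : ∑ i, (y i - τ * ∑ j, M x i j * y j) ^ 2 = ∑ i, y i ^ 2 - 2 * τ * ∑ i, y i * ∑ j, M x i j * y j +
      τ ^ 2 * ∑ i, (∑ j, M x i j * y j) ^ 2 := by
    rw [Finset.mul_sum, Finset.mul_sum, ← Finset.sum_sub_distrib, ← Finset.sum_add_distrib]
    exact Finset.sum_congr rfl fun i _ => by ring
  rw [e]
  have hN : 0 ≤ ∑ i, y i ^ 2 := by positivity
  have a1 := mul_le_mul_of_nonneg_left (hM x y) (by positivity : 0 ≤ 2 * τ)
  have a2 := mul_le_mul_of_nonneg_left hMy (by positivity : 0 ≤ τ ^ 2)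
  have a3 := mul_le_mul_of_nonneg_right hτB (mul_nonneg h0 hN)
  linarith

open Filter Topology in
theorem grid_main [Nonempty G] (h : D.Ok ε rr) (h2 : D.Ok2 M χ ε K R) {κ κ' : ℝ} (hκ' : 0 < κ') (hκ : κ' < κ)
    (hM : ∀ x (y : Fin d → ℝ), κ * ∑ i, y i ^ 2 ≤ ∑ i, y i * ∑ j, M x i j * y j)
    {b C E0 B0 CP W gb T δ : ℝ} (hb : 0 < b) (hF : ∀ x, b ≤ F x ∧ F x ≤ C) (hFm : D.Mon F)
    (hE : D.E D.V F F ≤ E0) (hT : 0 < T) (hδ : 0 < δ)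
    (hB0 : 0 ≤ B0) (hB : ∀ s, b ≤ s → s ≤ C → |1 + Real.log s| ≤ B0) (hCP : 0 ≤ CP)
    (hPo : ∀ g : G → ℝ, (∀ x, b ≤ g x ∧ g x ≤ C) → ∃ c : ℝ, ∑ x, D.w D.V x * (g x - c) ^ 2 ≤
      CP * ∑ i, ∑ x, D.w D.Va x * (χ x ^ 2 * D.v g i x ^ 2) + W)
    (hgb : gb * ∑ x, D.w D.V x = ∑ x, D.w D.V x * F x) :
    ∑ x, D.w D.V x * (χ x ^ 2 * Ph (F x)) ≤
      Ph gb * ∑ x, D.w D.V x * χ x ^ 2 + B0 * C * ∑ x, D.w D.V x * (1 - χ x ^ 2) +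
      b⁻¹ * (CP * (4 * (Real.exp (-(2 * κ' * T)) * E0) + 2 * Yb d T R ε E0) + W) +
      Real.exp ε * ((1 + δ) * (1 / (2 * κ')) * D.I0 F + T * ((1 + 1 / δ) * b⁻¹ * Yb d T R ε E0)) +
      T * (B0 / R * (d * ∑ x, D.w D.V x + E0)) := by
  obtain ⟨S, hS0, hS⟩ := D.Psi_bdd M χ C (2 * E0)
  obtain ⟨τ0, hτ0, hcon⟩ := con_of M hκ hM
  have hE0 : 0 ≤ E0 := (En_nonneg (h.c0 _) F).trans hE
  have hτt : Tendsto (fun n : ℕ => T / (n : ℝ)) atTop (𝓝 0) := tendsto_const_div_atTop_nhds_zero_nat T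
  set A := b⁻¹ * (CP * (2 * (T * S))) + Real.exp ε * (T * ((1 + 1 / δ) * b⁻¹ * (T * S))) with hA
  have key : ∀ᶠ n : ℕ in atTop, ∑ x, D.w D.V x * (χ x ^ 2 * Ph (F x)) ≤
      (Ph gb * ∑ x, D.w D.V x * χ x ^ 2 + B0 * C * ∑ x, D.w D.V x * (1 - χ x ^ 2) +
      b⁻¹ * (CP * (4 * (Real.exp (-(2 * κ' * T)) * E0) + 2 * Yb d T R ε E0) + W) +
      Real.exp ε * ((1 + δ) * (1 / (2 * κ')) * D.I0 F + T * ((1 + 1 / δ) * b⁻¹ * Yb d T R ε E0)) +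
      T * (B0 / R * (d * ∑ x, D.w D.V x + E0))) + T / (n : ℝ) * A := by
    have hpos : 0 < min (min τ0 1) (min (1 / (2 * rr)) (1 / (2 * κ'))) := by
      have := h.hrr; positivity
    filter_upwards [hτt.eventually (gt_mem_nhds hpos), eventually_gt_atTop 0] with n hn hn0
    have hn0' : (0 : ℝ) < n := by exact_mod_cast hn0
    set τ := T / (n : ℝ) with hτd
    have hτp : 0 < τ := by positivity
    have hnτ : n * τ = T := by rw [hτd]; field_simp
    simp only [lt_min_iff] at hn
    obtain ⟨⟨hn1, hn2⟩, hn3, hn4⟩ := hn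
    have hrr := h.hrr
    rw [lt_div_iff₀ (by positivity)] at hn3 hn4
    have hC := hcon τ hτp.le hn1.le
    set lam := 1 - 2 * τ * κ' with hlam
    have hl0 : 0 ≤ lam := by rw [hlam]; linarith
    have hl1 : lam ≤ 1 := by rw [hlam]; nlinarith
    have hτr : 2 * τ * rr ≤ 1 := by linarith
    have hQ : τ * ∑ k ∈ Finset.range n, lam ^ k ≤ 1 / (2 * κ') := by
      have := mul_neg_geom_sum lam n
      rw [le_div_iff₀ (by positivity)]
      have e : 1 - lam = 2 * τ * κ' := by rw [hlam]; ring
      rw [e] at this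
      have := pow_nonneg hl0 n
      linarith
    have hln : lam ^ n ≤ Real.exp (-(2 * κ' * T)) := by
      have : lam ≤ Real.exp (-(2 * κ' * τ)) := by
        have := Real.add_one_le_exp (-(2 * κ' * τ)); rw [hlam]; linarith
      refine (pow_le_pow_left₀ hl0 this n).trans (le_of_eq ?_)
      rw [← Real.exp_nat_mul, ← hnτ]; congr 1; ring
    have a1 := ent_sum h h2 hτp.le hn2.le hτr hl0 hl1 hC hb hF hFm hE hS0 hS hB0 hB hδ n hnτ.le hQ
    have a2 := ent_end h h2 hτp.le hτr hl0 hC hb hF hE hB hCP hPo hgb n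
    have a3 := Y_le h h2 hτp.le hn2.le hτr hl0 hl1 hC hb hF hE hS0 hS n hnτ.le
    have a4 : ∑ x, D.w D.V x * (χ x ^ 2 * Ph (F x)) =
      ∑ x, D.w D.V x * (χ x ^ 2 * (Ph (F x) - Ph (D.it D.V τ F n x))) +
      ∑ x, D.w D.V x * (χ x ^ 2 * Ph (D.it D.V τ F n x)) := by
      rw [← Finset.sum_add_distrib]; exact Finset.sum_congr rfl fun x _ => by ring
    rw [a4]
    have a5 : b⁻¹ * (CP * (4 * (lam ^ n * E0) + 2 * D.Y M χ τ F n) + W) ≤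
        b⁻¹ * (CP * (4 * (Real.exp (-(2 * κ' * T)) * E0) + 2 * (Yb d T R ε E0 + T * τ * S)) + W) := by
      have := mul_le_mul_of_nonneg_right hln hE0
      gcongr
    refine (add_le_add a1 (a2.trans (add_le_add_right a5 _))).trans (le_of_eq ?_)
    rw [hA]; ring
  have lim := (hτt.mul_const A).const_add (Ph gb * ∑ x, D.w D.V x * χ x ^ 2 + B0 * C * ∑ x, D.w D.V x * (1 - χ x ^ 2) +
      b⁻¹ * (CP * (4 * (Real.exp (-(2 * κ' * T)) * E0) + 2 * Yb d T R ε E0) + W) +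
      Real.exp ε * ((1 + δ) * (1 / (2 * κ')) * D.I0 F + T * ((1 + 1 / δ) * b⁻¹ * Yb d T R ε E0)) +
      T * (B0 / R * (d * ∑ x, D.w D.V x + E0)))
  rw [zero_mul, add_zero] at lim
  exact ge_of_tendsto lim key

end GD
end conc
end Grid

set_option linter.unusedSectionVars false
set_option linter.unusedVariables false

namespace Grid

lemma path_bound (L : ℕ) (h : ℕ → ℝ) {s t : ℕ} (hs : s ≤ L) (ht : t ≤ L) :
    (h s - h t) ^ 2 ≤ L * ∑ u ∈ Finset.range L, (h (u + 1) - h u) ^ 2 := by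
  have aux : ∀ {s t : ℕ}, s ≤ t → t ≤ L → (h s - h t) ^ 2 ≤ L * ∑ u ∈ Finset.range L, (h (u + 1) - h u) ^ 2 := by
    intro s t hst ht
    have e : h t - h s = ∑ u ∈ Finset.Ico s t, (h (u + 1) - h u) := (Finset.sum_Ico_sub h hst).symm
    rw [sub_sq_comm, e]
    refine (sq_sum_le_card_mul_sum_sq).trans ?_
    have hc : ((Finset.Ico s t).card : ℝ) ≤ L := by
      rw [Nat.card_Ico]; exact_mod_cast (Nat.sub_le t s).trans ht
    refine mul_le_mul hc ?_ (Finset.sum_nonneg fun _ _ => sq_nonneg _) (Nat.cast_nonneg _)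
    refine Finset.sum_le_sum_of_subset_of_nonneg (fun u hu => ?_) fun _ _ _ => sq_nonneg _
    rw [Finset.mem_Ico] at hu; rw [Finset.mem_range]; omega
  rcases le_total s t with hl | hl
  · exact aux hl ht
  · rw [sub_sq_comm]; exact aux hl hs

section poin
variable {d L : ℕ}

/-- shift by one in coordinate j -/
def up (L : ℕ) {d : ℕ} (x : Fin d → Fin (L + 1)) (j : Fin d) : Fin d → Fin (L + 1) :=
  Function.update x j (x j + 1)

/-- edge energy -/
noncomputable def ed (L : ℕ) {d : ℕ} (g : (Fin d → Fin (L + 1)) → ℝ) (j : Fin d) : ℝ :=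
  ∑ x, if x j = Fin.last L then 0 else (g (up L x j) - g x) ^ 2

lemma upd_sum (j : Fin d) (φ : (Fin d → Fin (L + 1)) → ℝ) :
    ∑ x : Fin d → Fin (L + 1), ∑ u : Fin (L + 1), φ (Function.update x j u) = (L + 1) * ∑ x, φ x := by
  rw [← Fintype.sum_prod_type']
  have hinv : Function.Involutive (fun q : (Fin d → Fin (L + 1)) × Fin (L + 1) => (Function.update q.1 j q.2, q.1 j)) := by
    rintro ⟨x, u⟩
    simp
  have := Equiv.sum_comp hinv.toPerm (fun q => φ q.1)
  simp only [Function.Involutive.coe_toPerm] at this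
  rw [this, Fintype.sum_prod_type]
  simp [Finset.mul_sum]

lemma line_bound (g : (Fin d → Fin (L + 1)) → ℝ) (j : Fin d) (x : Fin d → Fin (L + 1)) (t : Fin (L + 1)) :
    (g x - g (Function.update x j t)) ^ 2 ≤ L * ∑ u : Fin (L + 1),
      (fun y : Fin d → Fin (L + 1) => if y j = Fin.last L then 0 else (g (up L y j) - g y) ^ 2) (Function.update x j u) := by
  set h : ℕ → ℝ := fun u => g (Function.update x j (Fin.ofNat (L + 1) u)) with hh
  have := path_bound L h (s := x j) (t := t) (Nat.lt_succ_iff.1 (x j).2) (Nat.lt_succ_iff.1 t.2)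
  have e1 : h (x j) = g x := by simp [hh]
  have e2 : h t = g (Function.update x j t) := by simp [hh]
  rw [e1, e2] at this
  refine this.trans (le_of_eq ?_)
  congr 1
  rw [Fin.sum_univ_castSucc]
  simp only [Function.update_self, ↓reduceIte, add_zero]
  rw [Finset.sum_range]
  refine Finset.sum_congr rfl fun u _ => ?_
  rw [if_neg (Fin.castSucc_lt_last u).ne]
  simp only [hh, up, Function.update_self, Function.update_idem]
  have e3 : Fin.ofNat (L + 1) (u : ℕ) = Fin.castSucc u := by
    ext; simp
  have e4 : Fin.ofNat (L + 1) ((u : ℕ) + 1) = Fin.castSucc u + 1 := by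
    ext; simp
  rw [e3, e4]

lemma poin_ind (g : (Fin d → Fin (L + 1)) → ℝ) (s : Finset (Fin d)) :
    ∑ x, ∑ y, (g x - g (s.piecewise y x)) ^ 2 ≤
      2 ^ s.card * (Fintype.card (Fin d → Fin (L + 1)) * ((L + 1) ^ 2 * ∑ j ∈ s, ed L g j)) := by
  have hed : ∀ j, 0 ≤ ed L g j := fun j => Finset.sum_nonneg fun x _ => by split_ifs <;> positivity
  induction s using Finset.induction_on with
  | empty => simp
  | insert j s hj ih =>
    set P : ℝ := ((Fintype.card (Fin d → Fin (L + 1)) : ℕ) : ℝ) with hP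
    have hP0 : 0 ≤ P := Nat.cast_nonneg _
    have e : ∀ x y : Fin d → Fin (L + 1), (insert j s).piecewise y x = s.piecewise y (Function.update x j (y j)) := by
      intro x y; ext i
      by_cases hi : i = j
      · subst hi; simp [Finset.piecewise, hj]
      · simp [Finset.piecewise, hi]
    have h1 : ∑ x, ∑ y : Fin d → Fin (L + 1), (g x - g (Function.update x j (y j))) ^ 2 ≤ P * ((L + 1) ^ 2 * ed L g j) := by
      calc ∑ x, ∑ y : Fin d → Fin (L + 1), (g x - g (Function.update x j (y j))) ^ 2
          ≤ ∑ x, ∑ y : Fin d → Fin (L + 1), (L * ∑ u : Fin (L + 1), (fun y : Fin d → Fin (L + 1) => if y j = Fin.last L then 0 else (g (up L y j) - g y) ^ 2) (Function.update x j u)) :=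
            Finset.sum_le_sum fun x _ => Finset.sum_le_sum fun y _ => line_bound g j x (y j)
        _ = P * (L * ((L + 1) * ed L g j)) := by
            rw [Finset.sum_congr rfl fun x _ => Finset.sum_const _]
            rw [← Finset.smul_sum, ← Finset.mul_sum, Finset.card_univ, nsmul_eq_mul]
            rw [upd_sum j (fun y : Fin d → Fin (L + 1) => if y j = Fin.last L then 0 else (g (up L y j) - g y) ^ 2)]; rfl
        _ ≤ _ := by
            refine mul_le_mul_of_nonneg_left ?_ hP0
            nlinarith [hed j, mul_nonneg (Nat.cast_nonneg (α := ℝ) L) (hed j)]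
    have h2 : ∑ x, ∑ y : Fin d → Fin (L + 1), (g (Function.update x j (y j)) - g (s.piecewise y (Function.update x j (y j)))) ^ 2 =
        ∑ x, ∑ y, (g x - g (s.piecewise y x)) ^ 2 := by
      rw [← Fintype.sum_prod_type', ← Fintype.sum_prod_type' (fun x y => (g x - g (s.piecewise y x)) ^ 2)]
      have hinv : Function.Involutive (fun q : (Fin d → Fin (L + 1)) × (Fin d → Fin (L + 1)) =>
          (Function.update q.1 j (q.2 j), Function.update q.2 j (q.1 j))) := by
        rintro ⟨x, u⟩
        simp
      rw [← Equiv.sum_comp hinv.toPerm]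
      refine Finset.sum_congr rfl fun q _ => ?_
      simp only [Function.Involutive.coe_toPerm, Function.update_self]
      have : s.piecewise (Function.update q.2 j (q.1 j)) (Function.update (Function.update q.1 j (q.2 j)) j (q.1 j)) =
          s.piecewise q.2 q.1 := by
        ext i
        by_cases hi : i = j
        · subst hi; simp [Finset.piecewise, hj]
        · simp [Finset.piecewise, hi]
      rw [this]
      simp
    have h3 : ∑ x, ∑ y : Fin d → Fin (L + 1), (g x - g ((insert j s).piecewise y x)) ^ 2 ≤
        2 * (P * ((L + 1) ^ 2 * ed L g j)) + 2 * ∑ x, ∑ y, (g x - g (s.piecewise y x)) ^ 2 := by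
      rw [← h2]
      refine le_trans ?_ (add_le_add_left (mul_le_mul_of_nonneg_left h1 (by norm_num : (0:ℝ) ≤ 2)) _)
      simp only [Finset.mul_sum, ← Finset.sum_add_distrib]
      refine Finset.sum_le_sum fun x _ => Finset.sum_le_sum fun y _ => ?_
      rw [e]
      set A := g x; set B := g (Function.update x j (y j)); set C := g (s.piecewise y (Function.update x j (y j)))
      nlinarith [sq_nonneg (A - B - (B - C))]
    refine h3.trans ?_
    rw [Finset.sum_insert hj, Finset.card_insert_of_notMem hj, pow_succ (2 : ℝ)]
    have h4 : (1 : ℝ) ≤ 2 ^ s.card := one_le_pow₀ (by norm_num)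
    have h5 : 0 ≤ P * ((L + 1) ^ 2 * ed L g j) := by have := hed j; positivity
    have h6 := mul_le_mul_of_nonneg_right h4 h5
    linarith

theorem poincare (g : (Fin d → Fin (L + 1)) → ℝ) :
    ∃ y, ∑ x, (g x - g y) ^ 2 ≤ 2 ^ d * ((L + 1) ^ 2 * ∑ j, ed L g j) := by
  have h := poin_ind g Finset.univ
  simp only [Finset.piecewise_univ, Finset.card_univ, Fintype.card_fin] at h
  rw [Finset.sum_comm] at h
  by_contra! hc
  have := Finset.sum_lt_sum_of_nonempty (s := Finset.univ) Finset.univ_nonempty (fun y _ => hc y)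
  simp only [Finset.sum_const, Finset.card_univ, nsmul_eq_mul] at this
  linarith

end poin
end Grid

set_option linter.unusedSectionVars false
set_option linter.unusedVariables false

namespace Grid
open Filter Topology

section lims
variable {α E : Type} [NormedAddCommGroup E] [NormedSpace ℝ E] {l : Filter α} {η : α → ℝ} {y : α → E} {x0 : E}

lemma tshift (hη : Tendsto η l (𝓝 0)) (hy : Tendsto y l (𝓝 x0)) (u : E) :
    Tendsto (fun a => y a + η a • u) l (𝓝 x0) := by
  simpa using hy.add (hη.smul_const u)

lemma lim1 {φ : E → ℝ} {φ' : E →L[ℝ] ℝ} (hφ : HasStrictFDerivAt φ φ' x0) (hη : Tendsto η l (𝓝 0))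
    (hη0 : ∀ᶠ a in l, η a ≠ 0) (hy : Tendsto y l (𝓝 x0)) (u : E) :
    Tendsto (fun a => (φ (y a + η a • u) - φ (y a)) / η a) l (𝓝 (φ' u)) := by
  have h1 := hφ.isLittleO
  have h2 : Tendsto (fun a => (y a + η a • u, y a)) l (𝓝 (x0, x0)) := (tshift hη hy u).prodMk_nhds hy
  have h3 := h1.comp_tendsto h2
  have h4 : (fun a => φ (y a + η a • u) - φ (y a) - η a * φ' u) =o[l] η := by
    have h5 : (fun a => η a • u) =O[l] η := by
      refine Asymptotics.IsBigO.of_bound ‖u‖ (Eventually.of_forall fun a => ?_)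
      rw [norm_smul, mul_comm]
    refine Asymptotics.IsLittleO.trans_isBigO ?_ h5
    simpa [Function.comp_def] using h3
  have h5 := (h4.tendsto_div_nhds_zero).add_const (φ' u)
  rw [zero_add] at h5
  refine h5.congr' ?_
  filter_upwards [hη0] with a ha
  field_simp; ring

lemma lim2 {φ : E → ℝ} (hφ : ContDiff ℝ 2 φ) (hη : Tendsto η l (𝓝 0))
    (hη0 : ∀ᶠ a in l, η a ≠ 0) (hy : Tendsto y l (𝓝 x0)) (u w : E) :
    Tendsto (fun a => (φ (y a + η a • u + η a • w) - φ (y a + η a • u) - φ (y a + η a • w) + φ (y a)) / η a ^ 2) l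
      (𝓝 (fderiv ℝ (fun z => fderiv ℝ φ z u) x0 w)) := by
  have hd : Differentiable ℝ φ := hφ.differentiable (by norm_num)
  have hmvt : ∀ a, ∃ t : ℝ, t ∈ Set.Ioo (0:ℝ) 1 ∧
      φ (y a + η a • u + η a • w) - φ (y a + η a • u) - φ (y a + η a • w) + φ (y a) =
      η a * (fderiv ℝ φ (y a + (t * η a) • u + η a • w) u - fderiv ℝ φ (y a + (t * η a) • u) u) := by
    intro a
    have hder : ∀ z : E, ∀ t : ℝ, HasDerivAt (fun t : ℝ => φ (z + (t * η a) • u)) (η a * fderiv ℝ φ (z + (t * η a) • u) u) t := by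
      intro z t
      have h1 : HasDerivAt (fun t : ℝ => z + (t * η a) • u) (η a • u) t := by
        have := (((hasDerivAt_id t).mul_const (η a)).smul_const u).const_add z
        simpa using this
      have := (hd (z + (t * η a) • u)).hasFDerivAt.comp_hasDerivAt t h1
      rw [map_smul, smul_eq_mul] at this
      exact this
    have hder2 : ∀ t : ℝ, HasDerivAt (fun t : ℝ => φ (y a + η a • w + (t * η a) • u) - φ (y a + (t * η a) • u))
        (η a * fderiv ℝ φ (y a + η a • w + (t * η a) • u) u - η a * fderiv ℝ φ (y a + (t * η a) • u) u) t :=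
      fun t => (hder _ t).sub (hder _ t)
    obtain ⟨t, ht, he⟩ := exists_hasDerivAt_eq_slope _ _ (zero_lt_one (α := ℝ))
      (fun t _ => (hder2 t).continuousAt.continuousWithinAt) (fun t _ => hder2 t)
    refine ⟨t, ht, ?_⟩
    simp only [one_mul, zero_mul, zero_smul, add_zero, sub_zero, div_one] at he
    rw [add_right_comm (y a) ((t * η a) • u), mul_sub, he, add_right_comm (y a) (η a • w)]
    ring
  choose t ht he using hmvt
  have hsm : ContDiff ℝ 1 (fun z => fderiv ℝ φ z u) := by
    have : ContDiff ℝ 1 (fderiv ℝ φ) := hφ.fderiv_right (by norm_num)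
    exact this.clm_apply contDiff_const
  have hs : HasStrictFDerivAt (fun z => fderiv ℝ φ z u) (fderiv ℝ (fun z => fderiv ℝ φ z u) x0) x0 :=
    hsm.contDiffAt.hasStrictFDerivAt (by norm_num)
  have hy2 : Tendsto (fun a => y a + (t a * η a) • u) l (𝓝 x0) := by
    have h1 : Tendsto (fun a => t a * η a) l (𝓝 0) := by
      refine squeeze_zero_norm (fun a => ?_) (tendsto_norm_zero.comp hη)
      rw [norm_mul]
      have : ‖t a‖ ≤ 1 := by
        rw [Real.norm_eq_abs, abs_le]; constructor <;> linarith [(ht a).1, (ht a).2]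
      exact mul_le_of_le_one_left (norm_nonneg _) this
    exact tshift h1 hy u
  have := lim1 hs hη hη0 hy2 w
  refine this.congr' ?_
  filter_upwards [hη0] with a ha
  rw [he]; field_simp

lemma exp1 {A A' : α → ℝ} {c : ℝ} (hA : Tendsto A l (𝓝 0)) (hA' : Tendsto A' l (𝓝 0)) 
    (hc : Tendsto (fun a => (A' a - A a) / η a ^ 2) l (𝓝 c)) :
    Tendsto (fun a => (Real.exp (A' a) - Real.exp (A a)) / η a ^ 2) l (𝓝 c) := by
  have h1 : HasStrictDerivAt Real.exp 1 0 := by simpa using Real.hasStrictDerivAt_exp 0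
  have h2 := h1.hasStrictFDerivAt.isLittleO.comp_tendsto (hA'.prodMk_nhds hA)
  simp only [Function.comp_def, ContinuousLinearMap.toSpanSingleton_apply, smul_eq_mul, mul_one] at h2
  have h3 : (fun a => (Real.exp (A' a) - Real.exp (A a) - (A' a - A a)) / η a ^ 2) =o[l] fun a => (A' a - A a) / η a ^ 2 := by
    simp only [div_eq_mul_inv]
    exact h2.mul_isBigO (Asymptotics.isBigO_refl _ _)
  have h4 := (h3.trans_isBigO (hc.isBigO_one ℝ))
  rw [Asymptotics.isLittleO_one_iff] at h4
  have := h4.add hc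
  rw [zero_add] at this
  refine this.congr fun a => ?_
  ring

lemma exp_sub_one {A : α → ℝ} {b : ℝ} (hη : Tendsto η l (𝓝 0)) (hη0 : ∀ᶠ a in l, η a ≠ 0) 
    (hb : Tendsto (fun a => A a / η a) l (𝓝 b)) :
    Tendsto A l (𝓝 0) ∧ Tendsto (fun a => (Real.exp (A a) - 1) / η a) l (𝓝 b) := by
  have hA : Tendsto A l (𝓝 0) := by
    have := hb.mul hη
    rw [mul_zero] at this
    refine this.congr' ?_
    filter_upwards [hη0] with a ha
    field_simp
  refine ⟨hA, ?_⟩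
  have h1 : HasDerivAt Real.exp 1 0 := by simpa using Real.hasDerivAt_exp 0
  have h2 := (hasDerivAt_iff_isLittleO.1 h1).comp_tendsto hA
  simp only [Function.comp_def, sub_zero, Real.exp_zero, smul_eq_mul, mul_one] at h2
  have h3 : (fun a => (Real.exp (A a) - 1 - A a) / η a) =o[l] fun a => A a / η a := by
    simp only [div_eq_mul_inv]
    exact h2.mul_isBigO (Asymptotics.isBigO_refl _ _)
  have h4 := (h3.trans_isBigO (hb.isBigO_one ℝ))
  rw [Asymptotics.isLittleO_one_iff] at h4
  have := h4.add hb
  rw [zero_add] at this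
  refine this.congr fun a => ?_
  ring

lemma exp_sq {A : α → ℝ} {b : ℝ} (hη : Tendsto η l (𝓝 0)) (hη0 : ∀ᶠ a in l, η a ≠ 0) 
    (hb : Tendsto (fun a => A a / η a) l (𝓝 b)) :
    Tendsto (fun a => (Real.exp (A a) - 1 - A a) / η a ^ 2) l (𝓝 (b ^ 2 / 2)) := by
  have hA := (exp_sub_one hη hη0 hb).1
  have h2 : (fun a => Real.exp (A a) - 1 - A a - A a ^ 2 / 2) =O[l] fun a => A a ^ 3 := by
    refine Asymptotics.IsBigO.of_bound 1 ?_
    have : ∀ᶠ a in l, |A a| ≤ 1 := by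
      have := hA.abs; rw [abs_zero] at this
      exact (this.eventually (gt_mem_nhds one_pos)).mono fun a h => h.le
    filter_upwards [this] with a ha
    have := Real.exp_bound ha (n := 3) (by norm_num)
    simp only [Finset.sum_range_succ, Finset.sum_range_zero] at this
    norm_num [Nat.factorial] at this
    rw [Real.norm_eq_abs, Real.norm_eq_abs, abs_pow, one_mul]
    have h3 : Real.exp (A a) - 1 - A a - A a ^ 2 / 2 = Real.exp (A a) - (1 + A a + A a ^ 2 / 2) := by ring
    rw [h3]
    refine this.trans ?_
    have := pow_nonneg (abs_nonneg (A a)) 3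
    linarith
  have h3 : (fun a => (Real.exp (A a) - 1 - A a - A a ^ 2 / 2) / η a ^ 2) =O[l] fun a => A a * (A a / η a) ^ 2 := by
    have := h2.mul (Asymptotics.isBigO_refl (fun a => (η a ^ 2)⁻¹) l)
    refine this.congr (fun a => by ring) fun a => ?_
    ring
  have h4 : Tendsto (fun a => A a * (A a / η a) ^ 2) l (𝓝 0) := by
    simpa using hA.mul (hb.pow 2)
  have h5 := (h3.trans_tendsto h4).add ((hb.pow 2).div_const 2)
  rw [zero_add] at h5
  refine h5.congr fun a => ?_
  ring

lemma exp2 {σ σ' : α → ℝ} {b c : ℝ} (hη : Tendsto η l (𝓝 0)) (hη0 : ∀ᶠ a in l, η a ≠ 0)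
    (hσ : Tendsto (fun a => σ a / η a) l (𝓝 b)) (hσ' : Tendsto (fun a => σ' a / η a) l (𝓝 b))
    (hc : Tendsto (fun a => (σ' a - σ a) / η a ^ 2) l (𝓝 c)) :
    Tendsto (fun a => ((Real.exp (-σ a) - 1) + (Real.exp (σ' a) - 1)) / η a ^ 2) l (𝓝 (c + b ^ 2)) := by
  have h1 := exp_sq hη hη0 hσ'
  have h2 := exp_sq (A := fun a => -σ a) hη hη0 (b := -b) (by simpa [neg_div] using hσ.neg)
  have := (h2.add h1).add hc
  have e : (-b) ^ 2 / 2 + b ^ 2 / 2 + c = c + b ^ 2 := by ring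
  rw [e] at this
  refine this.congr fun a => ?_
  ring

end lims
end Grid

set_option linter.unusedSectionVars false
set_option linter.unusedVariables false

namespace Grid
open Filter Topology

section cont
variable {d : ℕ}

/-- unit vector -/
noncomputable def uv (i : Fin d) : EuclideanSpace ℝ (Fin d) := EuclideanSpace.single i 1

/-- continuum forward rate -/
noncomputable def pc (V : EuclideanSpace ℝ (Fin d) → ℝ) (η : ℝ) (j : Fin d) (x : EuclideanSpace ℝ (Fin d)) : ℝ :=
  η⁻¹ ^ 2 * Real.exp ((V x - V (x + η • uv j)) / 2)
/-- continuum backward rate -/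
noncomputable def qc (V : EuclideanSpace ℝ (Fin d) → ℝ) (η : ℝ) (j : Fin d) (x : EuclideanSpace ℝ (Fin d)) : ℝ :=
  η⁻¹ ^ 2 * Real.exp ((V x - V (x - η • uv j)) / 2)
/-- the function a L(1/a) -/
noncomputable def aLc (V al : EuclideanSpace ℝ (Fin d) → ℝ) (x : EuclideanSpace ℝ (Fin d)) : ℝ :=
  ∑ l, (- pd l (fun y => pd l al y) x + pd l al x ^ 2 + pd l V x * pd l al x)
/-- the matrix -/
noncomputable def Mc (V al : EuclideanSpace ℝ (Fin d) → ℝ) (x : EuclideanSpace ℝ (Fin d)) (i j : Fin d) : ℝ :=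
  hess V x i j - if i = j then aLc V al x else 0
/-- continuum consistency error -/
noncomputable def Zc (V al : EuclideanSpace ℝ (Fin d) → ℝ) (η : ℝ) (i j : Fin d) (x : EuclideanSpace ℝ (Fin d)) : ℝ :=
  (pc V η j (x + η • uv i) - pc V η j x) +
  (qc V η j x - qc V η j (x + η • uv i)) * Real.exp (al x - al (x - η • uv j)) + Mc V al x i j +
  if i = j then ∑ l, (pc V η l (x + η • uv i) * (Real.exp (al x - al (x + η • uv l)) - 1) +
    qc V η l (x + η • uv i) * (Real.exp (al x - al (x - η • uv l)) - 1)) else 0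

lemma pd_cont {V : EuclideanSpace ℝ (Fin d) → ℝ} (hV : ContDiff ℝ 1 V) (i : Fin d) : Continuous (pd i V) :=
  (hV.continuous_fderiv (by norm_num)).clm_apply continuous_const

lemma pd_cd {V : EuclideanSpace ℝ (Fin d) → ℝ} (hV : ContDiff ℝ 2 V) (i : Fin d) : ContDiff ℝ 1 (pd i V) := by
  have : ContDiff ℝ 1 (fderiv ℝ V) := hV.fderiv_right (by norm_num)
  exact this.clm_apply contDiff_const

lemma hess_cont {V : EuclideanSpace ℝ (Fin d) → ℝ} (hV : ContDiff ℝ 2 V) (i j : Fin d) :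
    Continuous (fun x => hess V x i j) := pd_cont (pd_cd hV j) i

lemma aLc_cont {V al : EuclideanSpace ℝ (Fin d) → ℝ} (hV : ContDiff ℝ 2 V) (hal : ContDiff ℝ 2 al) :
    Continuous (aLc V al) := by
  unfold aLc
  refine continuous_finsetSum _ fun l _ => ?_
  have h1 := pd_cont (pd_cd hal l) l
  have h2 := pd_cont (hal.of_le (by norm_num)) l
  have h3 := pd_cont (hV.of_le (by norm_num)) l
  exact (h1.neg.add (h2.pow 2)).add (h3.mul h2)

lemma Mc_cont {V al : EuclideanSpace ℝ (Fin d) → ℝ} (hV : ContDiff ℝ 2 V) (hal : ContDiff ℝ 2 al) (i j : Fin d) :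
    Continuous (fun x => Mc V al x i j) := by
  unfold Mc
  refine (hess_cont hV i j).sub ?_
  split_ifs
  · exact aLc_cont hV hal
  · exact continuous_const

variable {α : Type} {l : Filter α} {η : α → ℝ} {y : α → EuclideanSpace ℝ (Fin d)} {x0 : EuclideanSpace ℝ (Fin d)}
variable {V al : EuclideanSpace ℝ (Fin d) → ℝ}

lemma fwd (hV : ContDiff ℝ 2 V) (hη : Tendsto η l (𝓝 0)) (hη0 : ∀ᶠ a in l, η a ≠ 0)
    (hy : Tendsto y l (𝓝 x0)) (j : Fin d) :
    Tendsto (fun a => (V (y a + η a • uv j) - V (y a)) / η a) l (𝓝 (pd j V x0)) :=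
  lim1 (hV.contDiffAt.hasStrictFDerivAt (by norm_num)) hη hη0 hy (uv j)

lemma bshift (hη : Tendsto η l (𝓝 0)) (hy : Tendsto y l (𝓝 x0)) (u : EuclideanSpace ℝ (Fin d)) :
    Tendsto (fun a => y a - η a • u) l (𝓝 x0) := by
  simpa using hy.sub (hη.smul_const u)

lemma bwd (hV : ContDiff ℝ 2 V) (hη : Tendsto η l (𝓝 0)) (hη0 : ∀ᶠ a in l, η a ≠ 0)
    (hy : Tendsto y l (𝓝 x0)) (j : Fin d) :
    Tendsto (fun a => (V (y a) - V (y a - η a • uv j)) / η a) l (𝓝 (pd j V x0)) := by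
  have := fwd hV hη hη0 (bshift hη hy (uv j)) j
  simpa using this

lemma sec (hV : ContDiff ℝ 2 V) (hη : Tendsto η l (𝓝 0)) (hη0 : ∀ᶠ a in l, η a ≠ 0)
    (hy : Tendsto y l (𝓝 x0)) (i j : Fin d) :
    Tendsto (fun a => (V (y a + η a • uv i + η a • uv j) - V (y a + η a • uv i) - V (y a + η a • uv j) + V (y a)) / η a ^ 2)
      l (𝓝 (hess V x0 i j)) := by
  have := lim2 hV hη hη0 hy (uv j) (uv i)
  refine this.congr fun a => ?_
  rw [add_right_comm (y a)]; ring

lemma P_lim (hV : ContDiff ℝ 2 V) (hη : Tendsto η l (𝓝 0)) (hη0 : ∀ᶠ a in l, η a ≠ 0)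
    (hy : Tendsto y l (𝓝 x0)) (i j : Fin d) :
    Tendsto (fun a => pc V (η a) j (y a + η a • uv i) - pc V (η a) j (y a)) l (𝓝 (-(hess V x0 i j / 2))) := by
  have hc : ∀ {z : α → EuclideanSpace ℝ (Fin d)}, Tendsto z l (𝓝 x0) → Tendsto (fun a => V (z a)) l (𝓝 (V x0)) :=
    fun hz => (hV.continuous.tendsto x0).comp hz
  have s1 := tshift hη hy (uv i)
  have s2 := tshift hη hy (uv j)
  have s3 := tshift hη s1 (uv j)
  have hA : Tendsto (fun a => (V (y a) - V (y a + η a • uv j)) / 2) l (𝓝 0) := by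
    simpa using ((hc hy).sub (hc s2)).div_const 2
  have hA' : Tendsto (fun a => (V (y a + η a • uv i) - V (y a + η a • uv i + η a • uv j)) / 2) l (𝓝 0) := by
    simpa using ((hc s1).sub (hc s3)).div_const 2
  have := exp1 (η := η) hA hA' (c := -(hess V x0 i j / 2)) (by
    refine ((sec hV hη hη0 hy i j).div_const 2).neg.congr fun a => ?_
    ring)
  refine this.congr fun a => ?_
  simp only [pc]; ring

lemma Q_lim (hV : ContDiff ℝ 2 V) (hη : Tendsto η l (𝓝 0)) (hη0 : ∀ᶠ a in l, η a ≠ 0)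
    (hy : Tendsto y l (𝓝 x0)) (i j : Fin d) :
    Tendsto (fun a => qc V (η a) j (y a + η a • uv i) - qc V (η a) j (y a)) l (𝓝 (hess V x0 i j / 2)) := by
  have hc : ∀ {z : α → EuclideanSpace ℝ (Fin d)}, Tendsto z l (𝓝 x0) → Tendsto (fun a => V (z a)) l (𝓝 (V x0)) :=
    fun hz => (hV.continuous.tendsto x0).comp hz
  have s1 := tshift hη hy (uv i)
  have s2 := bshift hη hy (uv j)
  have s3 := bshift hη s1 (uv j)
  have hA : Tendsto (fun a => (V (y a) - V (y a - η a • uv j)) / 2) l (𝓝 0) := by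
    simpa using ((hc hy).sub (hc s2)).div_const 2
  have hA' : Tendsto (fun a => (V (y a + η a • uv i) - V (y a + η a • uv i - η a • uv j)) / 2) l (𝓝 0) := by
    simpa using ((hc s1).sub (hc s3)).div_const 2
  have := exp1 (η := η) hA hA' (c := hess V x0 i j / 2) (by
    refine ((sec hV hη hη0 s2 i j).div_const 2).congr fun a => ?_
    have e1 : y a - η a • uv j + η a • uv i + η a • uv j = y a + η a • uv i := by abel
    have e2 : y a - η a • uv j + η a • uv i = y a + η a • uv i - η a • uv j := by abel
    rw [e1, e2, sub_add_cancel]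
    ring)
  refine this.congr fun a => ?_
  simp only [qc]; ring

lemma al_lim (hV : ContDiff ℝ 2 al) (hη : Tendsto η l (𝓝 0)) 
    (hy : Tendsto y l (𝓝 x0)) (j : Fin d) :
    Tendsto (fun a => Real.exp (al (y a) - al (y a + η a • uv j))) l (𝓝 1) ∧
    Tendsto (fun a => Real.exp (al (y a) - al (y a - η a • uv j))) l (𝓝 1) := by
  have hc : ∀ {z : α → EuclideanSpace ℝ (Fin d)}, Tendsto z l (𝓝 x0) → Tendsto (fun a => al (z a)) l (𝓝 (al x0)) :=
    fun hz => (hV.continuous.tendsto x0).comp hz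
  constructor
  · have := (Real.continuous_exp.tendsto _).comp ((hc hy).sub (hc (tshift hη hy (uv j))))
    simpa [Function.comp_def] using this
  · have := (Real.continuous_exp.tendsto _).comp ((hc hy).sub (hc (bshift hη hy (uv j))))
    simpa [Function.comp_def] using this

lemma T_lim (hV : ContDiff ℝ 2 V) (hal : ContDiff ℝ 2 al) (hη : Tendsto η l (𝓝 0)) (hη0 : ∀ᶠ a in l, η a ≠ 0)
    (hy : Tendsto y l (𝓝 x0)) (i k : Fin d) :
    Tendsto (fun a => pc V (η a) k (y a + η a • uv i) * (Real.exp (al (y a) - al (y a + η a • uv k)) - 1) +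
      qc V (η a) k (y a + η a • uv i) * (Real.exp (al (y a) - al (y a - η a • uv k)) - 1)) l
      (𝓝 (- pd k (fun y => pd k al y) x0 + pd k al x0 ^ 2 + pd k V x0 * pd k al x0)) := by
  have s1 := tshift hη hy (uv i)
  have a1 := fwd hal hη hη0 hy k
  have a2 := bwd hal hη hη0 hy k
  have a3 : Tendsto (fun a => ((al (y a) - al (y a - η a • uv k)) - (al (y a + η a • uv k) - al (y a))) / η a ^ 2) l
      (𝓝 (- pd k (fun y => pd k al y) x0)) := by
    have := (sec hal hη hη0 (bshift hη hy (uv k)) k k).neg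
    refine this.congr fun a => ?_
    rw [sub_add_cancel]; ring
  have b1 := exp2 hη hη0 a1 a2 a3
  have v1 := exp_sub_one (A := fun a => (V (y a + η a • uv i) - V (y a + η a • uv i + η a • uv k)) / 2) (b := -(pd k V x0 / 2)) hη hη0 (by
    refine ((fwd hV hη hη0 s1 k).div_const 2).neg.congr fun a => ?_
    ring)
  have v2 := exp_sub_one (A := fun a => (V (y a + η a • uv i) - V (y a + η a • uv i - η a • uv k)) / 2) (b := (pd k V x0 / 2)) hη hη0 (by
    refine ((bwd hV hη hη0 s1 k).div_const 2).congr fun a => ?_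
    ring)
  have w1 := exp_sub_one (A := fun a => al (y a) - al (y a + η a • uv k)) (b := - pd k al x0) hη hη0 (by
    refine a1.neg.congr fun a => ?_
    ring)
  have w2 := exp_sub_one (A := fun a => al (y a) - al (y a - η a • uv k)) (b := pd k al x0) hη hη0 a2
  have := (b1.add (v1.2.mul w1.2)).add (v2.2.mul w2.2)
  have e : - pd k (fun y => pd k al y) x0 + pd k al x0 ^ 2 + -(pd k V x0 / 2) * - pd k al x0 + pd k V x0 / 2 * pd k al x0 =
    - pd k (fun y => pd k al y) x0 + pd k al x0 ^ 2 + pd k V x0 * pd k al x0 := by ring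
  rw [e] at this
  refine this.congr' ?_
  filter_upwards [hη0] with a ha
  simp only [pc, qc, neg_sub]
  field_simp
  ring

lemma Z_lim (hV : ContDiff ℝ 2 V) (hal : ContDiff ℝ 2 al) (hη : Tendsto η l (𝓝 0)) (hη0 : ∀ᶠ a in l, η a ≠ 0)
    (hy : Tendsto y l (𝓝 x0)) (i j : Fin d) :
    Tendsto (fun a => Zc V al (η a) i j (y a)) l (𝓝 0) := by
  have h1 := P_lim hV hη hη0 hy i j
  have h2 := ((Q_lim hV hη hη0 hy i j).neg).mul (al_lim hal hη hy j).2
  have h3 := ((Mc_cont hV hal i j).tendsto x0).comp hy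
  have h4 : Tendsto (fun a => if i = j then ∑ l, (pc V (η a) l (y a + η a • uv i) * (Real.exp (al (y a) - al (y a + η a • uv l)) - 1) +
    qc V (η a) l (y a + η a • uv i) * (Real.exp (al (y a) - al (y a - η a • uv l)) - 1)) else 0) l (𝓝 (if i = j then aLc V al x0 else 0)) := by
    split_ifs
    · exact tendsto_finsetSum _ fun k _ => T_lim hV hal hη hη0 hy i k
    · exact tendsto_const_nhds
  have := ((h1.add h2).add h3).add h4
  have e : -(hess V x0 i j / 2) + -(hess V x0 i j / 2) * 1 + Mc V al x0 i j + (if i = j then aLc V al x0 else 0) = 0 := by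
    rw [Mc]; ring
  rw [e] at this
  refine this.congr fun a => ?_
  simp only [Zc, Function.comp_apply]; ring

lemma unif {K : Set (EuclideanSpace ℝ (Fin d))} (hK : IsCompact K) {P : ℝ → EuclideanSpace ℝ (Fin d) → Prop}
    (hP : ∀ x ∈ K, ∀ᶠ z in 𝓝[>] (0:ℝ) ×ˢ 𝓝 x, P z.1 z.2) : ∀ᶠ η in 𝓝[>] (0:ℝ), ∀ x ∈ K, P η x := by
  have h1 : {z : ℝ × EuclideanSpace ℝ (Fin d) | P z.1 z.2} ∈ 𝓝[>] (0:ℝ) ×ˢ 𝓝ˢ K :=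
    hK.mem_prod_nhdsSet_of_forall hP
  have h2 : {z : ℝ × EuclideanSpace ℝ (Fin d) | P z.1 z.2} ∈ 𝓝[>] (0:ℝ) ×ˢ 𝓟 K :=
    Filter.prod_mono le_rfl principal_le_nhdsSet h1
  exact Filter.eventually_prod_principal_iff.1 h2

lemma tfst (x : EuclideanSpace ℝ (Fin d)) : Tendsto (fun z : ℝ × EuclideanSpace ℝ (Fin d) => z.1) (𝓝[>] (0:ℝ) ×ˢ 𝓝 x) (𝓝 0) :=
  (tendsto_nhdsWithin_iff.1 (tendsto_fst (f := 𝓝[>] (0:ℝ)) (g := 𝓝 x))).1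
lemma tfst0 (x : EuclideanSpace ℝ (Fin d)) : ∀ᶠ z : ℝ × EuclideanSpace ℝ (Fin d) in (𝓝[>] (0:ℝ) ×ˢ 𝓝 x), z.1 ≠ 0 :=
  ((tendsto_nhdsWithin_iff.1 (tendsto_fst (f := 𝓝[>] (0:ℝ)) (g := 𝓝 x))).2).mono fun z hz => (ne_of_gt hz)

lemma unifZ (hV : ContDiff ℝ 2 V) (hal : ContDiff ℝ 2 al) {K : Set (EuclideanSpace ℝ (Fin d))} (hK : IsCompact K)
    {ε : ℝ} (hε : 0 < ε) : ∀ᶠ η in 𝓝[>] (0:ℝ), ∀ x ∈ K, ∀ i j, |Zc V al η i j x| ≤ ε := by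
  refine unif hK fun x hx => ?_
  simp only [eventually_all]
  intro i j
  have := (Z_lim hV hal (tfst x) (tfst0 x) tendsto_snd i j).abs
  rw [abs_zero] at this
  exact (this.eventually (gt_mem_nhds hε)).mono fun _ h => h.le

lemma unifV (hV : ContDiff ℝ 2 V) {K : Set (EuclideanSpace ℝ (Fin d))} (hK : IsCompact K)
    {ε : ℝ} (hε : 0 < ε) : ∀ᶠ η in 𝓝[>] (0:ℝ), ∀ x ∈ K, ∀ i, |V (x + η • uv i) - V x| ≤ ε := by
  refine unif hK fun x hx => ?_
  simp only [eventually_all]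
  intro i
  have h1 : Tendsto (fun z : ℝ × EuclideanSpace ℝ (Fin d) => z.2 + z.1 • uv i) (𝓝[>] (0:ℝ) ×ˢ 𝓝 x) (𝓝 x) :=
    tshift (tfst x) tendsto_snd (uv i)
  have := (((hV.continuous.tendsto x).comp h1).sub ((hV.continuous.tendsto x).comp tendsto_snd)).abs
  rw [sub_self, abs_zero] at this
  exact (this.eventually (gt_mem_nhds hε)).mono fun _ h => h.le

lemma unifD (hV : ContDiff ℝ 2 V) {K : Set (EuclideanSpace ℝ (Fin d))} (hK : IsCompact K)
    {ε : ℝ} (hε : 0 < ε) : ∀ᶠ η in 𝓝[>] (0:ℝ), ∀ x ∈ K, ∀ i,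
      ((V (x + η • uv i) - V x) / η) ^ 2 ≤ pd i V x ^ 2 + ε := by
  refine unif hK fun x hx => ?_
  simp only [eventually_all]
  intro i
  have h1 := (fwd hV (tfst x) (tfst0 x) tendsto_snd i).pow 2
  have h2 := (((pd_cont (hV.of_le (by norm_num)) i).tendsto x).comp (tendsto_snd (f := 𝓝[>] (0:ℝ)) (g := 𝓝 x))).pow 2
  have := h1.sub h2
  rw [sub_self] at this
  refine (this.eventually (gt_mem_nhds hε)).mono fun _ h => ?_
  simp only [Function.comp_apply] at h
  linarith

lemma unifPQ (hV : ContDiff ℝ 2 V) (hal : ContDiff ℝ 2 al) {K : Set (EuclideanSpace ℝ (Fin d))} (hK : IsCompact K) :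
    ∃ B, 0 ≤ B ∧ ∀ᶠ η in 𝓝[>] (0:ℝ), ∀ x ∈ K, ∀ i j,
      |(pc V η j (x + η • uv i) - pc V η j x) * Real.exp (al x - al (x + η • uv j))| ≤ B ∧
      |(qc V η j (x + η • uv i) - qc V η j x) * Real.exp (al x - al (x - η • uv j))| ≤ B := by
  have hb : ∃ B, 0 ≤ B ∧ ∀ x ∈ K, ∀ i j, |hess V x i j| ≤ B := by
    have hc : Continuous (fun x => ∑ i, ∑ j, |hess V x i j|) := 
      continuous_finsetSum _ fun i _ => continuous_finsetSum _ fun j _ => (hess_cont hV i j).abs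
    obtain ⟨B, hB⟩ := (hK.image hc).bddAbove
    refine ⟨max B 0, le_max_right _ _, fun x hx i j => le_max_of_le_left ?_⟩
    refine le_trans ?_ (hB ⟨x, hx, rfl⟩)
    refine le_trans ?_ (Finset.single_le_sum (f := fun i => ∑ j, |hess V x i j|) (fun i _ => by positivity) (Finset.mem_univ i))
    exact (Finset.single_le_sum (f := fun j => |hess V x i j|) (fun i _ => by positivity) (Finset.mem_univ j))
  obtain ⟨B, hB0, hB⟩ := hb
  refine ⟨B + 1, by linarith, unif hK fun x hx => ?_⟩
  simp only [eventually_all]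
  intro i j
  have h1 := ((P_lim hV (tfst x) (tfst0 x) tendsto_snd i j).mul (al_lim hal (tfst x) tendsto_snd j).1).abs
  have h2 := ((Q_lim hV (tfst x) (tfst0 x) tendsto_snd i j).mul (al_lim hal (tfst x) tendsto_snd j).2).abs
  have e1 : |-(hess V x i j / 2) * 1| < B + 1 := by
    rw [mul_one, abs_neg, abs_div, abs_two]; linarith [hB x hx i j, abs_nonneg (hess V x i j)]
  have e2 : |(hess V x i j / 2) * 1| < B + 1 := by
    rw [mul_one, abs_div, abs_two]; linarith [hB x hx i j, abs_nonneg (hess V x i j)]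
  filter_upwards [h1.eventually (gt_mem_nhds e1), h2.eventually (gt_mem_nhds e2)] with z a1 a2
  exact ⟨a1.le, a2.le⟩

end cont
end Grid

set_option linter.unusedSectionVars false
set_option linter.unusedVariables false

namespace Grid
open Filter Topology

section facts
variable {d : ℕ}

lemma mono_line {f : EuclideanSpace ℝ (Fin d) → ℝ} (hf : Differentiable ℝ f) (i : Fin d)
    (h : ∀ x, 0 ≤ pd i f x) (x : EuclideanSpace ℝ (Fin d)) {t : ℝ} (ht : 0 ≤ t) : f x ≤ f (x + t • uv i) := by
  have hd : ∀ s, HasDerivAt (fun s : ℝ => f (x + s • uv i)) (pd i f (x + s • uv i)) s := by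
    intro s
    have h1 : HasDerivAt (fun s : ℝ => x + s • uv i) (uv i) s := by
      simpa using ((hasDerivAt_id s).smul_const (uv i)).const_add x
    exact (hf (x + s • uv i)).hasFDerivAt.comp_hasDerivAt s h1
  have hm : Monotone (fun s : ℝ => f (x + s • uv i)) :=
    monotone_of_deriv_nonneg (fun s => (hd s).differentiableAt) (fun s => by rw [(hd s).deriv]; exact h _)
  have := hm ht
  simpa using this

lemma submod {U : EuclideanSpace ℝ (Fin d) → ℝ} (hU : ContDiff ℝ 2 U)
    (h : ∀ i j : Fin d, i ≠ j → ∀ x, pd i (fun y => pd j U y) x ≤ 0) {i j : Fin d} (hij : i ≠ j)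
    (x : EuclideanSpace ℝ (Fin d)) {t : ℝ} (ht : 0 ≤ t) :
    U (x + t • uv i + t • uv j) + U x ≤ U (x + t • uv i) + U (x + t • uv j) := by
  have h1 : ∀ x, pd i U (x + t • uv j) ≤ pd i U x := by
    intro x
    have hd : Differentiable ℝ (pd i U) := (pd_cd hU i).differentiable (by norm_num)
    have := mono_line (f := fun y => - pd i U y) hd.neg j (fun y => by
      have := h j i hij.symm y
      simp only [pd] at this ⊢
      rw [fderiv_fun_neg]
      simpa using this) x ht
    linarith
  have hd : Differentiable ℝ U := hU.differentiable (by norm_num)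
  have hd2 : Differentiable ℝ (fun y => U (y + t • uv j)) := hd.comp (differentiable_id.add_const _)
  have := mono_line (f := fun y => U y - U (y + t • uv j)) (hd.sub hd2) i (fun y => by
    have := h1 y
    simp only [pd] at this ⊢
    rw [fderiv_fun_sub (hd y) (hd2 y), fderiv_comp_add_right]
    simpa using this) x ht
  have e : x + t • uv i + t • uv j = x + t • uv i + t • uv j := rfl
  linarith

lemma pd_log {a : EuclideanSpace ℝ (Fin d) → ℝ} (ha : ContDiff ℝ 2 a) (hp : ∀ x, 0 < a x) (i : Fin d) (x) :
    pd i (fun y => Real.log (a y)) x = pd i a x / a x := by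
  have h := ((ha.differentiable (by norm_num) x).hasFDerivAt.log (hp x).ne').fderiv
  simp only [pd, h]
  simp [div_eq_inv_mul]

lemma aL_eq {V a : EuclideanSpace ℝ (Fin d) → ℝ} (ha : ContDiff ℝ 2 a) (hp : ∀ x, 0 < a x) (x) :
    a x * diffOp V (fun y => (a y)⁻¹) x = aLc V (fun y => Real.log (a y)) x := by
  set al := fun y => Real.log (a y) with hal
  have hal2 : ContDiff ℝ 2 al := ha.log (fun x => (hp x).ne')
  have h1 : ∀ i, pd i (fun y => (a y)⁻¹) = fun y => (a y)⁻¹ * (- pd i al y) := by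
    intro i; ext y
    have h := ((hasDerivAt_inv (hp y).ne').comp_hasFDerivAt y (ha.differentiable (by norm_num) y).hasFDerivAt).fderiv
    rw [hal, pd_log ha hp]
    simp only [pd]
    have e : (fun y => (a y)⁻¹) = Inv.inv ∘ a := rfl
    rw [e, h]
    have := (hp y).ne'
    simp; field_simp
  have hda : Differentiable ℝ (fun y => (a y)⁻¹) := (ha.inv (fun x => (hp x).ne')).differentiable (by norm_num)
  have h2 : ∀ i, pd i (fun y => pd i (fun y => (a y)⁻¹) y) x =
      (a x)⁻¹ * (- pd i (fun y => pd i al y) x + pd i al x ^ 2) := by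
    intro i
    have hd : Differentiable ℝ (fun y => - pd i al y) := ((pd_cd hal2 i).differentiable (by norm_num)).neg
    rw [h1 i]
    have h := fderiv_fun_mul (hda x) (hd x)
    have h3 := congrFun (h1 i) x
    have h4 : fderiv ℝ (fun y => - pd i al y) x = - fderiv ℝ (fun y => pd i al y) x := fderiv_fun_neg
    simp only [pd] at h h3 h4 ⊢
    rw [h]
    simp only [_root_.add_apply, _root_.smul_apply, smul_eq_mul]
    rw [h3, h4]
    simp; ring
  unfold diffOp lap aLc
  rw [mul_sub, Finset.mul_sum, Finset.mul_sum, ← Finset.sum_sub_distrib]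
  refine Finset.sum_congr rfl fun i _ => ?_
  rw [h2 i, h1 i]
  have := (hp x).ne'
  field_simp
  ring

lemma minEig_le {A : Matrix (Fin d) (Fin d) ℝ} (hA : A.IsHermitian) (y : Fin d → ℝ) :
    minEig A * ∑ i, y i ^ 2 ≤ ∑ i, y i * ∑ j, A i j * y j := by
  have hB : (A - minEig A • (1 : Matrix (Fin d) (Fin d) ℝ)).IsHermitian := by
    refine hA.sub ?_
    rw [Matrix.IsHermitian, Matrix.conjTranspose_smul, Matrix.conjTranspose_one]; simp
  have hp : (A - minEig A • (1 : Matrix (Fin d) (Fin d) ℝ)).PosSemidef := by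
    rw [hB.posSemidef_iff_eigenvalues_nonneg]
    intro i
    have h1 : hB.eigenvalues i ∈ spectrum ℝ (A - minEig A • (1 : Matrix (Fin d) (Fin d) ℝ)) := by
      rw [hB.spectrum_real_eq_range_eigenvalues]; exact ⟨i, rfl⟩
    have h2 : hB.eigenvalues i + minEig A ∈ spectrum ℝ A := by
      have := (spectrum.add_mem_add_iff (s := minEig A)).2 h1
      rwa [Algebra.algebraMap_eq_smul_one, add_sub_cancel] at this
    have h3 : minEig A ≤ hB.eigenvalues i + minEig A := 
      csInf_le (Matrix.finite_real_spectrum.bddBelow) h2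
    simp; linarith
  have := hp.dotProduct_mulVec_nonneg y
  simp only [Matrix.sub_mulVec, Matrix.smul_mulVec, Matrix.one_mulVec, dotProduct_sub, dotProduct_smul] at this
  simp only [dotProduct, Matrix.mulVec, star_trivial, smul_eq_mul] at this
  simp only [pow_two]
  linarith

lemma Mc_ge {V a : EuclideanSpace ℝ (Fin d) → ℝ} (ha : ContDiff ℝ 2 a) (hp : ∀ x, 0 < a x)
    (hconv : ∃ ρ : ℝ, ∀ x, Matrix.PosSemidef (hess V x - ρ • 1))
    (hκ : 0 < ⨅ x, (minEig (hess V x) - a x * diffOp V (fun y => (a y)⁻¹) x)) (x) (y : Fin d → ℝ) :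
    (⨅ x, (minEig (hess V x) - a x * diffOp V (fun y => (a y)⁻¹) x)) * ∑ i, y i ^ 2 ≤
      ∑ i, y i * ∑ j, Mc V (fun y => Real.log (a y)) x i j * y j := by
  have hbd : BddBelow (Set.range fun x => (minEig (hess V x) - a x * diffOp V (fun y => (a y)⁻¹) x)) := by
    by_contra hn
    rw [Real.iInf_of_not_bddBelow hn] at hκ
    exact lt_irrefl _ hκ
  have h1 := ciInf_le hbd x
  obtain ⟨ρ, hρ⟩ := hconv
  have hH : (hess V x).IsHermitian := by
    have h2 : (ρ • (1 : Matrix (Fin d) (Fin d) ℝ)).IsHermitian := by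
      rw [Matrix.IsHermitian, Matrix.conjTranspose_smul, Matrix.conjTranspose_one]; simp
    have := (hρ x).isHermitian.add h2
    rwa [sub_add_cancel] at this
  have h2 := minEig_le hH y
  have h3 : ∑ i, y i * ∑ j, Mc V (fun y => Real.log (a y)) x i j * y j =
      ∑ i, y i * ∑ j, hess V x i j * y j - aLc V (fun y => Real.log (a y)) x * ∑ i, y i ^ 2 := by
    rw [Finset.mul_sum, ← Finset.sum_sub_distrib]
    refine Finset.sum_congr rfl fun i _ => ?_
    have : ∑ j, Mc V (fun y => Real.log (a y)) x i j * y j = 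
        ∑ j, hess V x i j * y j - aLc V (fun y => Real.log (a y)) x * y i := by
      simp only [Mc, sub_mul, Finset.sum_sub_distrib, ite_mul, zero_mul, Finset.sum_ite_eq, Finset.mem_univ, if_true]
    rw [this]; ring
  rw [h3, ← aL_eq ha hp]
  have h4 : 0 ≤ ∑ i, y i ^ 2 := Finset.sum_nonneg fun i _ => sq_nonneg _
  have := mul_le_mul_of_nonneg_right h1 h4
  linarith
end facts
end Grid

set_option linter.unusedSectionVars false
set_option linter.unusedVariables false

namespace Grid
open Filter Topology

section inst
variable {d N : ℕ}

/-- unit step of the discrete torus -/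
def ee (i : Fin d) : Fin d → Fin (N + 1) := Pi.single i 1

/-- position of a grid point -/
noncomputable def pos (h η : ℝ) (x : Fin d → Fin (N + 1)) : EuclideanSpace ℝ (Fin d) :=
  WithLp.toLp 2 (fun i => -h + η * ((x i : ℕ) : ℝ))

/-- the grid data -/
noncomputable def gd (V al : EuclideanSpace ℝ (Fin d) → ℝ) (N : ℕ) (h η : ℝ) : GD d (Fin d → Fin (N + 1)) where
  e := ee
  η := η
  k := fun i x => if x i = Fin.last N then 0 else 1
  V := fun x => V (pos h η x) - Real.log (η ^ d)
  al := fun x => al (pos h η x)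

lemma pos_apply (h η : ℝ) (x : Fin d → Fin (N + 1)) (i : Fin d) : pos h η x i = -h + η * ((x i : ℕ) : ℝ) := rfl

lemma val_add_one {a : Fin (N + 1)} (h : a ≠ Fin.last N) : ((a + 1 : Fin (N + 1)) : ℕ) = (a : ℕ) + 1 :=
  Fin.val_add_one_of_lt (Fin.lt_last_iff_ne_last.2 h)

lemma add_ee_same (x : Fin d → Fin (N + 1)) (i : Fin d) : (x + ee i : Fin d → Fin (N + 1)) i = x i + 1 := by simp [ee]
lemma add_ee_ne (x : Fin d → Fin (N + 1)) {i j : Fin d} (h : i ≠ j) : (x + ee j : Fin d → Fin (N + 1)) i = x i := by simp [ee, h]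
lemma sub_ee_same (x : Fin d → Fin (N + 1)) (i : Fin d) : (x - ee i : Fin d → Fin (N + 1)) i = x i - 1 := by simp [ee]
lemma sub_ee_ne (x : Fin d → Fin (N + 1)) {i j : Fin d} (h : i ≠ j) : (x - ee j : Fin d → Fin (N + 1)) i = x i := by simp [ee, h]

lemma pos_add (h η : ℝ) (x : Fin d → Fin (N + 1)) {i : Fin d} (hx : x i ≠ Fin.last N) :
    pos h η (x + ee i) = pos h η x + η • uv i := by
  ext j
  rw [PiLp.add_apply, PiLp.smul_apply, pos_apply, pos_apply, uv]
  by_cases hj : j = i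
  · subst hj
    rw [add_ee_same, val_add_one hx]; simp; ring
  · rw [add_ee_ne x hj]; simp [hj]

lemma sub_one_ne_last {a : Fin (N + 1)} (h : a ≠ 0) : a - 1 ≠ Fin.last N := by
  intro hh
  apply h
  have : a = Fin.last N + 1 := by rw [← hh, sub_add_cancel]
  rw [this, Fin.last_add_one]

lemma pos_sub (h η : ℝ) (x : Fin d → Fin (N + 1)) {i : Fin d} (hx : x i ≠ 0) :
    pos h η (x - ee i) = pos h η x - η • uv i := by
  have := pos_add h η (x - ee i) (i := i) (by rw [sub_ee_same]; exact sub_one_ne_last hx)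
  rw [sub_add_cancel] at this
  rw [this, add_sub_cancel_right]

/-- interior grid points -/
def Inn (x : Fin d → Fin (N + 1)) : Prop := ∀ i, 1 ≤ (x i : ℕ) ∧ (x i : ℕ) + 2 ≤ N

lemma Inn.nl {x : Fin d → Fin (N + 1)} (hx : Inn x) (i : Fin d) : x i ≠ Fin.last N := by
  intro h; have := (hx i).2; rw [h] at this; simp at this
lemma Inn.n0 {x : Fin d → Fin (N + 1)} (hx : Inn x) (i : Fin d) : x i ≠ 0 := by
  intro h; have := (hx i).1; rw [h] at this; simp at this
lemma Inn.nl2 {x : Fin d → Fin (N + 1)} (hx : Inn x) (i l : Fin d) : (x + ee i : Fin d → Fin (N + 1)) l ≠ Fin.last N := by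
  by_cases hl : l = i
  · subst hl
    rw [add_ee_same]; intro h
    have h1 := val_add_one (hx.nl l)
    rw [h] at h1; have := (hx l).2; simp at h1; omega
  · rw [add_ee_ne x hl]; exact hx.nl l
lemma Inn.n02 {x : Fin d → Fin (N + 1)} (hx : Inn x) (i l : Fin d) : (x + ee i : Fin d → Fin (N + 1)) l ≠ 0 := by
  by_cases hl : l = i
  · subst hl
    rw [add_ee_same]; intro h
    have h1 := val_add_one (hx.nl l)
    rw [h] at h1; simp at h1
  · rw [add_ee_ne x hl]; exact hx.n0 l

variable {V al : EuclideanSpace ℝ (Fin d) → ℝ} {h η : ℝ}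

lemma gd_k1 {i : Fin d} {x : Fin d → Fin (N + 1)} : (gd V al N h η).k i x = 1 ↔ x i ≠ Fin.last N := by
  simp [gd]

lemma gd_ksub {i : Fin d} {x : Fin d → Fin (N + 1)} (hx : x i ≠ 0) : (gd V al N h η).k i (x - ee i) = 1 := by
  rw [gd_k1, sub_ee_same]; exact sub_one_ne_last hx

lemma gd_p {i : Fin d} {x : Fin d → Fin (N + 1)} (hx : x i ≠ Fin.last N) :
    (gd V al N h η).p (gd V al N h η).V i x = pc V η i (pos h η x) := by
  have := gd_k1 (V := V) (al := al) (h := h) (η := η).2 hx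
  simp only [GD.p, pc, this]
  simp only [gd, pos_add h η x hx]
  ring_nf

lemma gd_q {i : Fin d} {x : Fin d → Fin (N + 1)} (hx : x i ≠ 0) :
    (gd V al N h η).q (gd V al N h η).V i x = qc V η i (pos h η x) := by
  have := gd_ksub (V := V) (al := al) (h := h) (η := η) hx
  have e : (gd V al N h η).e = ee := rfl
  simp only [GD.q, qc, e, this]
  simp only [gd, pos_sub h η x hx]
  ring_nf

lemma gd_Z {x : Fin d → Fin (N + 1)} (hx : Inn x) (i j : Fin d) :
    (gd V al N h η).Z (fun x => Mc V al (pos h η x)) i j x = Zc V al η i j (pos h η x) := by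
  have e : (gd V al N h η).e = ee := rfl
  have e2 : (gd V al N h η).al = fun x => al (pos h η x) := rfl
  simp only [GD.Z, Zc, e, e2]
  rw [gd_p (hx.nl2 i j), gd_p (hx.nl j), gd_q (hx.n0 j), gd_q (hx.n02 i j), pos_add _ _ _ (hx.nl i),
    pos_sub _ _ _ (hx.n0 j)]
  congr 1
  split_ifs
  · refine Finset.sum_congr rfl fun l _ => ?_
    rw [gd_p (hx.nl2 i l), gd_q (hx.n02 i l), pos_add _ _ _ (hx.nl i), pos_add _ _ _ (hx.nl l),
      pos_sub _ _ _ (hx.n0 l)]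
  · rfl

/-- the box -/
def Bx (d : ℕ) (h : ℝ) : Set (EuclideanSpace ℝ (Fin d)) := {x | ∀ i, |x i| ≤ h}

lemma Bx_compact (h : ℝ) : IsCompact (Bx d h) := by
  have : Bx d h = WithLp.ofLp ⁻¹' (Set.pi Set.univ fun _ => Set.Icc (-h) h) := by
    ext x; simp only [Bx, Set.mem_setOf_eq, abs_le, Set.mem_preimage, Set.mem_pi, Set.mem_univ, true_implies, Set.mem_Icc]
  rw [this]
  exact (PiLp.homeomorph 2 (fun _ : Fin d => ℝ)).isClosedEmbedding.isCompact_preimage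
    (isCompact_univ_pi fun _ => isCompact_Icc)

lemma pos_mem (hη : 0 ≤ η) (hN : η * N = 2 * h) (x : Fin d → Fin (N + 1)) : pos h η x ∈ Bx d h := by
  intro i
  rw [pos_apply, abs_le]
  have h1 : ((x i : ℕ) : ℝ) ≤ N := by exact_mod_cast Nat.lt_succ_iff.1 (x i).2
  have := mul_le_mul_of_nonneg_left h1 hη
  have h2 : 0 ≤ η * ((x i : ℕ) : ℝ) := by positivity
  constructor <;> linarith

lemma gd_ok {ε : ℝ} (hη : 0 < η) (hN : η * N = 2 * h)
    (hε0 : 0 ≤ ε) (hε1 : ε ≤ 1 / 10) (hamono : ∀ i x, al x ≤ al (x + η • uv i))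
    (hsub : ∀ i j, i ≠ j → ∀ x, V (x + η • uv i + η • uv j) + 2 * al (x + η • uv i + η • uv j) + (V x + 2 * al x) ≤
      (V (x + η • uv i) + 2 * al (x + η • uv i)) + (V (x + η • uv j) + 2 * al (x + η • uv j)))
    (hVe : ∀ x ∈ Bx d h, ∀ i, |V (x + η • uv i) - V x| ≤ ε)
    (hae : ∀ x ∈ Bx d h, ∀ i, |al (x + η • uv i) - al x| ≤ ε) :
    ∃ rr, (gd V al N h η).Ok ε rr := by
  have hrate : ∀ U : (Fin d → Fin (N + 1)) → ℝ, ∃ r : ℝ, ∀ x, ∑ i, ((gd V al N h η).c U i x + (gd V al N h η).c U i (x - ee i)) 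
      ≤ r * (gd V al N h η).w U x := by
    intro U
    obtain ⟨r, hr⟩ := (Set.finite_range (fun x => (∑ i, ((gd V al N h η).c U i x + (gd V al N h η).c U i (x - ee i))) / 
      (gd V al N h η).w U x)).bddAbove
    exact ⟨r, fun x => (div_le_iff₀ (GD.w_pos _ _ _)).1 (hr ⟨x, rfl⟩)⟩
  obtain ⟨r1, h1⟩ := hrate (gd V al N h η).V
  obtain ⟨r2, h2⟩ := hrate (gd V al N h η).Va
  have e : (gd V al N h η).e = ee := rfl
  have e2 : (gd V al N h η).al = fun x => al (pos h η x) := rfl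
  have e3 : (gd V al N h η).V = fun x => V (pos h η x) - Real.log (η ^ d) := rfl
  refine ⟨max 1 (max r1 r2), hη, ?_, ?_, ?_, ?_, hε0, hε1, ?_, ?_, by positivity, ?_, ?_⟩
  · intro i x; simp only [gd]; split_ifs <;> simp
  · intro i j hij x
    simp only [gd, add_ee_ne x hij]
  · intro i x hk
    rw [gd_k1] at hk
    simp only [e, e2, pos_add h η x hk]; exact hamono _ _
  · intro i j hij x hi hj
    rw [gd_k1] at hi hj
    have hj' : (x + ee i : Fin d → Fin (N + 1)) j ≠ Fin.last N := by rw [add_ee_ne x hij.symm]; exact hj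
    simp only [GD.Va, e, e2, e3]
    rw [pos_add h η _ hj', pos_add h η _ hi, pos_add h η _ hj]
    have := hsub i j hij (pos h η x)
    linarith
  · intro i x hk
    rw [gd_k1] at hk
    simp only [e, e3, pos_add h η x hk, sub_sub_sub_cancel_right]; exact hVe _ (pos_mem hη.le hN x) i
  · intro i x hk
    rw [gd_k1] at hk
    simp only [e, e2, pos_add h η x hk]; exact hae _ (pos_mem hη.le hN x) i
  · intro x
    refine (h1 x).trans (mul_le_mul_of_nonneg_right ?_ (GD.w_pos _ _ _).le)
    exact le_max_of_le_right (le_max_left _ _)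
  · intro x
    refine (h2 x).trans (mul_le_mul_of_nonneg_right ?_ (GD.w_pos _ _ _).le)
    exact le_max_of_le_right (le_max_right _ _)

/-- cutoff -/
noncomputable def chi (r : ℝ) (x : EuclideanSpace ℝ (Fin d)) : ℝ := max 0 (min 1 (2 - ‖x‖ / r))

lemma chi0 (r : ℝ) (x : EuclideanSpace ℝ (Fin d)) : 0 ≤ chi r x := le_max_left _ _
lemma chi1 (r : ℝ) (x : EuclideanSpace ℝ (Fin d)) : chi r x ≤ 1 := max_le zero_le_one (min_le_left _ _)
lemma chi_eq_one {r : ℝ} (hr : 0 < r) {x : EuclideanSpace ℝ (Fin d)} (hx : ‖x‖ ≤ r) : chi r x = 1 := by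
  have : ‖x‖ / r ≤ 1 := (div_le_one hr).2 hx
  rw [chi, min_eq_left (by linarith), max_eq_right zero_le_one]
lemma chi_supp {r : ℝ} (hr : 0 < r) {x : EuclideanSpace ℝ (Fin d)} (hx : chi r x ≠ 0) : ‖x‖ < 2 * r := by
  by_contra! hh
  apply hx
  have : 2 ≤ ‖x‖ / r := (le_div_iff₀ hr).2 hh
  rw [chi, max_eq_left]; exact (min_le_right _ _).trans (by linarith)
lemma chi_cont {r : ℝ} : Continuous (chi (d := d) r) := by
  unfold chi; fun_prop
lemma chi_lip {r : ℝ} (hr : 0 < r) (x y : EuclideanSpace ℝ (Fin d)) : |chi r x - chi r y| ≤ ‖x - y‖ / r := by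
  unfold chi
  have h1 := abs_max_sub_max_le_max 0 (min 1 (2 - ‖x‖ / r)) 0 (min 1 (2 - ‖y‖ / r))
  have h2 := abs_min_sub_min_le_max 1 (2 - ‖x‖ / r) 1 (2 - ‖y‖ / r)
  have h3 : |(2 - ‖x‖ / r) - (2 - ‖y‖ / r)| ≤ ‖x - y‖ / r := by
    have : (2 - ‖x‖ / r) - (2 - ‖y‖ / r) = (‖y‖ - ‖x‖) / r := by ring
    rw [this, abs_div, abs_of_pos hr]
    gcongr
    rw [norm_sub_rev]; exact abs_norm_sub_norm_le y x
  have h4 : 0 ≤ ‖x - y‖ / r := by positivity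
  refine h1.trans (max_le (by simpa using h4) (h2.trans (max_le (by simpa using h4) h3)))

lemma norm_uv (i : Fin d) : ‖uv i‖ = 1 := by simp [uv]

lemma chi_inn {r : ℝ} (hr : 0 < r) (hη : 0 < η) (hN : η * N = 2 * (3 * r)) (hηr : 2 * η ≤ r)
    {x : Fin d → Fin (N + 1)} (hx : chi r (pos (3 * r) η x) ≠ 0) : Inn x := by
  intro i
  have h1 := chi_supp hr hx
  have h2 : |pos (3 * r) η x i| ≤ ‖pos (3 * r) η x‖ := by
    simpa using PiLp.norm_apply_le (pos (3 * r) η x) i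
  rw [pos_apply, abs_le] at h2
  constructor
  · by_contra! h3
    have : (x i : ℕ) = 0 := by omega
    rw [this] at h2; simp at h2; linarith
  · by_contra! h3
    have h4 : (N : ℝ) ≤ (x i : ℕ) + 1 := by exact_mod_cast Nat.lt_succ_iff.1 (by omega)
    have := mul_le_mul_of_nonneg_left h4 hη.le
    linarith

lemma gd_ok2 {ε K r : ℝ} (hr : 1 ≤ r) (hη : 0 < η) (hN : η * N = 2 * (3 * r)) (hηr : 2 * η ≤ r)
    (hMp : ∀ x (y : Fin d → ℝ), 0 ≤ ∑ i, y i * ∑ j, Mc V al x i j * y j)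
    (hPQ : ∀ x ∈ Bx d (3 * r), ∀ i j,
      |(pc V η j (x + η • uv i) - pc V η j x) * Real.exp (al x - al (x + η • uv j))| ≤ K ∧
      |(qc V η j (x + η • uv i) - qc V η j x) * Real.exp (al x - al (x - η • uv j))| ≤ K)
    (hZ : ∀ x ∈ Bx d (3 * r), ∀ i j, |Zc V al η i j x| ≤ ε) (hK : 0 ≤ K) (hθ : K * η * (8 * (1 + d)) ≤ ε) :
    (gd V al N (3 * r) η).Ok2 (fun x => Mc V al (pos (3 * r) η x)) (fun x => chi r (pos (3 * r) η x)) ε K r := by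
  have hr0 : 0 < r := by linarith
  have e : (gd V al N (3 * r) η).e = ee := rfl
  have e2 : (gd V al N (3 * r) η).al = fun x => al (pos (3 * r) η x) := rfl
  refine ⟨fun x => chi0 _ _, fun x => chi1 _ _, ?_, ?_, hr, fun x y => hMp _ y, ?_, ?_, ?_, hK, hθ⟩
  · intro i x hk
    rw [gd_k1] at hk
    simp only [e, pos_add (3 * r) η x hk]
    refine (chi_lip hr0 _ _).trans ?_
    rw [add_sub_cancel_left, norm_smul, norm_uv, mul_one, Real.norm_eq_abs, abs_of_pos hη]
    exact le_refl _
  · intro x hx i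
    have hi := chi_inn hr0 hη hN hηr hx
    simp only [e]
    exact ⟨gd_k1.2 (hi.nl i), gd_ksub (hi.n0 i), gd_k1.2 (hi.nl2 i i)⟩
  · intro x hx i j
    have hi := chi_inn hr0 hη hN hηr hx
    simp only [e, e2]
    rw [gd_p (hi.nl2 i j), gd_p (hi.nl j), pos_add _ _ _ (hi.nl i), pos_add _ _ _ (hi.nl j)]
    exact (hPQ _ (pos_mem hη.le hN x) i j).1
  · intro x hx i j
    have hi := chi_inn hr0 hη hN hηr hx
    simp only [e, e2]
    rw [gd_q (hi.n02 i j), gd_q (hi.n0 j), pos_add _ _ _ (hi.nl i), pos_sub _ _ _ (hi.n0 j)]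
    exact (hPQ _ (pos_mem hη.le hN x) i j).2
  · intro x hx i j
    have hi := chi_inn hr0 hη hN hηr hx
    rw [gd_Z hi]
    exact hZ _ (pos_mem hη.le hN x) i j

end inst
end Grid

set_option linter.unusedSectionVars false
set_option linter.unusedVariables false

namespace Grid
open Filter Topology

section poin
variable {d N L o : ℕ}

/-- embedding of a small cube grid -/
def io (hoL : o + L ≤ N) (y : Fin d → Fin (L + 1)) : Fin d → Fin (N + 1) :=
  fun i => ⟨(y i : ℕ) + o, by have := (y i).2; omega⟩

lemma io_val (hoL : o + L ≤ N) (y : Fin d → Fin (L + 1)) (i : Fin d) : ((io hoL y i : Fin (N + 1)) : ℕ) = y i + o := rfl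

lemma io_inj (hoL : o + L ≤ N) : Function.Injective (io (d := d) hoL) := by
  intro y y' h
  ext i
  have := congrArg (fun z : Fin d → Fin (N + 1) => ((z i : Fin (N + 1)) : ℕ)) h
  simp only [io_val] at this
  omega

lemma io_nl (hoL : o + L ≤ N) {y : Fin d → Fin (L + 1)} {j : Fin d} (hy : y j ≠ Fin.last L) :
    io hoL y j ≠ Fin.last N := by
  intro h
  have := congrArg Fin.val h
  rw [io_val] at this
  have h2 : (y j : ℕ) ≠ L := fun hh => hy (Fin.ext hh)
  have h3 := (y j).2
  simp at this; omega

lemma io_up (hoL : o + L ≤ N) {y : Fin d → Fin (L + 1)} {j : Fin d} (hy : y j ≠ Fin.last L) :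
    io hoL (up L y j) = io hoL y + ee j := by
  ext i
  by_cases hi : i = j
  · subst hi
    rw [io_val, add_ee_same, val_add_one (io_nl hoL hy), io_val, up, Function.update_self, val_add_one hy]; ring
  · rw [io_val, add_ee_ne _ hi, io_val, up, Function.update_of_ne hi]

variable {V al : EuclideanSpace ℝ (Fin d) → ℝ} {h η ρ : ℝ}

lemma io_mem (hoL : o + L ≤ N) (hη : 0 < η) (ho : η * o = h - ρ) (hL : η * L = 2 * ρ) (y : Fin d → Fin (L + 1)) :
    pos h η (io hoL y) ∈ Bx d ρ := by
  have := pos_mem hη.le hL y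
  intro i
  have h1 := this i
  rw [pos_apply] at h1 ⊢
  rw [io_val]; push_cast
  have : -h + η * ((y i : ℕ) + o) = -ρ + η * (y i : ℕ) := by linear_combination ho
  rw [this]; exact h1

lemma io_surj (hoL : o + L ≤ N) (hη : 0 < η) (ho : η * o = h - ρ) (hL : η * L = 2 * ρ) {x : Fin d → Fin (N + 1)}
    (hx : pos h η x ∈ Bx d ρ) : ∃ y, io hoL y = x := by
  have h1 : ∀ i, o ≤ (x i : ℕ) ∧ (x i : ℕ) ≤ o + L := by
    intro i
    have := hx i
    rw [pos_apply, abs_le] at this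
    constructor
    · have : η * (o : ℝ) ≤ η * (x i : ℕ) := by linarith
      exact_mod_cast le_of_mul_le_mul_left this hη
    · have : η * ((x i : ℕ) : ℝ) ≤ η * ((o + L : ℕ) : ℝ) := by push_cast; linarith
      exact_mod_cast le_of_mul_le_mul_left this hη
  refine ⟨fun i => ⟨(x i : ℕ) - o, by have := h1 i; omega⟩, ?_⟩
  ext i
  rw [io_val]; have := h1 i; simp only; omega

lemma gd_w (hη : 0 < η) (x : Fin d → Fin (N + 1)) :
    (gd V al N h η).w (gd V al N h η).V x = η ^ d * Real.exp (-V (pos h η x)) := by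
  simp only [GD.w, gd]
  rw [neg_sub, sub_eq_add_neg, Real.exp_add, Real.exp_log (by positivity)]

lemma gd_v (hη : 0 < η) (g : (Fin d → Fin (N + 1)) → ℝ) (i : Fin d) (x : Fin d → Fin (N + 1)) (hx : x i ≠ Fin.last N) :
    (gd V al N h η).w (gd V al N h η).Va x * (gd V al N h η).v g i x ^ 2 =
      η ^ d * Real.exp (-V (pos h η x)) * ((g (x + ee i) - g x) / η) ^ 2 := by
  rw [← gd_w (al := al) hη x, GD.wVa]
  have := gd_k1 (V := V) (al := al) (h := h) (η := η).2 hx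
  simp only [GD.v, this]
  have e : (gd V al N h η).e = ee := rfl
  have e2 : (gd V al N h η).η = η := rfl
  rw [e, e2]; ring

lemma gd_v0 (hη : 0 < η) (g : (Fin d → Fin (N + 1)) → ℝ) (i : Fin d) (x : Fin d → Fin (N + 1)) (hx : x i = Fin.last N) :
    (gd V al N h η).v g i x = 0 := by
  have : (gd V al N h η).k i x = 0 := by simp [gd, hx]
  simp [GD.v, this]

lemma gd_poin (hoL : o + L ≤ N) (hη : 0 < η) (hη1 : η ≤ 1) (hρ : 0 ≤ ρ) (ho : η * o = h - ρ) (hL : η * L = 2 * ρ)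
    {m1 m2 : ℝ} (hm1 : 0 < m1) (hm2 : 0 < m2) (hm : ∀ z ∈ Bx d ρ, m1 ≤ Real.exp (-V z) ∧ Real.exp (-V z) ≤ m2)
    {χ χs : EuclideanSpace ℝ (Fin d) → ℝ} (hχ : ∀ z ∈ Bx d ρ, χ z = 1) (hχs : ∀ z, z ∉ Bx d ρ → χs z = 0)
    (hs0 : ∀ z, χs z ≤ 1) {b C : ℝ} (hb : 0 < b) (g : (Fin d → Fin (N + 1)) → ℝ)
    (hg : ∀ x, b ≤ g x ∧ g x ≤ C) : ∃ c : ℝ, ∑ x, (gd V al N h η).w (gd V al N h η).V x * (g x - c) ^ 2 ≤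
      (2 ^ d * (2 * ρ + 1) ^ 2 * (m2 / m1)) * ∑ i, ∑ x, (gd V al N h η).w (gd V al N h η).Va x *
        (χ (pos h η x) ^ 2 * (gd V al N h η).v g i x ^ 2) +
      C ^ 2 * ∑ x, (gd V al N h η).w (gd V al N h η).V x * (1 - χs (pos h η x)) := by
  classical
  set D := gd V al N h η with hD
  obtain ⟨y0, hy0⟩ := poincare (fun y => g (io hoL y))
  refine ⟨g (io hoL y0), ?_⟩
  set S : Finset (Fin d → Fin (N + 1)) := Finset.univ.image (io hoL) with hS
  have hw : ∀ x, 0 < D.w D.V x := fun x => GD.w_pos _ _ _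
  have hη' : 0 < η ^ d := by positivity
  rw [← Finset.sum_add_sum_compl S]
  have hT : ∀ i x, 0 ≤ D.w D.Va x * (χ (pos h η x) ^ 2 * D.v g i x ^ 2) := fun i x =>
    mul_nonneg (GD.w_pos _ _ _).le (by positivity)
  refine add_le_add ?_ ?_
  · rw [hS, Finset.sum_image (fun _ _ _ _ hh => io_inj hoL hh)]
    have hed : ∀ j, ed L (fun y => g (io hoL y)) j ≤ (η ^ 2 / (η ^ d * m1)) * 
        ∑ x, D.w D.Va x * (χ (pos h η x) ^ 2 * D.v g j x ^ 2) := by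
      intro j
      have h1 : ∑ y, D.w D.Va (io hoL y) * (χ (pos h η (io hoL y)) ^ 2 * D.v g j (io hoL y) ^ 2) ≤
          ∑ x, D.w D.Va x * (χ (pos h η x) ^ 2 * D.v g j x ^ 2) := by
        rw [← Finset.sum_image (f := fun x => D.w D.Va x * (χ (pos h η x) ^ 2 * D.v g j x ^ 2)) 
          (fun _ _ _ _ hh => io_inj hoL hh)]
        exact Finset.sum_le_sum_of_subset_of_nonneg (Finset.subset_univ _) (fun x _ _ => hT j x)
      refine le_trans ?_ (mul_le_mul_of_nonneg_left h1 (by positivity))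
      rw [ed, Finset.mul_sum]
      refine Finset.sum_le_sum fun y _ => ?_
      split_ifs with hy
      · exact mul_nonneg (by positivity) (hT _ _)
      · have hm' := hm _ (io_mem hoL hη ho hL y)
        rw [hχ _ (io_mem hoL hη ho hL y), one_pow, one_mul, hD, gd_v hη _ _ _ (io_nl hoL hy), io_up hoL hy]
        have : η ^ 2 / (η ^ d * m1) * (η ^ d * Real.exp (-V (pos h η (io hoL y))) * ((g (io hoL y + ee j) - g (io hoL y)) / η) ^ 2)
          = (Real.exp (-V (pos h η (io hoL y))) / m1) * (g (io hoL y + ee j) - g (io hoL y)) ^ 2 := by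
          field_simp
        rw [this]
        refine le_mul_of_one_le_left (sq_nonneg _) ((one_le_div hm1).2 hm'.1)
    set A := ∑ i, ∑ x, D.w D.Va x * (χ (pos h η x) ^ 2 * D.v g i x ^ 2) with hA
    have hA0 : 0 ≤ A := Finset.sum_nonneg fun i _ => Finset.sum_nonneg fun x _ => hT i x
    have hsum : ∑ j, ed L (fun y => g (io hoL y)) j ≤ (η ^ 2 / (η ^ d * m1)) * A := by
      rw [hA, Finset.mul_sum]; exact Finset.sum_le_sum fun j _ => hed j
    calc ∑ y, D.w D.V (io hoL y) * (g (io hoL y) - g (io hoL y0)) ^ 2 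
        ≤ ∑ y, (η ^ d * m2) * (g (io hoL y) - g (io hoL y0)) ^ 2 := by
          refine Finset.sum_le_sum fun y _ => mul_le_mul_of_nonneg_right ?_ (sq_nonneg _)
          rw [hD, gd_w hη]
          exact mul_le_mul_of_nonneg_left (hm _ (io_mem hoL hη ho hL y)).2 hη'.le
      _ = (η ^ d * m2) * ∑ y, (g (io hoL y) - g (io hoL y0)) ^ 2 := by rw [Finset.mul_sum]
      _ ≤ (η ^ d * m2) * (2 ^ d * ((L + 1) ^ 2 * ((η ^ 2 / (η ^ d * m1)) * A))) := by
          refine mul_le_mul_of_nonneg_left (hy0.trans ?_) (by positivity)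
          gcongr
      _ = (2 ^ d * (η * L + η) ^ 2 * (m2 / m1)) * A := by field_simp
      _ ≤ _ := by
          rw [hL]; gcongr
  · have h1 : C ^ 2 * ∑ x, D.w D.V x * (1 - χs (pos h η x)) ≥ C ^ 2 * ∑ x ∈ Sᶜ, D.w D.V x * (1 - χs (pos h η x)) := by
      refine mul_le_mul_of_nonneg_left ?_ (sq_nonneg _)
      refine Finset.sum_le_sum_of_subset_of_nonneg (Finset.subset_univ _) (fun x _ _ => 
        mul_nonneg (hw x).le (by linarith [hs0 (pos h η x)]))
    refine le_trans ?_ h1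
    rw [Finset.mul_sum]
    refine Finset.sum_le_sum fun x hx => ?_
    have hx' : pos h η x ∉ Bx d ρ := by
      intro hh
      obtain ⟨y, hy⟩ := io_surj hoL hη ho hL hh
      rw [Finset.mem_compl] at hx
      exact hx (Finset.mem_image.2 ⟨y, Finset.mem_univ _, hy⟩)
    rw [hχs _ hx', sub_zero, mul_one, mul_comm]
    refine mul_le_mul_of_nonneg_right ?_ (hw x).le
    have h2 := hg x
    have h3 := hg (io hoL y0)
    nlinarith
end poin
end Grid

set_option linter.unusedSectionVars false
set_option linter.unusedVariables false

namespace Grid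
open Filter Topology Pointwise

section riem
variable {d : ℕ}

lemma mem_lat {n : ℕ} (hn : 0 < n) (v : Fin d → ℝ) :
    v ∈ (n : ℝ)⁻¹ • (Submodule.span ℤ (Set.range (Pi.basisFun ℝ (Fin d))) : Set (Fin d → ℝ)) ↔ 
      ∀ i, ∃ m : ℤ, (m : ℝ) = n * v i := by
  have hn' : (n : ℝ) ≠ 0 := by positivity
  rw [Set.mem_smul_set_iff_inv_smul_mem₀ (inv_ne_zero hn'), inv_inv, SetLike.mem_coe,
    Module.Basis.mem_span_iff_repr_mem]
  simp

lemma riemann (h : ℕ) {φ : EuclideanSpace ℝ (Fin d) → ℝ} (hφ : Continuous φ) :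
    Tendsto (fun n : ℕ => ∑ x : Fin d → Fin (2 * h * n + 1), (n : ℝ)⁻¹ ^ d * φ (pos h (n : ℝ)⁻¹ x)) atTop
      (𝓝 (∫ z in Bx d h, φ z)) := by
  set s : Set (Fin d → ℝ) := Set.pi Set.univ fun _ => Set.Icc (-(h : ℝ)) h with hs
  have hms : MeasurableSet s := MeasurableSet.univ_pi fun _ => measurableSet_Icc
  have hcont : Continuous (fun v : Fin d → ℝ => φ (WithLp.toLp 2 v)) := hφ.comp (PiLp.continuous_toLp 2 _)
  have key := tendsto_tsum_div_pow_atTop_integral s (fun v => φ (WithLp.toLp 2 v)) hcont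
    (isCompact_univ_pi fun _ => isCompact_Icc).isBounded hms
    ((convex_pi fun _ _ => convex_Icc _ _).addHaar_frontier volume)
  have hI : ∫ v in s, φ (WithLp.toLp 2 v) = ∫ z in Bx d h, φ z := by
    have hB : Bx d (h : ℝ) = WithLp.ofLp ⁻¹' s := by
      ext x; simp only [Bx, Set.mem_ofPred_eq, abs_le, Set.mem_preimage, hs, Set.mem_pi, Set.mem_univ, true_implies, Set.mem_Icc]
    rw [hB]
    have := (PiLp.volume_preserving_ofLp (Fin d)).setIntegral_preimage_emb 
      (MeasurableEquiv.toLp 2 (Fin d → ℝ)).symm.measurableEmbedding (fun v => φ (WithLp.toLp 2 v)) s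
    rw [← this]
  rw [hI] at key
  refine key.congr' ?_
  filter_upwards [eventually_gt_atTop 0] with n hn
  have hn' : (0 : ℝ) < n := by exact_mod_cast hn
  have hN : (n : ℝ)⁻¹ * ((2 * h * n : ℕ) : ℝ) = 2 * h := by push_cast; field_simp
  let f : (Fin d → Fin (2 * h * n + 1)) → ↑(s ∩ (n : ℝ)⁻¹ • (Submodule.span ℤ (Set.range (Pi.basisFun ℝ (Fin d))) : Set (Fin d → ℝ))) :=
    fun x => ⟨WithLp.ofLp (pos h (n : ℝ)⁻¹ x), by
      constructor
      · intro i _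
        have := pos_mem (by positivity) hN x i
        rwa [abs_le] at this
      · rw [mem_lat hn]
        intro i
        refine ⟨-(h * n) + (x i : ℕ), ?_⟩
        rw [pos_apply]; push_cast; field_simp⟩
  have hf : Function.Bijective f := by
    constructor
    · intro x y hxy
      have h1 : (f x : Fin d → ℝ) = f y := congrArg _ hxy
      ext i
      have h2 := congrFun h1 i
      simp only [f] at h2
      rw [pos_apply, pos_apply] at h2
      have h3 : (n : ℝ)⁻¹ * ((x i : ℕ) : ℝ) = (n : ℝ)⁻¹ * ((y i : ℕ) : ℝ) := by linarith
      exact_mod_cast mul_left_cancel₀ (by positivity) h3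
    · rintro ⟨v, hv1, hv2⟩
      rw [mem_lat hn] at hv2
      choose m hm using hv2
      have hv : ∀ i, v i = (n : ℝ)⁻¹ * m i := fun i => by rw [hm]; field_simp
      have hr : ∀ i, 0 ≤ m i + h * n ∧ m i + h * n ≤ 2 * h * n := by
        intro i
        have h1 := hv1 i (Set.mem_univ i)
        have h2 : -(h * n : ℝ) ≤ m i ∧ (m i : ℝ) ≤ h * n := by
          rw [hm i]; constructor
          · nlinarith [h1.1]
          · nlinarith [h1.2]
        have h3 : -(h * n : ℤ) ≤ m i ∧ m i ≤ h * n := by exact_mod_cast h2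
        constructor
        · linarith [h3.1]
        · linarith [h3.2]
      refine ⟨fun i => ⟨(m i + h * n).toNat, by have := hr i; zify; rw [Int.toNat_of_nonneg this.1]; omega⟩, ?_⟩
      refine Subtype.ext ?_
      funext i
      simp only [f]
      rw [pos_apply, hv i]
      have : (((m i + h * n).toNat : ℕ) : ℝ) = m i + h * n := by
        have := Int.toNat_of_nonneg (hr i).1
        exact_mod_cast congrArg (fun z : ℤ => (z : ℝ)) this
      simp only [this]
      field_simp; ring
  rw [← (Equiv.ofBijective f hf).tsum_eq, tsum_fintype, Finset.sum_div]
  refine Finset.sum_congr rfl fun x _ => ?_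
  simp only [Equiv.ofBijective_apply, f, Fintype.card_fin]
  rw [div_eq_inv_mul, inv_pow]
end riem
end Grid

set_option linter.unusedSectionVars false
set_option linter.unusedVariables false

namespace Grid
open Filter Topology

section ei
variable {d N : ℕ} {V al F : EuclideanSpace ℝ (Fin d) → ℝ} {h η ε : ℝ}

lemma gd_E (hη : 0 < η) (hN : η * N = 2 * h) (hε0 : 0 ≤ ε)
    (hVe : ∀ x ∈ Bx d h, ∀ i, |V (x + η • uv i) - V x| ≤ ε)
    (hD : ∀ x ∈ Bx d h, ∀ i, ((F (x + η • uv i) - F x) / η) ^ 2 ≤ pd i F x ^ 2 + ε) :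
    (gd V al N h η).E (gd V al N h η).V (fun x => F (pos h η x)) (fun x => F (pos h η x)) ≤
      Real.exp ε * ∑ x : Fin d → Fin (N + 1), η ^ d * (Real.exp (-V (pos h η x)) * (gradSq F (pos h η x) + d * ε)) := by
  have e : (gd V al N h η).e = ee := rfl
  rw [GD.E, En, Finset.sum_comm, Finset.mul_sum]
  refine Finset.sum_le_sum fun x _ => ?_
  have h1 : gradSq F (pos h η x) + d * ε = ∑ i, (pd i F (pos h η x) ^ 2 + ε) := by
    rw [Finset.sum_add_distrib, gradSq]; simp
  rw [h1, Finset.mul_sum, Finset.mul_sum, Finset.mul_sum]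
  refine Finset.sum_le_sum fun i _ => ?_
  by_cases hx : x i = Fin.last N
  · have : (gd V al N h η).k i x = 0 := by simp [gd, hx]
    simp only [GD.c, this, mul_zero, zero_mul]
    positivity
  · have hk := gd_k1 (V := V) (al := al) (h := h) (η := η).2 hx
    simp only [GD.c, hk, e, pos_add h η x hx]
    simp only [gd, pos_add h η x hx]
    have h2 := hVe _ (pos_mem hη.le hN x) i
    have h3 := hD _ (pos_mem hη.le hN x) i
    set X := pos h η x
    have h4 : Real.exp (-(V X - Real.log (η ^ d) + (V (X + η • uv i) - Real.log (η ^ d))) / 2) ≤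
        Real.exp ε * (η ^ d * Real.exp (-V X)) := by
      have : Real.exp ε * (η ^ d * Real.exp (-V X)) = Real.exp (ε + Real.log (η ^ d) - V X) := by
        rw [Real.exp_sub, Real.exp_add, Real.exp_log (by positivity), Real.exp_neg]; ring
      rw [this]
      apply Real.exp_le_exp.2
      have := abs_le.1 h2
      linarith [this.1]
    calc η⁻¹ ^ 2 * 1 * Real.exp (-(V X - Real.log (η ^ d) + (V (X + η • uv i) - Real.log (η ^ d))) / 2) * (F (X + η • uv i) - F X) * (F (X + η • uv i) - F X)
        = Real.exp (-(V X - Real.log (η ^ d) + (V (X + η • uv i) - Real.log (η ^ d))) / 2) * ((F (X + η • uv i) - F X) / η) ^ 2 := by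
          field_simp
      _ ≤ (Real.exp ε * (η ^ d * Real.exp (-V X))) * (pd i F X ^ 2 + ε) := by gcongr
      _ = _ := by ring

lemma gd_I0 (hη : 0 < η) (hN : η * N = 2 * h) (hε0 : 0 ≤ ε) (hF : ∀ x, 0 < F x)
    (hD : ∀ x ∈ Bx d h, ∀ i, ((F (x + η • uv i) - F x) / η) ^ 2 ≤ pd i F x ^ 2 + ε) :
    (gd V al N h η).I0 (fun x => F (pos h η x)) ≤
      ∑ x : Fin d → Fin (N + 1), η ^ d * (Real.exp (-V (pos h η x)) * ((gradSq F (pos h η x) + d * ε) / F (pos h η x))) := by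
  rw [GD.I0]
  refine Finset.sum_le_sum fun x _ => ?_
  have h1 : gradSq F (pos h η x) + d * ε = ∑ i, (pd i F (pos h η x) ^ 2 + ε) := by
    rw [Finset.sum_add_distrib, gradSq]; simp
  rw [h1, ← mul_assoc, ← mul_div_assoc, ← mul_div_assoc, Finset.mul_sum, Finset.mul_sum]
  refine div_le_div_of_nonneg_right ?_ (hF _).le
  refine Finset.sum_le_sum fun i _ => ?_
  by_cases hx : x i = Fin.last N
  · rw [gd_v0 hη _ _ _ hx]
    have : 0 ≤ η ^ d * Real.exp (-V (pos h η x)) * (pd i F (pos h η x) ^ 2 + ε) := by positivity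
    simpa using this
  · rw [gd_v hη _ _ _ hx, pos_add h η x hx]
    exact mul_le_mul_of_nonneg_left (hD _ (pos_mem hη.le hN x) i) (by positivity)

lemma norm_le_of_Bx {ρ : ℝ} (hρ : 0 ≤ ρ) {x : EuclideanSpace ℝ (Fin d)} (hx : x ∈ Bx d ρ) : ‖x‖ ≤ d * ρ := by
  have : x = ∑ i, x i • uv i := by
    ext j
    simp [uv, Finset.sum_apply, Pi.single_apply]
  rw [this]
  refine (norm_sum_le _ _).trans ?_
  calc ∑ i, ‖x i • uv i‖ ≤ ∑ i : Fin d, ρ := by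
        refine Finset.sum_le_sum fun i _ => ?_
        rw [norm_smul, norm_uv, mul_one]; exact hx i
    _ = d * ρ := by simp

lemma Bx_of_norm {ρ : ℝ} {x : EuclideanSpace ℝ (Fin d)} (hx : ‖x‖ ≤ ρ) : x ∈ Bx d ρ := fun i => by
  have := PiLp.norm_apply_le x i
  rw [Real.norm_eq_abs] at this
  exact this.trans hx

lemma gradSq_cont (hF : ContDiff ℝ 2 F) : Continuous (gradSq F) := by
  unfold gradSq
  exact continuous_finsetSum _ fun i _ => (pd_cont (hF.of_le (by norm_num)) i).pow 2
end ei
end Grid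

set_option linter.unusedSectionVars false
set_option linter.unusedVariables false

namespace Grid
open Filter Topology

section box
variable {d : ℕ} {V al F : EuclideanSpace ℝ (Fin d) → ℝ}

/-- box integral -/
noncomputable def bI (V : EuclideanSpace ℝ (Fin d) → ℝ) (r : ℝ) (φ : EuclideanSpace ℝ (Fin d) → ℝ) : ℝ :=
  ∫ z in Bx d (3 * r), Real.exp (-V z) * φ z

/-- Riemann sum -/
noncomputable def bS (V : EuclideanSpace ℝ (Fin d) → ℝ) (r n : ℕ) (φ : EuclideanSpace ℝ (Fin d) → ℝ) : ℝ :=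
  ∑ x : Fin d → Fin (2 * (3 * r) * n + 1), (n : ℝ)⁻¹ ^ d *
    (Real.exp (-V (pos (3 * (r : ℝ)) (n : ℝ)⁻¹ x)) * φ (pos (3 * (r : ℝ)) (n : ℝ)⁻¹ x))

lemma bS_tendsto (hV : Continuous V) (r : ℕ) {φ : EuclideanSpace ℝ (Fin d) → ℝ} (hφ : Continuous φ) :
    Tendsto (fun n => bS V r n φ) atTop (𝓝 (bI V r φ)) := by
  have := riemann (3 * r) (φ := fun z => Real.exp (-V z) * φ z) (by fun_prop)
  have e : ((3 * r : ℕ) : ℝ) = 3 * (r : ℝ) := by push_cast; ring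
  rw [e] at this
  exact this

/-- constant in the Poincare inequality -/
noncomputable def CPo (d : ℕ) (ρ m1 m2 : ℝ) : ℝ := 2 ^ d * (2 * ρ + 1) ^ 2 * (m2 / m1)

/-- right-hand side -/
noncomputable def RH (d : ℕ) (r ε T δ κ' b C B0 CP E1 I1 IF Iχ Ic Is II : ℝ) : ℝ :=
  Ph (IF / I1) * Iχ + B0 * C * Ic + b⁻¹ * (CP * (4 * (Real.exp (-(2 * κ' * T)) * E1) + 2 * GD.Yb d T r ε E1) + C ^ 2 * Is) +
    Real.exp ε * ((1 + δ) * (1 / (2 * κ')) * II + T * ((1 + 1 / δ) * b⁻¹ * GD.Yb d T r ε E1)) + T * (B0 / r * (d * I1 + E1))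

lemma Ph_cont : Continuous Ph := Real.continuous_mul_log

theorem box_ineq (hV : ContDiff ℝ 2 V) (hal : ContDiff ℝ 2 al) (hF : ContDiff ℝ 2 F)
    (halm : ∀ i x (t : ℝ), 0 ≤ t → al x ≤ al (x + t • uv i)) (hFm : ∀ i x (t : ℝ), 0 ≤ t → F x ≤ F (x + t • uv i))
    (hsub : ∀ i j, i ≠ j → ∀ x (t : ℝ), 0 ≤ t → V (x + t • uv i + t • uv j) + 2 * al (x + t • uv i + t • uv j) + (V x + 2 * al x) ≤
      (V (x + t • uv i) + 2 * al (x + t • uv i)) + (V (x + t • uv j) + 2 * al (x + t • uv j)))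
    {κ κ' : ℝ} (hκ' : 0 < κ') (hκ : κ' < κ)
    (hM : ∀ x (y : Fin d → ℝ), κ * ∑ i, y i ^ 2 ≤ ∑ i, y i * ∑ j, Mc V al x i j * y j)
    {b C B0 T δ : ℝ} (hb : 0 < b) (hFb : ∀ x, b ≤ F x ∧ F x ≤ C) (hT : 0 < T) (hδ : 0 < δ)
    (hB0 : 0 ≤ B0) (hB : ∀ s, b ≤ s → s ≤ C → |1 + Real.log s| ≤ B0)
    {r s : ℕ} (hr : 1 ≤ r) (hs : 1 ≤ s) (hrs : (d + 1) * (2 * s) ≤ r) {ε : ℝ} (hε : 0 < ε) (hε1 : ε ≤ 1 / 10)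
    {m1 m2 : ℝ} (hm1 : 0 < m1) (hm2 : 0 < m2)
    (hm : ∀ z ∈ Bx d (2 * (s : ℝ)), m1 ≤ Real.exp (-V z) ∧ Real.exp (-V z) ≤ m2)
    {E1 : ℝ} (hE1 : Real.exp ε * bI V r (fun z => gradSq F z + d * ε) < E1) (hI1 : bI V r (fun _ => 1) ≠ 0) :
    bI V r (fun z => chi r z ^ 2 * Ph (F z)) ≤
      RH d r ε T δ κ' b C B0 (CPo d (2 * (s : ℝ)) m1 m2) E1 (bI V r (fun _ => 1)) (bI V r F) (bI V r (fun z => chi r z ^ 2))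
        (bI V r (fun z => 1 - chi r z ^ 2)) (bI V r (fun z => 1 - chi s z)) (bI V r (fun z => (gradSq F z + d * ε) / F z)) := by
  have hF0 : ∀ x, 0 < F x := fun x => hb.trans_le (hFb x).1
  have hr' : (1 : ℝ) ≤ r := by exact_mod_cast hr
  have hs' : (1 : ℝ) ≤ s := by exact_mod_cast hs
  have hVc := hV.continuous
  have hFc := hF.continuous
  have hgc := gradSq_cont hF
  have hχc : ∀ r : ℝ, Continuous (chi (d := d) r) := fun r => chi_cont
  have l0 := bS_tendsto hVc r (φ := fun z => chi r z ^ 2 * Ph (F z)) (((hχc r).pow 2).mul (Ph_cont.comp hFc))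
  have l1 := bS_tendsto hVc r (φ := fun _ => 1) continuous_const
  have l2 := bS_tendsto hVc r hFc
  have l3 := bS_tendsto hVc r (φ := fun z => chi r z ^ 2) ((hχc r).pow 2)
  have l4 := bS_tendsto hVc r (φ := fun z => 1 - chi r z ^ 2) (continuous_const.sub ((hχc r).pow 2))
  have l5 := bS_tendsto hVc r (φ := fun z => 1 - chi s z) (continuous_const.sub (hχc s))
  have l6 := bS_tendsto hVc r (φ := fun z => (gradSq F z + d * ε) / F z)
    ((hgc.add continuous_const).div hFc (fun z => (hF0 z).ne'))
  have l7 := bS_tendsto hVc r (φ := fun z => (gradSq F z + d * ε)) (hgc.add continuous_const)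
  have hlim : Tendsto (fun n => RH d r ε T δ κ' b C B0 (CPo d (2 * (s : ℝ)) m1 m2) E1 (bS V r n (fun _ => 1)) (bS V r n F)
      (bS V r n (fun z => chi r z ^ 2))
      (bS V r n (fun z => 1 - chi r z ^ 2)) (bS V r n (fun z => 1 - chi s z)) (bS V r n (fun z => (gradSq F z + d * ε) / F z))) atTop
      (𝓝 (RH d r ε T δ κ' b C B0 (CPo d (2 * (s : ℝ)) m1 m2) E1 (bI V r (fun _ => 1)) (bI V r F) (bI V r (fun z => chi r z ^ 2))
        (bI V r (fun z => 1 - chi r z ^ 2)) (bI V r (fun z => 1 - chi s z)) (bI V r (fun z => (gradSq F z + d * ε) / F z)))) := by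
    unfold RH
    have a1 := (((Ph_cont.tendsto _).comp (l2.div l1 hI1)).mul l3)
    have a2 := l4.const_mul (B0 * C)
    have a3 := ((l5.const_mul (C ^ 2)).const_add ((CPo d (2 * (s : ℝ)) m1 m2) * (4 * (Real.exp (-(2 * κ' * T)) * E1) + 2 * GD.Yb d T r ε E1))).const_mul b⁻¹
    have a4 := ((l6.const_mul ((1 + δ) * (1 / (2 * κ')))).add_const (T * ((1 + 1 / δ) * b⁻¹ * GD.Yb d T r ε E1))).const_mul (Real.exp ε)
    have a5 := (((l1.const_mul (d : ℝ)).add_const E1).const_mul (B0 / r)).const_mul T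
    exact (((a1.add a2).add a3).add a4).add a5
  refine le_of_tendsto_of_tendsto l0 hlim ?_
  -- eventual inequality
  have hη0 : Tendsto (fun n : ℕ => (n : ℝ)⁻¹) atTop (𝓝[>] 0) := tendsto_inv_atTop_nhdsGT_zero.comp tendsto_natCast_atTop_atTop
  have hKc := Bx_compact (d := d) (3 * (r : ℝ))
  obtain ⟨K, hK0, hK⟩ := unifPQ hV hal hKc
  have hθ : ∀ᶠ η in 𝓝[>] (0:ℝ), K * η * (8 * (1 + d)) ≤ ε := by
    have : Tendsto (fun η : ℝ => K * η * (8 * (1 + (d : ℝ)))) (𝓝[>] 0) (𝓝 (K * 0 * (8 * (1 + d)))) :=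
      ((tendsto_nhdsWithin_of_tendsto_nhds tendsto_id).const_mul K).mul_const _
    rw [mul_zero, zero_mul] at this
    exact (this.eventually (gt_mem_nhds hε)).mono fun _ hh => hh.le
  have hle : ∀ᶠ η in 𝓝[>] (0:ℝ), η ≤ 1 / 2 :=
    mem_nhdsWithin_of_mem_nhds (ge_mem_nhds (by norm_num))
  have hall := (((unifZ hV hal hKc hε).and (unifV hV hKc hε)).and ((unifV hal hKc hε).and (unifD hF hKc hε))).and 
    ((hK.and hθ).and hle)
  have hE : ∀ᶠ n : ℕ in atTop, Real.exp ε * bS V r n (fun z => gradSq F z + d * ε) < E1 :=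
    (l7.const_mul _).eventually (gt_mem_nhds hE1)
  filter_upwards [hη0.eventually hall, hE, eventually_gt_atTop 0] with n hn hEn hn0
  obtain ⟨⟨⟨hZ, hVe⟩, hae, hD⟩, ⟨hPQ, hθ'⟩, hη2⟩ := hn
  have hn' : (0 : ℝ) < n := by exact_mod_cast hn0
  set η : ℝ := (n : ℝ)⁻¹ with hηd
  have hη : 0 < η := by positivity
  set N := 2 * (3 * r) * n with hNd
  have hN : η * N = 2 * (3 * (r : ℝ)) := by rw [hNd, hηd]; push_cast; field_simp
  obtain ⟨rr, hok⟩ := gd_ok (V := V) (al := al) hη hN hε.le hε1 (fun i x => halm i x η hη.le) 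
    (fun i j hij x => hsub i j hij x η hη.le) hVe hae
  have hκ0 : 0 < κ := hκ'.trans hκ
  have hok2 := gd_ok2 (V := V) (al := al) (ε := ε) (K := K) hr' hη hN (by linarith) 
    (fun x y => (mul_nonneg hκ0.le (Finset.sum_nonneg fun i _ => sq_nonneg _)).trans (hM x y)) hPQ hZ hK0 hθ'
  set D := gd V al N (3 * (r : ℝ)) η with hDd
  have hEE : D.E D.V (fun x => F (pos (3 * (r : ℝ)) η x)) (fun x => F (pos (3 * (r : ℝ)) η x)) ≤ E1 :=
    (gd_E hη hN hε.le hVe hD).trans hEn.le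
  have hI0 := gd_I0 (V := V) (al := al) hη hN hε.le hF0 hD
  have hw : ∀ (φ : EuclideanSpace ℝ (Fin d) → ℝ), ∑ x, D.w D.V x * φ (pos (3 * (r : ℝ)) η x) = bS V r n φ := by
    intro φ
    rw [bS]
    refine Finset.sum_congr rfl fun x _ => ?_
    rw [hDd, gd_w hη]; ring
  have hw1 : ∑ x, D.w D.V x = bS V r n (fun _ => 1) := by
    rw [← hw]; simp
  have hw1p : 0 < ∑ x, D.w D.V x := Finset.sum_pos (fun x _ => GD.w_pos _ _ _) Finset.univ_nonempty
  have hsr : (2 * (s : ℝ)) * (d + 1) ≤ r := by 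
    have : (((d + 1) * (2 * s) : ℕ) : ℝ) ≤ r := by exact_mod_cast hrs
    push_cast at this; linarith
  have hs3 : 2 * s ≤ 3 * r := by nlinarith
  have hd0 : (0:ℝ) ≤ d := by positivity
  have hPo := fun g hg => gd_poin (V := V) (al := al) (N := N) (L := 2 * (2 * s) * n) (o := (3 * r - 2 * s) * n)
    (η := η) (ρ := 2 * (s : ℝ)) (h := 3 * (r : ℝ)) (b := b) (C := C) (χ := chi r) (χs := chi s)
    (by rw [hNd, ← add_mul]; exact Nat.mul_le_mul_right _ (by omega)) hη (by linarith) (by positivity)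
    (by rw [hηd]; push_cast [Nat.cast_sub hs3]; field_simp) (by rw [hηd]; push_cast; field_simp)
    hm1 hm2 hm (fun z hz => chi_eq_one (by linarith) ((norm_le_of_Bx (by positivity) hz).trans (by nlinarith)))
    (fun z hz => by
      by_contra hne
      exact hz (Bx_of_norm (chi_supp (by linarith) hne).le)) (fun z => chi1 _ _) hb g hg
  have hmain := GD.grid_main hok hok2 hκ' hκ (fun x y => hM _ y) (F := fun x => F (pos (3 * (r : ℝ)) η x)) (gb := bS V r n F / bS V r n (fun _ => 1))
    hb (fun x => hFb _) (fun i x hk => by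
      rw [hDd, gd_k1] at hk
      have := pos_add (3 * (r : ℝ)) η x hk
      have e : D.e = ee := rfl
      simp only [e, this]
      exact hFm _ _ _ hη.le) hEE hT hδ hB0 hB (by positivity) hPo (by
      rw [hw1, hw, div_mul_cancel₀]
      rw [← hw1]; exact hw1p.ne')
  simp only [hw1] at hmain
  have c1 := hw (fun z => chi r z ^ 2 * Ph (F z))
  have c2 := hw (fun z => chi r z ^ 2)
  have c3 := hw (fun z => 1 - chi r z ^ 2)
  have c4 := hw (fun z => 1 - chi s z)
  rw [c1, c2, c3, c4] at hmain
  refine hmain.trans ?_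
  rw [RH, CPo]
  have : D.I0 (fun x => F (pos (3 * (r : ℝ)) η x)) ≤ bS V r n (fun z => (gradSq F z + d * ε) / F z) := hI0
  gcongr
end box
end Grid

set_option linter.unusedSectionVars false
set_option linter.unusedVariables false

namespace Grid
open Filter Topology

section full
variable {d : ℕ} {V al F : EuclideanSpace ℝ (Fin d) → ℝ}

lemma ev_Bx (x : EuclideanSpace ℝ (Fin d)) : ∀ᶠ r : ℕ in atTop, x ∈ Bx d (3 * (r : ℝ)) := by
  filter_upwards [eventually_ge_atTop ⌈‖x‖⌉₊] with r hr
  have : ‖x‖ ≤ r := Nat.ceil_le.1 hr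
  exact Bx_of_norm (by have := norm_nonneg x; linarith)

lemma ev_chi (x : EuclideanSpace ℝ (Fin d)) : ∀ᶠ r : ℕ in atTop, chi r x = 1 := by
  filter_upwards [eventually_ge_atTop ⌈‖x‖⌉₊, eventually_gt_atTop 0] with r hr hr0
  have : ‖x‖ ≤ r := Nat.ceil_le.1 hr
  exact chi_eq_one (by exact_mod_cast hr0) this

lemma bI_lim (hV : Continuous V) {φ : ℕ → EuclideanSpace ℝ (Fin d) → ℝ} {ψ : EuclideanSpace ℝ (Fin d) → ℝ}
    {g : EuclideanSpace ℝ (Fin d) → ℝ} (hφ : ∀ r, Continuous (φ r)) (hg : Integrable g)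
    (hb : ∀ᶠ r in atTop, ∀ x, |Real.exp (-V x) * φ r x| ≤ g x) (hl : ∀ x, Tendsto (fun r => φ r x) atTop (𝓝 (ψ x))) :
    Tendsto (fun r : ℕ => bI V r (φ r)) atTop (𝓝 (∫ x, Real.exp (-V x) * ψ x)) := by
  have e : ∀ r : ℕ, bI V r (φ r) = ∫ x, (Bx d (3 * (r : ℝ))).indicator (fun z => Real.exp (-V z) * φ r z) x := by
    intro r
    rw [bI, integral_indicator (Bx_compact _).measurableSet]
  simp only [e]
  refine tendsto_integral_filter_of_dominated_convergence g ?_ ?_ hg ?_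
  · refine Eventually.of_forall fun r => ?_
    have : Continuous (fun z => Real.exp (-V z) * φ r z) := by have := hφ r; fun_prop
    exact this.aestronglyMeasurable.indicator (Bx_compact _).measurableSet
  · filter_upwards [hb] with r hr
    refine Eventually.of_forall fun x => ?_
    refine (norm_indicator_le_norm_self _ _).trans ?_
    exact hr x
  · refine Eventually.of_forall fun x => ?_
    have : Tendsto (fun r : ℕ => Real.exp (-V x) * φ r x) atTop (𝓝 (Real.exp (-V x) * ψ x)) := (hl x).const_mul _
    refine this.congr' ?_
    filter_upwards [ev_Bx x] with r hr
    rw [Set.indicator_of_mem hr]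

theorem full_ineq (hV : ContDiff ℝ 2 V) (hal : ContDiff ℝ 2 al) (hF : ContDiff ℝ 2 F)
    (halm : ∀ i x (t : ℝ), 0 ≤ t → al x ≤ al (x + t • uv i)) (hFm : ∀ i x (t : ℝ), 0 ≤ t → F x ≤ F (x + t • uv i))
    (hsub : ∀ i j, i ≠ j → ∀ x (t : ℝ), 0 ≤ t → V (x + t • uv i + t • uv j) + 2 * al (x + t • uv i + t • uv j) + (V x + 2 * al x) ≤
      (V (x + t • uv i) + 2 * al (x + t • uv i)) + (V (x + t • uv j) + 2 * al (x + t • uv j)))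
    {κ : ℝ} (hκ : 0 < κ)
    (hM : ∀ x (y : Fin d → ℝ), κ * ∑ i, y i ^ 2 ≤ ∑ i, y i * ∑ j, Mc V al x i j * y j)
    {b C : ℝ} (hb : 0 < b) (hFb : ∀ x, b ≤ F x ∧ F x ≤ C)
    (hint : Integrable (fun x => Real.exp (-V x))) (hgi : Integrable (fun x => Real.exp (-V x) * gradSq F x)) :
    ∫ x, Real.exp (-V x) * Ph (F x) ≤ Ph ((∫ x, Real.exp (-V x) * F x) / (∫ x, Real.exp (-V x))) * (∫ x, Real.exp (-V x)) +
      1 / (2 * κ) * ∫ x, Real.exp (-V x) * (gradSq F x / F x) := by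
  have hF0 : ∀ x, 0 < F x := fun x => hb.trans_le (hFb x).1
  have hC : 0 < C := (hF0 0).trans_le (hFb 0).2
  have hVc := hV.continuous
  have hFc := hF.continuous
  have hgc := gradSq_cont hF
  have hχc : ∀ r : ℝ, Continuous (chi (d := d) r) := fun r => chi_cont
  have hg0 : ∀ x, 0 ≤ gradSq F x := fun x => Finset.sum_nonneg fun i _ => sq_nonneg _
  set B0 : ℝ := 1 + |Real.log b| + |Real.log C| with hB0d
  have hB00 : 0 ≤ B0 := by positivity
  have hB : ∀ s, b ≤ s → s ≤ C → |1 + Real.log s| ≤ B0 := by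
    intro s h1 h2
    have l1 := Real.log_le_log hb h1
    have l2 := Real.log_le_log (hb.trans_le h1) h2
    rw [abs_le]
    constructor
    · linarith [neg_abs_le (Real.log b), abs_nonneg (Real.log C)]
    · linarith [le_abs_self (Real.log C), abs_nonneg (Real.log b)]
  have hPhb : ∀ s, b ≤ s → s ≤ C → |Ph s| ≤ C * (B0 + 1) := by
    intro s h1 h2
    have := hB s h1 h2
    rw [Ph, abs_mul, abs_of_pos (hb.trans_le h1)]
    have h3 : |Real.log s| ≤ B0 + 1 := by
      rw [abs_le] at this ⊢; constructor <;> linarith [this.1, this.2]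
    gcongr
  set I1 := ∫ x, Real.exp (-V x) with hI1
  set II := ∫ x, Real.exp (-V x) * (gradSq F x / F x) with hII
  set IF := ∫ x, Real.exp (-V x) * F x with hIF
  set J : ℕ → ℝ := fun s => ∫ x, Real.exp (-V x) * (1 - chi s x) with hJ
  have hI1p : 0 < I1 := integral_exp_pos hint
  have hm0 : ∀ x, 0 < Real.exp (-V x) := fun x => Real.exp_pos _
  -- limits in r
  have hεt : Tendsto (fun r : ℕ => 1 / (r : ℝ)) atTop (𝓝 0) := tendsto_one_div_atTop_nhds_zero_nat
  have hε1 : ∀ᶠ r : ℕ in atTop, 1 / (r : ℝ) ≤ 1 := (hεt.eventually (gt_mem_nhds (by norm_num : (0:ℝ) < 1))).mono fun _ h => h.le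
  have t0 : Tendsto (fun r : ℕ => bI V r (fun z => chi r z ^ 2 * Ph (F z))) atTop (𝓝 (∫ x, Real.exp (-V x) * Ph (F x))) := by
    refine bI_lim hVc (fun r => ((hχc r).pow 2).mul (Ph_cont.comp hFc)) (hint.mul_const (C * (B0 + 1))) ?_ ?_
    · refine Eventually.of_forall fun r x => ?_
      rw [abs_mul, abs_of_pos (hm0 x), abs_mul]
      have h1 : |chi r x ^ 2| ≤ 1 := by
        rw [abs_of_nonneg (sq_nonneg _)]; exact pow_le_one₀ (chi0 _ _) (chi1 _ _)
      have h2 := hPhb _ (hFb x).1 (hFb x).2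
      refine mul_le_mul_of_nonneg_left ?_ (hm0 x).le
      calc _ ≤ 1 * |Ph (F x)| := mul_le_mul_of_nonneg_right h1 (abs_nonneg _)
        _ ≤ _ := by rw [one_mul]; exact h2
    · intro x
      refine tendsto_const_nhds.congr' ?_
      filter_upwards [ev_chi x] with r hr
      rw [hr]; ring
  have t1 : Tendsto (fun r : ℕ => bI V r (fun z => 1)) atTop (𝓝 I1) := by
    have := bI_lim (φ := fun _ _ => 1) (ψ := fun _ => 1) hVc (fun r => continuous_const) hint 
      (Eventually.of_forall fun r x => by rw [mul_one, abs_of_pos (hm0 x)]) (fun x => tendsto_const_nhds)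
    simpa using this
  have t2 : Tendsto (fun r : ℕ => bI V r F) atTop (𝓝 IF) := by
    refine bI_lim hVc (fun r => hFc) (hint.mul_const C) (Eventually.of_forall fun r x => ?_) (fun x => tendsto_const_nhds)
    rw [abs_of_pos (mul_pos (hm0 x) (hF0 x))]
    exact mul_le_mul_of_nonneg_left (hFb x).2 (hm0 x).le
  have t3 : Tendsto (fun r : ℕ => bI V r (fun z => chi r z ^ 2)) atTop (𝓝 I1) := by
    have := bI_lim (V := V) (φ := fun r z => chi r z ^ 2) (ψ := fun _ => 1) hVc (fun r => (hχc r).pow 2) hint 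
      (Eventually.of_forall fun r x => by
        rw [abs_mul, abs_of_pos (hm0 x)]
        have h1 : |chi r x ^ 2| ≤ 1 := by
          rw [abs_of_nonneg (sq_nonneg _)]; exact pow_le_one₀ (chi0 _ _) (chi1 _ _)
        exact mul_le_of_le_one_right (hm0 x).le h1) (fun x => by
        refine tendsto_const_nhds.congr' ?_
        filter_upwards [ev_chi x] with r hr
        rw [hr]; ring)
    simpa using this
  have t4 : Tendsto (fun r : ℕ => bI V r (fun z => 1 - chi r z ^ 2)) atTop (𝓝 0) := by
    have := bI_lim (V := V) (φ := fun r z => 1 - chi r z ^ 2) (ψ := fun _ => 0) hVc (fun r => continuous_const.sub ((hχc r).pow 2)) hint 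
      (Eventually.of_forall fun r x => by
        rw [abs_mul, abs_of_pos (hm0 x)]
        have h1 : chi r x ^ 2 ≤ 1 := pow_le_one₀ (chi0 _ _) (chi1 _ _)
        have h2 : |1 - chi r x ^ 2| ≤ 1 := by rw [abs_le]; constructor <;> nlinarith [sq_nonneg (chi (r : ℝ) x)]
        exact mul_le_of_le_one_right (hm0 x).le h2) (fun x => by
        refine tendsto_const_nhds.congr' ?_
        filter_upwards [ev_chi x] with r hr
        rw [hr]; ring)
    simpa using this
  have hχ1 : ∀ (s : ℕ) (x : EuclideanSpace ℝ (Fin d)), |Real.exp (-V x) * (1 - chi s x)| ≤ Real.exp (-V x) := by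
    intro s x
    rw [abs_mul, abs_of_pos (hm0 x)]
    have h2 : |1 - chi (s : ℝ) x| ≤ 1 := by rw [abs_le]; constructor <;> linarith [chi0 (s : ℝ) x, chi1 (s : ℝ) x]
    exact mul_le_of_le_one_right (hm0 x).le h2
  have t5 : ∀ s : ℕ, Tendsto (fun r : ℕ => bI V r (fun z => 1 - chi s z)) atTop (𝓝 (J s)) := fun s =>
    bI_lim hVc (fun r => continuous_const.sub (hχc s)) hint (Eventually.of_forall fun r x => hχ1 s x) (fun x => tendsto_const_nhds)
  have hdomE : Integrable (fun x => Real.exp (-V x) * gradSq F x + Real.exp (-V x) * d) := hgi.add (hint.mul_const _)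
  have t6 : Tendsto (fun r : ℕ => bI V r (fun z => (gradSq F z + d * (1 / (r : ℝ))) / F z)) atTop (𝓝 II) := by
    refine bI_lim (φ := fun r z => (gradSq F z + d * (1 / (r : ℝ))) / F z) hVc (fun r => (hgc.add continuous_const).div hFc (fun z => (hF0 z).ne')) (hdomE.mul_const b⁻¹) ?_ ?_
    · filter_upwards [hε1] with r hr x
      have hp : (0:ℝ) ≤ 1 / r := by positivity
      have hgx := hg0 x
      rw [abs_of_nonneg (mul_nonneg (hm0 x).le (div_nonneg (by positivity) (hF0 x).le)), ← mul_div_assoc, div_eq_mul_inv, ← mul_add]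
      have h1 : (F x)⁻¹ ≤ b⁻¹ := inv_anti₀ hb (hFb x).1
      have h2 : d * (1 / (r : ℝ)) ≤ d := mul_le_of_le_one_right (by positivity) hr
      have h3 := (inv_pos.2 (hF0 x)).le
      gcongr
    · intro x
      have := ((hεt.const_mul (d : ℝ)).const_add (gradSq F x)).div_const (F x)
      simpa using this
  have t7 : Tendsto (fun r : ℕ => bI V r (fun z => (gradSq F z + d * (1 / (r : ℝ))))) atTop (𝓝 (∫ x, Real.exp (-V x) * gradSq F x)) := by
    refine bI_lim (φ := fun r z => (gradSq F z + d * (1 / (r : ℝ)))) hVc (fun r => (hgc.add continuous_const)) hdomE ?_ ?_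
    · filter_upwards [hε1] with r hr x
      have hp : (0:ℝ) ≤ 1 / r := by positivity
      have hgx := hg0 x
      rw [abs_of_nonneg (mul_nonneg (hm0 x).le (by positivity)), ← mul_add]
      have h2 : d * (1 / (r : ℝ)) ≤ d := mul_le_of_le_one_right (by positivity) hr
      have := (hm0 x).le
      gcongr
    · intro x
      have := ((hεt.const_mul (d : ℝ)).const_add (gradSq F x))
      simpa using this
  set E1 := (∫ x, Real.exp (-V x) * gradSq F x) + 1 with hE1
  have hexpt : Tendsto (fun r : ℕ => Real.exp (1 / (r : ℝ))) atTop (𝓝 1) := by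
    have := (Real.continuous_exp.tendsto 0).comp hεt
    rwa [Real.exp_zero] at this
  have hEe : ∀ᶠ r : ℕ in atTop, Real.exp (1 / (r : ℝ)) * bI V r (fun z => (gradSq F z + d * (1 / (r : ℝ)))) < E1 :=
    (hexpt.mul t7).eventually (gt_mem_nhds (by rw [hE1]; linarith))
  have hYb : ∀ T, Tendsto (fun r : ℕ => GD.Yb d T r (1 / (r : ℝ)) E1) atTop (𝓝 0) := by
    intro T
    unfold GD.Yb
    have hi : Tendsto (fun r : ℕ => (r : ℝ)⁻¹) atTop (𝓝 0) := by simpa using hεt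
    have := ((((hi.pow 2).const_mul (16 * (d : ℝ))).add (hεt.const_mul (16 + 10 * (d : ℝ)))).const_mul T).mul_const E1 |>.add
      ((hεt.const_mul 4).mul_const E1)
    simpa using this
  -- inequality with parameters
  have key : ∀ κ', 0 < κ' → κ' < κ → ∀ δ : ℝ, 0 < δ → ∀ s : ℕ, 1 ≤ s → ∃ CP : ℝ, ∀ T : ℝ, 0 < T →
      ∫ x, Real.exp (-V x) * Ph (F x) ≤ Ph (IF / I1) * I1 + b⁻¹ * (CP * (4 * (Real.exp (-(2 * κ' * T)) * E1)) + C ^ 2 * J s) +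
        (1 + δ) * (1 / (2 * κ')) * II := by
    intro κ' hκ'0 hκ' δ hδ s hs
    have hcexp : Continuous (fun z => Real.exp (-V z)) := by fun_prop
    have hne : (Bx d (2 * (s : ℝ))).Nonempty := ⟨0, Bx_of_norm (by simp)⟩
    obtain ⟨z1, -, hz1⟩ := (Bx_compact (d := d) (2 * (s : ℝ))).exists_isMinOn hne hcexp.continuousOn
    obtain ⟨z2, -, hz2⟩ := (Bx_compact (d := d) (2 * (s : ℝ))).exists_isMaxOn hne hcexp.continuousOn
    refine ⟨CPo d (2 * (s : ℝ)) (Real.exp (-V z1)) (Real.exp (-V z2)), fun T hT => ?_⟩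
    set CP := CPo d (2 * (s : ℝ)) (Real.exp (-V z1)) (Real.exp (-V z2)) with hCP
    have hev : ∀ᶠ r : ℕ in atTop, bI V r (fun z => chi r z ^ 2 * Ph (F z)) ≤
      RH d r (1 / (r : ℝ)) T δ κ' b C B0 CP E1 (bI V r (fun _ => 1)) (bI V r F) (bI V r (fun z => chi r z ^ 2))
        (bI V r (fun z => 1 - chi r z ^ 2)) (bI V r (fun z => 1 - chi s z)) (bI V r (fun z => (gradSq F z + d * (1 / (r : ℝ))) / F z)) := by
      filter_upwards [hEe, t1.eventually_ne hI1p.ne', eventually_ge_atTop 1, eventually_ge_atTop ((d + 1) * (2 * s)),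
        hεt.eventually (gt_mem_nhds (by norm_num : (0:ℝ) < 1 / 10))] with r h1 h2 h3 h4 h5
      have : (0:ℝ) < r := by exact_mod_cast h3
      exact box_ineq hV hal hF halm hFm hsub hκ'0 hκ' hM hb hFb hT hδ hB00 hB h3 hs h4 (by positivity) h5.le
        (hm0 z1) (hm0 z2) (fun z hz => ⟨hz1 hz, hz2 hz⟩) h1 h2
    have hlim : Tendsto (fun r : ℕ => RH d r (1 / (r : ℝ)) T δ κ' b C B0 CP E1 (bI V r (fun _ => 1)) (bI V r F) (bI V r (fun z => chi r z ^ 2))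
        (bI V r (fun z => 1 - chi r z ^ 2)) (bI V r (fun z => 1 - chi s z)) (bI V r (fun z => (gradSq F z + d * (1 / (r : ℝ))) / F z))) atTop
        (𝓝 (Ph (IF / I1) * I1 + B0 * C * 0 + b⁻¹ * (CP * (4 * (Real.exp (-(2 * κ' * T)) * E1) + 2 * 0) + C ^ 2 * J s) +
          1 * ((1 + δ) * (1 / (2 * κ')) * II + T * ((1 + 1 / δ) * b⁻¹ * 0)) + T * (0 * (d * I1 + E1)))) := by
      unfold RH
      have a1 := (((Ph_cont.tendsto _).comp (t2.div t1 hI1p.ne')).mul t3)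
      have a2 := t4.const_mul (B0 * C)
      have a3 := ((((hYb T).const_mul 2).const_add (4 * (Real.exp (-(2 * κ' * T)) * E1))).const_mul CP).add ((t5 s).const_mul (C ^ 2)) |>.const_mul b⁻¹
      have a4 := hexpt.mul ((t6.const_mul ((1 + δ) * (1 / (2 * κ')))).add (((hYb T).const_mul ((1 + 1 / δ) * b⁻¹)).const_mul T))
      have hB0r : Tendsto (fun r : ℕ => B0 / (r : ℝ)) atTop (𝓝 0) := tendsto_const_div_atTop_nhds_zero_nat B0
      have a5 := (hB0r.mul ((t1.const_mul (d : ℝ)).add_const E1)).const_mul T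
      exact (((a1.add a2).add a3).add a4).add a5
    have := le_of_tendsto_of_tendsto t0 hlim hev
    simpa using this
  have key2 : ∀ κ', 0 < κ' → κ' < κ → ∀ δ : ℝ, 0 < δ → ∀ s : ℕ, 1 ≤ s → 
      ∫ x, Real.exp (-V x) * Ph (F x) ≤ Ph (IF / I1) * I1 + b⁻¹ * (C ^ 2 * J s) + (1 + δ) * (1 / (2 * κ')) * II := by
    intro κ' hκ'0 hκ' δ hδ s hs
    obtain ⟨CP, hCP⟩ := key κ' hκ'0 hκ' δ hδ s hs
    have he : Tendsto (fun T : ℝ => Real.exp (-(2 * κ' * T))) atTop (𝓝 0) :=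
      Real.tendsto_exp_neg_atTop_nhds_zero.comp (tendsto_id.const_mul_atTop (by positivity))
    have hl := (((((he.mul_const E1).const_mul 4).const_mul CP).add_const (C ^ 2 * J s)).const_mul b⁻¹ |>.const_add (Ph (IF / I1) * I1)).add_const
      ((1 + δ) * (1 / (2 * κ')) * II)
    have := ge_of_tendsto hl ((eventually_gt_atTop 0).mono fun T hT => hCP T hT)
    simpa using this
  have hJ0 : Tendsto J atTop (𝓝 0) := by
    have : Tendsto J atTop (𝓝 (∫ x : EuclideanSpace ℝ (Fin d), (0 : ℝ))) := by
      refine tendsto_integral_of_dominated_convergence (fun x => Real.exp (-V x)) (fun s => ?_) hint (fun s => ?_) ?_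
      · have : Continuous (fun x => Real.exp (-V x) * (1 - chi s x)) := by have := hχc s; fun_prop
        exact this.aestronglyMeasurable
      · exact Eventually.of_forall fun x => hχ1 s x
      · refine Eventually.of_forall fun x => ?_
        refine tendsto_const_nhds.congr' ?_
        filter_upwards [ev_chi x] with r hr
        rw [hr]; ring
    simpa using this
  have key3 : ∀ κ', 0 < κ' → κ' < κ → ∀ δ : ℝ, 0 < δ →
      ∫ x, Real.exp (-V x) * Ph (F x) ≤ Ph (IF / I1) * I1 + (1 + δ) * (1 / (2 * κ')) * II := by
    intro κ' hκ'0 hκ' δ hδ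
    have hl := (((hJ0.const_mul (C ^ 2)).const_mul b⁻¹).const_add (Ph (IF / I1) * I1)).add_const ((1 + δ) * (1 / (2 * κ')) * II)
    have := ge_of_tendsto hl ((eventually_ge_atTop 1).mono fun s hs => key2 κ' hκ'0 hκ' δ hδ s hs)
    simpa using this
  -- final limit
  have h4 : ∀ᶠ t : ℝ in 𝓝[>] 0, ∫ x, Real.exp (-V x) * Ph (F x) ≤ Ph (IF / I1) * I1 + (1 + t) * (1 / (2 * (κ / (1 + t)))) * II := by
    filter_upwards [self_mem_nhdsWithin] with t ht
    have ht' : 0 < t := ht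
    exact key3 _ (by positivity) (div_lt_self hκ (by linarith)) t ht'
  have hl : Tendsto (fun t : ℝ => Ph (IF / I1) * I1 + (1 + t) * (1 / (2 * (κ / (1 + t)))) * II) (𝓝[>] 0)
      (𝓝 (Ph (IF / I1) * I1 + (1 + 0) * (1 / (2 * (κ / (1 + 0)))) * II)) := by
    have ht : Tendsto (fun t : ℝ => 1 + t) (𝓝[>] 0) (𝓝 (1 + 0)) := (tendsto_nhdsWithin_of_tendsto_nhds tendsto_id).const_add 1
    have hne : (2 * (κ / (1 + 0)) : ℝ) ≠ 0 := by positivity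
    have h1 : Tendsto (fun t : ℝ => 2 * (κ / (1 + t))) (𝓝[>] 0) (𝓝 (2 * (κ / (1 + 0)))) := 
      ((tendsto_const_nhds (x := κ)).div ht (by norm_num)).const_mul 2
    exact ((ht.mul ((tendsto_const_nhds (x := (1:ℝ))).div h1 hne)).mul_const II).const_add _
  have := ge_of_tendsto hl h4
  simpa using this
end full
end Grid

set_option linter.unusedVariables false
set_option linter.unusedSectionVars false
namespace Grid
open Filter Topology
section fin
variable {d : ℕ} {V al f : EuclideanSpace ℝ (Fin d) → ℝ}

noncomputable def tr (e s : ℝ) : ℝ := e + s / (1 + e * s)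

lemma tr_bd {e s : ℝ} (he : 0 < e) (hs : 0 < s) : e ≤ tr e s ∧ tr e s ≤ e + 1 / e ∧ tr e s ≤ e + s := by
  have h1 : 0 < 1 + e * s := by positivity
  refine ⟨?_, ?_, ?_⟩
  · have : 0 ≤ s / (1 + e * s) := by positivity
    unfold tr; linarith
  · have : s / (1 + e * s) ≤ 1 / e := by
      rw [div_le_div_iff₀ h1 he]; nlinarith
    unfold tr; linarith
  · have : s / (1 + e * s) ≤ s := by
      rw [div_le_iff₀ h1]; nlinarith [mul_pos he (mul_pos hs hs)]
    unfold tr; linarith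

lemma tr_deriv {e s : ℝ} (he : 0 < e) (hs : 0 < s) :
    HasDerivAt (fun s => tr e s ^ 2) (2 * tr e s / (1 + e * s) ^ 2) s := by
  have h1 : 0 < 1 + e * s := by positivity
  have hd : HasDerivAt (fun s : ℝ => 1 + e * s) e s := by
    simpa using ((hasDerivAt_id s).const_mul e).const_add 1
  have h2 : HasDerivAt (fun s => tr e s) (1 / (1 + e * s) ^ 2) s := by
    have := ((hasDerivAt_id s).div hd h1.ne').const_add e
    refine this.congr_deriv ?_
    simp only [id]
    congr 1
    ring
  have h3 := h2.pow 2
  refine h3.congr_deriv ?_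
  push_cast
  ring

lemma Ph_dom {u s : ℝ} (hu : 0 < u) (hs : 0 < s) (h : s ≤ 2 * (u + 1)) :
    |Ph s| ≤ 8 + 8 * u + 4 * |Ph u| := by
  have h4 : Real.log 4 ≤ 2 := by
    have : Real.log 4 = 2 * Real.log 2 := by
      rw [show (4 : ℝ) = 2 ^ 2 by norm_num, Real.log_pow]; norm_num
    have := Real.log_two_lt_d9; linarith
  have hlow : -1 ≤ Ph s := by
    have h1 := Real.log_le_sub_one_of_pos (inv_pos.mpr hs)
    rw [Real.log_inv] at h1
    have h2 := mul_le_mul_of_nonneg_left h1 hs.le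
    have : s * (s⁻¹ - 1) = 1 - s := by field_simp
    unfold Ph; nlinarith
  have ha := abs_nonneg (Ph u)
  have hup : Ph s ≤ 8 + 8 * u + 4 * |Ph u| := by
    unfold Ph
    rcases le_total s 1 with h1 | h1
    · have := Real.log_nonpos hs.le h1
      have : s * Real.log s ≤ 0 := mul_nonpos_of_nonneg_of_nonpos hs.le this
      unfold Ph at ha
      linarith
    rcases le_total u 1 with h2 | h2
    · have hl : Real.log s ≤ 2 := (Real.log_le_log hs (by linarith)).trans h4
      have : s * Real.log s ≤ 4 * 2 := mul_le_mul (by linarith) hl (Real.log_nonneg h1) (by norm_num)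
      unfold Ph at ha
      linarith
    · have hl : Real.log s ≤ 2 + Real.log u := by
        have := Real.log_le_log hs (show s ≤ 4 * u by linarith)
        rw [Real.log_mul (by norm_num) hu.ne'] at this; linarith
      have : s * Real.log s ≤ (4 * u) * (2 + Real.log u) := mul_le_mul (by linarith) hl (Real.log_nonneg h1) (by linarith)
      have := le_abs_self (u * Real.log u)
      nlinarith
  rw [abs_le]
  exact ⟨by linarith, hup⟩

lemma Ftr_pd {e : ℝ} (he : 0 < e) (hf : Differentiable ℝ f) (hfp : ∀ x, 0 < f x) (i : Fin d) (x) :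
    pd i (fun y => tr e (f y) ^ 2) x = 2 * tr e (f x) / (1 + e * f x) ^ 2 * pd i f x := by
  have h := ((tr_deriv he (hfp x)).comp_hasFDerivAt x (hf x).hasFDerivAt).fderiv
  have h' : fderiv ℝ (fun y => tr e (f y) ^ 2) x = (2 * tr e (f x) / (1 + e * f x) ^ 2) • fderiv ℝ f x := h
  simp [pd, h']

lemma Ftr_grad {e : ℝ} (he : 0 < e) (hf : Differentiable ℝ f) (hfp : ∀ x, 0 < f x) (x) :
    gradSq (fun y => tr e (f y) ^ 2) x ≤ 4 * tr e (f x) ^ 2 * gradSq f x := by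
  unfold gradSq
  rw [Finset.mul_sum]
  refine Finset.sum_le_sum fun i _ => ?_
  rw [Ftr_pd he hf hfp, mul_pow]
  refine mul_le_mul_of_nonneg_right ?_ (sq_nonneg _)
  have h1 : 1 ≤ 1 + e * f x := by have := mul_pos he (hfp x); linarith
  have h2 : 1 ≤ ((1 + e * f x) ^ 2) ^ 2 := one_le_pow₀ (one_le_pow₀ h1)
  rw [div_pow, div_le_iff₀ (by positivity)]
  have : 0 ≤ 4 * tr e (f x) ^ 2 := by positivity
  nlinarith

lemma gradSq_nonneg' (F : EuclideanSpace ℝ (Fin d) → ℝ) (x) : 0 ≤ gradSq F x :=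
  Finset.sum_nonneg fun i _ => sq_nonneg _

lemma Ftr_cd {e : ℝ} (he : 0 < e) (hf : ContDiff ℝ 2 f) (hfp : ∀ x, 0 < f x) :
    ContDiff ℝ 2 (fun y => tr e (f y) ^ 2) := by
  unfold tr
  refine (contDiff_const.add (hf.div (contDiff_const.add (contDiff_const.mul hf)) fun x => ?_)).pow 2
  have := mul_pos he (hfp x); linarith

theorem vol_ineq (hV : ContDiff ℝ 2 V) (hal : ContDiff ℝ 2 al) (hf : ContDiff ℝ 2 f) (hfp : ∀ x, 0 < f x)
    (halm : ∀ i x (t : ℝ), 0 ≤ t → al x ≤ al (x + t • uv i)) (hfm : ∀ i x, 0 ≤ pd i f x)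
    (hsub : ∀ i j, i ≠ j → ∀ x (t : ℝ), 0 ≤ t → V (x + t • uv i + t • uv j) + 2 * al (x + t • uv i + t • uv j) + (V x + 2 * al x) ≤
      (V (x + t • uv i) + 2 * al (x + t • uv i)) + (V (x + t • uv j) + 2 * al (x + t • uv j)))
    {κ : ℝ} (hκ : 0 < κ)
    (hM : ∀ x (y : Fin d → ℝ), κ * ∑ i, y i ^ 2 ≤ ∑ i, y i * ∑ j, Mc V al x i j * y j)
    (hint : Integrable (fun x => Real.exp (-V x)))
    (h1 : Integrable (fun x => Real.exp (-V x) * Ph (f x ^ 2)))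
    (h2 : Integrable (fun x => Real.exp (-V x) * f x ^ 2))
    (h3 : Integrable (fun x => Real.exp (-V x) * gradSq f x)) :
    ∫ x, Real.exp (-V x) * Ph (f x ^ 2) ≤
      Ph ((∫ x, Real.exp (-V x) * f x ^ 2) / (∫ x, Real.exp (-V x))) * (∫ x, Real.exp (-V x)) +
        2 / κ * ∫ x, Real.exp (-V x) * gradSq f x := by
  have hVc : Continuous V := hV.continuous
  have hfc : Continuous f := hf.continuous
  have hm : Continuous fun x => Real.exp (-V x) := by fun_prop
  have hfd : Differentiable ℝ f := hf.differentiable (by norm_num)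
  let e : ℕ → ℝ := fun k => 1 / ((k : ℝ) + 1)
  have he : ∀ k, 0 < e k := fun k => by positivity
  have he1 : ∀ k, e k ≤ 1 := fun k => by
    simp only [e]; rw [div_le_one (by positivity)]; have : (0 : ℝ) ≤ k := by positivity
    linarith
  have het : Tendsto e atTop (𝓝 0) := tendsto_one_div_add_atTop_nhds_zero_nat
  have hFt : ∀ x, Tendsto (fun k => tr (e k) (f x) ^ 2) atTop (𝓝 (f x ^ 2)) := by
    intro x
    have : Tendsto (fun k => (e k + f x / (1 + e k * f x)) ^ 2) atTop (𝓝 ((0 + f x / (1 + 0 * f x)) ^ 2)) := by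
      refine (het.add (tendsto_const_nhds.div (tendsto_const_nhds.add (het.mul_const _)) (by norm_num))).pow 2
    simpa [tr] using this
  have hFc : ∀ k, Continuous fun x => tr (e k) (f x) ^ 2 := fun k => (Ftr_cd (he k) hf hfp).continuous
  have hF0 : ∀ k x, 0 < tr (e k) (f x) ^ 2 := fun k x => by
    have := (tr_bd (he k) (hfp x)).1
    have := he k
    exact pow_pos (by linarith) 2
  have hFu : ∀ k x, tr (e k) (f x) ^ 2 ≤ 2 * (f x ^ 2 + 1) := fun k x => by
    have := (tr_bd (he k) (hfp x)).2.2
    have h0 := (tr_bd (he k) (hfp x)).1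
    have := he k
    have := he1 k
    have : tr (e k) (f x) ^ 2 ≤ (1 + f x) ^ 2 := pow_le_pow_left₀ (by linarith) (by linarith) 2
    nlinarith [sq_nonneg (f x - 1)]
  have key : ∀ k, ∫ x, Real.exp (-V x) * Ph (tr (e k) (f x) ^ 2) ≤
      Ph ((∫ x, Real.exp (-V x) * tr (e k) (f x) ^ 2) / (∫ x, Real.exp (-V x))) * (∫ x, Real.exp (-V x)) +
        2 / κ * ∫ x, Real.exp (-V x) * gradSq f x := by
    intro k
    have hcd := Ftr_cd (he k) hf hfp
    have hFb : ∀ x, e k ^ 2 ≤ tr (e k) (f x) ^ 2 ∧ tr (e k) (f x) ^ 2 ≤ (e k + 1 / e k) ^ 2 := fun x => by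
      obtain ⟨a1, a2, -⟩ := tr_bd (he k) (hfp x)
      have := he k
      exact ⟨pow_le_pow_left₀ this.le a1 2, pow_le_pow_left₀ (by linarith) a2 2⟩
    have hgi : Integrable (fun x => Real.exp (-V x) * gradSq (fun y => tr (e k) (f y) ^ 2) x) := by
      refine (h3.const_mul (4 * (e k + 1 / e k) ^ 2)).mono' (hm.mul (gradSq_cont hcd)).aestronglyMeasurable
        (ae_of_all _ fun x => ?_)
      have := gradSq_nonneg' (fun y => tr (e k) (f y) ^ 2) x
      have g0 := gradSq_nonneg' f x
      have ee := Real.exp_pos (-V x)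
      rw [Real.norm_of_nonneg (by positivity)]
      have h5 := Ftr_grad (he k) hfd hfp x
      have h6 := mul_le_mul_of_nonneg_right (hFb x).2 g0
      have h7 : gradSq (fun y => tr (e k) (f y) ^ 2) x ≤ 4 * (e k + 1 / e k) ^ 2 * gradSq f x := by linarith
      have := mul_le_mul_of_nonneg_left h7 ee.le
      linarith
    have hq := full_ineq hV hal hcd halm (fun i x t ht => mono_line (hcd.differentiable (by norm_num)) i
      (fun y => by
        rw [Ftr_pd (he k) hfd hfp]
        have := (tr_bd (he k) (hfp y)).1
        have h0 := he k
        have : 0 ≤ tr (e k) (f y) := by linarith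
        exact mul_nonneg (by positivity) (hfm i y)) x ht) hsub hκ hM (b := e k ^ 2)
      (C := (e k + 1 / e k) ^ 2) (by have := he k; positivity) hFb hint hgi
    refine hq.trans ?_
    have hle : ∫ x, Real.exp (-V x) * (gradSq (fun y => tr (e k) (f y) ^ 2) x / tr (e k) (f x) ^ 2) ≤
        ∫ x, 4 * (Real.exp (-V x) * gradSq f x) := by
      refine integral_mono_of_nonneg (ae_of_all _ fun x => ?_) (h3.const_mul 4) (ae_of_all _ fun x => ?_)
      · have := gradSq_nonneg' (fun y => tr (e k) (f y) ^ 2) x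
        have := hF0 k x
        show (0 : ℝ) ≤ _
        positivity
      · have h5 := Ftr_grad (he k) hfd hfp x
        have h6 : gradSq (fun y => tr (e k) (f y) ^ 2) x / tr (e k) (f x) ^ 2 ≤ 4 * gradSq f x := by
          rw [div_le_iff₀ (hF0 k x)]; linarith
        have := mul_le_mul_of_nonneg_left h6 (Real.exp_pos (-V x)).le
        show _ ≤ _
        linarith
    rw [integral_const_mul] at hle
    have h8 := mul_le_mul_of_nonneg_left hle (show 0 ≤ 1 / (2 * κ) by positivity)
    have h9 : 1 / (2 * κ) * (4 * ∫ x, Real.exp (-V x) * gradSq f x) = 2 / κ * ∫ x, Real.exp (-V x) * gradSq f x := by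
      field_simp; norm_num
    rw [h9] at h8
    linarith
  have t1 : Tendsto (fun k => ∫ x, Real.exp (-V x) * Ph (tr (e k) (f x) ^ 2)) atTop
      (𝓝 (∫ x, Real.exp (-V x) * Ph (f x ^ 2))) := by
    refine tendsto_integral_of_dominated_convergence
      (fun x => 8 * Real.exp (-V x) + 8 * (Real.exp (-V x) * f x ^ 2) + 4 * |Real.exp (-V x) * Ph (f x ^ 2)|)
      (fun k => (hm.mul (Ph_cont.comp (hFc k))).aestronglyMeasurable)
      (((hint.const_mul 8).add (h2.const_mul 8)).add (h1.abs.const_mul 4)) ?_ ?_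
    · intro k
      refine ae_of_all _ fun x => ?_
      have ee := Real.exp_pos (-V x)
      rw [Real.norm_eq_abs, abs_mul, abs_mul, abs_of_pos ee]
      have := mul_le_mul_of_nonneg_left (Ph_dom (by have := hfp x; positivity) (hF0 k x) (hFu k x)) ee.le
      linarith
    · exact ae_of_all _ fun x => ((Ph_cont.tendsto _).comp (hFt x)).const_mul _
  have t2 : Tendsto (fun k => ∫ x, Real.exp (-V x) * tr (e k) (f x) ^ 2) atTop
      (𝓝 (∫ x, Real.exp (-V x) * f x ^ 2)) := by
    refine tendsto_integral_of_dominated_convergence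
      (fun x => 2 * Real.exp (-V x) + 2 * (Real.exp (-V x) * f x ^ 2))
      (fun k => (hm.mul (hFc k)).aestronglyMeasurable)
      ((hint.const_mul 2).add (h2.const_mul 2)) ?_ ?_
    · intro k
      refine ae_of_all _ fun x => ?_
      have ee := Real.exp_pos (-V x)
      have := hF0 k x
      rw [Real.norm_of_nonneg (by positivity)]
      have := mul_le_mul_of_nonneg_left (hFu k x) ee.le
      linarith
    · exact ae_of_all _ fun x => (hFt x).const_mul _
  refine le_of_tendsto_of_tendsto' t1 ((((Ph_cont.tendsto _).comp (t2.div_const _)).mul_const _).add_const _) key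


lemma Z_pos (hV : Continuous V) (hint : Integrable (fun x => Real.exp (-V x))) : 0 < ∫ x, Real.exp (-V x) := integral_exp_pos hint

lemma gib_eq (hV : Continuous V) (hint : Integrable (fun x => Real.exp (-V x))) : gibbs V = (ENNReal.ofReal (∫ x, Real.exp (-V x)))⁻¹ •
    volume.withDensity fun x => ENNReal.ofReal (Real.exp (-V x)) := by
  rw [gibbs, ofReal_integral_eq_lintegral_ofReal hint (ae_of_all _ fun x => (Real.exp_pos _).le)]

lemma gib_int (hV : Continuous V) (hint : Integrable (fun x => Real.exp (-V x))) (g : EuclideanSpace ℝ (Fin d) → ℝ) :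
    ∫ x, g x ∂(gibbs V) = (∫ x, Real.exp (-V x))⁻¹ * ∫ x, Real.exp (-V x) * g x := by
  have hz := Z_pos hV hint
  have hm : Measurable fun x => ENNReal.ofReal (Real.exp (-V x)) := by fun_prop
  rw [gib_eq hV hint, integral_smul_measure, integral_withDensity_eq_integral_toReal_smul hm (ae_of_all _ fun x => ENNReal.ofReal_lt_top)]
  simp [ENNReal.toReal_inv, ENNReal.toReal_ofReal hz.le, ENNReal.toReal_ofReal (Real.exp_pos _).le]

lemma gib_integ (hV : Continuous V) (hint : Integrable (fun x => Real.exp (-V x))) {g : EuclideanSpace ℝ (Fin d) → ℝ} (hg : Integrable g (gibbs V)) :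
    Integrable (fun x => Real.exp (-V x) * g x) := by
  have hz := Z_pos hV hint
  have hm : Measurable fun x => ENNReal.ofReal (Real.exp (-V x)) := by fun_prop
  rw [gib_eq hV hint, integrable_smul_measure (by simp) (by simp [hz]), integrable_withDensity_iff_integrable_smul' hm (ae_of_all _ fun x => ENNReal.ofReal_lt_top)] at hg
  simpa [ENNReal.toReal_ofReal (Real.exp_pos _).le] using hg
end fin
end Grid


/-- Logarithmic Sobolev inequality restricted to monotonic functions:
under the (G) and (BM) conditions on a non-decreasing positive perturbation `a`, if
`κ̃_a = inf { ρ₋(∇²V) - a L(a⁻¹) } > 0`, then for every smooth positive non-decreasing `f`,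
`Ent_μ(f²) ≤ (2/κ̃_a) ∫ |∇f|² dμ`. -/
theorem lsi_monotone {d : ℕ} (hd : 1 ≤ d) (V a : EuclideanSpace ℝ (Fin d) → ℝ)
    (hV : ContDiff ℝ (⊤ : ℕ∞) V)
    (hint : Integrable (fun x => Real.exp (-V x)))
    (hconv : ∃ ρ : ℝ, ∀ x, Matrix.PosSemidef (hess V x - ρ • 1))
    (ha : ContDiff ℝ (⊤ : ℕ∞) a) (hapos : ∀ x, 0 < a x)
    (hamono : ∀ (i : Fin d) x, 0 ≤ pd i a x)
    (hG : ∃ M : ℝ, ∀ x, Real.sqrt (gradSq a x) / a x ≤ M)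
    (hBM1 : ∀ i j : Fin d, i ≠ j → ∀ x,
      pd i (fun y => pd j (fun z => V z + Real.log (a z ^ 2)) y) x ≤ 0)
    (hBM2 : ∀ i : Fin d, ∃ M : ℝ, ∀ x,
      ∑ j, pd i (fun y => pd j (fun z => V z + Real.log (a z ^ 2)) y) x ≤ M)
    (hκ : 0 < ⨅ x, (minEig (hess V x) - a x * diffOp V (fun y => (a y)⁻¹) x)) :
    ∀ f : EuclideanSpace ℝ (Fin d) → ℝ, ContDiff ℝ (⊤ : ℕ∞) f →
      (∀ x, 0 < f x) → (∀ (i : Fin d) x, 0 ≤ pd i f x) →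
      Integrable (fun x => f x ^ 2 * Real.log (f x ^ 2)) (gibbs V) →
      Integrable (fun x => f x ^ 2) (gibbs V) →
      Integrable (fun x => gradSq f x) (gibbs V) →
      entropy (gibbs V) (fun x => f x ^ 2) ≤
        (2 / ⨅ x, (minEig (hess V x) - a x * diffOp V (fun y => (a y)⁻¹) x)) *
          ∫ x, gradSq f x ∂(gibbs V) := by
  intro f hf hfp hfm i1 i2 i3
  have hle : (2 : WithTop ℕ∞) ≤ ((⊤ : ℕ∞) : WithTop ℕ∞) := WithTop.coe_le_coe.mpr le_top
  have hV2 : ContDiff ℝ 2 V := hV.of_le hle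
  have ha2 : ContDiff ℝ 2 a := ha.of_le hle
  have hf2 : ContDiff ℝ 2 f := hf.of_le hle
  have hal : ContDiff ℝ 2 (fun y => Real.log (a y)) := ha2.log fun x => (hapos x).ne'
  have hU : ContDiff ℝ 2 (fun z => V z + Real.log (a z ^ 2)) :=
    hV2.add ((ha2.pow 2).log fun x => (pow_pos (hapos x) 2).ne')
  have hl2 : ∀ z, Real.log (a z ^ 2) = 2 * Real.log (a z) := fun z => by rw [Real.log_pow]; norm_num
  have hq := Grid.vol_ineq hV2 hal hf2 hfp
    (fun i x t ht => Grid.mono_line (hal.differentiable (by norm_num)) i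
      (fun y => by rw [Grid.pd_log ha2 hapos]; exact div_nonneg (hamono i y) (hapos y).le) x ht) hfm
    (fun i j hij x t ht => by
      have := Grid.submod hU hBM1 hij x ht
      simpa only [hl2] using this) hκ (fun x y => Grid.Mc_ge ha2 hapos hconv hκ x y) hint
    (Grid.gib_integ hV.continuous hint i1) (Grid.gib_integ hV.continuous hint i2)
    (Grid.gib_integ hV.continuous hint i3)
  have hz := Grid.Z_pos hV.continuous hint
  rw [entropy, Grid.gib_int hV.continuous hint, Grid.gib_int hV.continuous hint,
    Grid.gib_int hV.continuous hint]
  simp only [Grid.Ph] at hq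
  have h := mul_le_mul_of_nonneg_left hq (inv_pos.mpr hz).le
  rw [sub_le_iff_le_add]
  refine h.trans (le_of_eq ?_)
  rw [div_eq_inv_mul _ (∫ x, Real.exp (-V x)), mul_add, add_comm, mul_left_comm]
  congr 1
  rw [mul_comm _ (∫ x, Real.exp (-V x)), inv_mul_cancel_left₀ hz.ne']
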